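/- arXiv:1009.0575 — 2 statements merged into one kernel-verified Lean document; each statement's English description precedes it below -/
import Mathlib

section
/- Let D be a circle contained in the annulus A with D ≠ C₀ and D ∩ C₀ ≠ ∅, and let U be a connected component of A \ D with U ∩ C₁ = ∅. Then every circle contained in U bounds a disk in A. -/
open Topology Set

/-- A circle in a topological space `X`: a subset homeomorphic to the unit circle. -/
def IsCircle {X : Type*} [TopologicalSpace X] (C : Set X) : Prop :=
  Nonempty (C ≃ₜ Circle)

/-- A circle decomposition of `X`: a set of pairwise disjoint circles whose union is `X`. -/
def IsCircleDecomposition {X : Type*} [TopologicalSpace X] (𝒞 : Set (Set X)) : Prop :=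
  (∀ C ∈ 𝒞, IsCircle C) ∧
  (∀ C ∈ 𝒞, ∀ D ∈ 𝒞, C ≠ D → Disjoint C D) ∧
  ⋃₀ 𝒞 = Set.univ

/-- A circle `C` bounds a disk in `X` if there is a topological embedding of the closed
unit disk into `X` carrying the boundary circle onto `C`. -/
def BoundsADisk {X : Type*} [TopologicalSpace X] (C : Set X) : Prop :=
  ∃ f : (Metric.closedBall (0 : EuclideanSpace ℝ (Fin 2)) 1) → X,
    Topology.IsEmbedding f ∧
    f '' {x | (x : EuclideanSpace ℝ (Fin 2)) ∈
      Metric.sphere (0 : EuclideanSpace ℝ (Fin 2)) 1} = C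

section ContinuousLogarithms

open Complex Metric

/-- `g` has a continuous logarithm on `K`. -/
def HasLogOn {X : Type*} [TopologicalSpace X] (g : X → ℂ) (K : Set X) : Prop :=
  ∃ h : X → ℂ, ContinuousOn h K ∧ ∀ z ∈ K, exp (h z) = g z

lemma Complex.eq_of_exp_eq_of_norm_sub_lt {x y : ℂ} (h : exp x = exp y) (hd : ‖x - y‖ < 6) :
    x = y := by
  obtain ⟨n, rfl⟩ := exp_eq_exp_iff_exists_int.1 h
  have h1 : ‖y + n * (2 * Real.pi * I) - y‖ = |(n : ℝ)| * (2 * Real.pi) := by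
    simp [abs_of_pos Real.pi_pos]
  rw [h1] at hd
  have h3 : |(n : ℝ)| < 1 := by
    by_contra! hn
    nlinarith [Real.pi_gt_three]
  have h4 : n = 0 := by
    rw [← Int.abs_lt_one_iff]; exact_mod_cast h3
  simp [h4]

lemma IsPreconnected.sub_eq_sub_of_exp_eq {X : Type*} [TopologicalSpace X] {S : Set X}
    (hS : IsPreconnected S) {f g : X → ℂ} (hf : ContinuousOn f S) (hg : ContinuousOn g S)
    (he : ∀ z ∈ S, exp (f z) = exp (g z)) {a b : X} (ha : a ∈ S) (hb : b ∈ S) :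
    f a - g a = f b - g b := by
  have h1 := isCoveringMap_exp.eqOn_of_comp_eqOn hS hf
    (g₂ := fun x => g x + (f a - g a)) (hg.add continuousOn_const) (fun z hz => ?_) ha (by ring)
  · have := h1 hb
    simp only at this
    rw [this]; ring
  · simp [exp_add, exp_sub, he z hz, he a ha]

namespace HasLogOn

variable {X : Type*} [TopologicalSpace X] {f g : X → ℂ} {K L : Set X}

lemma mono (h : HasLogOn g K) (hL : L ⊆ K) : HasLogOn g L := by
  obtain ⟨l, hl, he⟩ := h
  exact ⟨l, hl.mono hL, fun z hz => he z (hL hz)⟩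

lemma congr (h : HasLogOn g K) (hfg : ∀ z ∈ K, f z = g z) : HasLogOn f K := by
  obtain ⟨l, hl, he⟩ := h
  exact ⟨l, hl, fun z hz => by rw [he z hz, hfg z hz]⟩

lemma mul (hf : HasLogOn f K) (hg : HasLogOn g K) : HasLogOn (fun z => f z * g z) K := by
  obtain ⟨l, hl, he⟩ := hf
  obtain ⟨m, hm, he'⟩ := hg
  exact ⟨fun z => l z + m z, hl.add hm, fun z hz => by rw [exp_add, he z hz, he' z hz]⟩

lemma div (hf : HasLogOn f K) (hg : HasLogOn g K) : HasLogOn (fun z => f z / g z) K := by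
  obtain ⟨l, hl, he⟩ := hf
  obtain ⟨m, hm, he'⟩ := hg
  exact ⟨fun z => l z - m z, hl.sub hm, fun z hz => by rw [exp_sub, he z hz, he' z hz]⟩

lemma const {c : ℂ} (hc : c ≠ 0) : HasLogOn (fun _ : X => c) K :=
  ⟨fun _ => log c, continuousOn_const, fun _ _ => exp_log hc⟩

lemma of_slitPlane (hg : ContinuousOn g K) (h : ∀ z ∈ K, g z ∈ slitPlane) : HasLogOn g K :=
  ⟨fun z => log (g z), hg.clog h, fun z hz => exp_log (slitPlane_ne_zero (h z hz))⟩

lemma of_norm_sub_lt {c : ℂ} (hg : ContinuousOn g K) (h : ∀ z ∈ K, ‖g z - c‖ < ‖c‖) :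
    HasLogOn g K := by
  rcases K.eq_empty_or_nonempty with rfl | ⟨z₀, hz₀⟩
  · exact ⟨0, continuousOn_empty _, by simp⟩
  have hc : c ≠ 0 := by
    rintro rfl
    exact absurd (h z₀ hz₀) (by simp)
  have h1 : HasLogOn (fun z => g z / c) K := by
    refine of_slitPlane (hg.div_const c) fun z hz => ?_
    refine Or.inl ?_
    have h2 : ‖g z / c - 1‖ < 1 := by
      rw [div_sub_one hc, norm_div, div_lt_one (norm_pos_iff.2 hc)]
      exact h z hz
    have h3 := (abs_lt.1 ((abs_re_le_norm _).trans_lt h2)).1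
    simp only [sub_re, one_re] at h3
    linarith
  refine (h1.mul (const hc)).congr fun z _ => ?_
  field_simp

/-- Logarithms on two closed sets which agree on the intersection glue. -/
lemma union_of_eqOn {h₁ h₂ : X → ℂ} (hK : IsClosed K) (hL : IsClosed L)
    (c₁ : ContinuousOn h₁ K) (c₂ : ContinuousOn h₂ L) (e₁ : ∀ z ∈ K, exp (h₁ z) = g z)
    (e₂ : ∀ z ∈ L, exp (h₂ z) = g z) (h : ∀ z ∈ K ∩ L, h₁ z = h₂ z) : HasLogOn g (K ∪ L) := by
  classical
  have q1 : EqOn (K.piecewise h₁ h₂) h₁ K := piecewise_eqOn K h₁ h₂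
  have q2 : EqOn (K.piecewise h₁ h₂) h₂ L := by
    intro z hz
    by_cases hk : z ∈ K
    · rw [q1 hk, h z ⟨hk, hz⟩]
    · simp [hk]
  refine ⟨K.piecewise h₁ h₂, (c₁.congr q1).union_of_isClosed (c₂.congr q2) hK hL, ?_⟩
  rintro z (hz | hz)
  · rw [q1 hz, e₁ z hz]
  · rw [q2 hz, e₂ z hz]

/-- Logarithms on two closed sets with preconnected intersection glue. -/
lemma union_of_isPreconnected_inter (hK : IsClosed K) (hL : IsClosed L)
    (h : IsPreconnected (K ∩ L)) (h₁ : HasLogOn g K) (h₂ : HasLogOn g L) :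
    HasLogOn g (K ∪ L) := by
  obtain ⟨l, hl, he⟩ := h₁
  obtain ⟨m, hm, he'⟩ := h₂
  rcases (K ∩ L).eq_empty_or_nonempty with h0 | ⟨a, ha⟩
  · exact union_of_eqOn hK hL hl hm he he' (by simp [h0])
  · refine union_of_eqOn hK hL (h₂ := fun z => m z + (l a - m a)) hl
      (hm.add continuousOn_const) he (fun z hz => ?_) (fun z hz => ?_)
    · rw [exp_add, he' z hz, exp_sub, he a ha.1, he' a ha.2, div_self, mul_one]
      rw [← he a ha.1]; exact exp_ne_zero _
    · have := h.sub_eq_sub_of_exp_eq (hl.mono inter_subset_left) (hm.mono inter_subset_right)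
        (fun z hz => by rw [he z hz.1, he' z hz.2]) ha hz
      rw [this]; ring

/-- A nonvanishing continuous function on a contractible space has a logarithm. -/
lemma of_contractibleSpace [ContractibleSpace X] [LocallyPathConnectedSpace X]
    (hg : Continuous g) (h0 : ∀ z, g z ≠ 0) : HasLogOn g univ := by
  obtain ⟨h, hc, he⟩ := exists_continuousOn_eqOn_exp_comp (U := (univ : Set X)) (g := g)
    (by have := (Homeomorph.Set.univ X).contractibleSpace
        exact SimplyConnectedSpace.ofContractible _)
    isOpen_univ hg.continuousOn (by simpa using h0)
  exact ⟨h, hc, fun z hz => he hz⟩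

end HasLogOn

lemma not_exists_continuous_exp_eq_circle {r : ℝ} {φ : ℝ → ℂ} (hφ : Continuous φ)
    (hp : φ (2 * Real.pi) = φ 0) (he : ∀ t : ℝ, exp (φ t) = r * exp (t * I)) (hr : r ≠ 0) :
    False := by
  have h := isPreconnected_univ.sub_eq_sub_of_exp_eq (f := φ) (S := (univ : Set ℝ))
    (g := fun t : ℝ => log r + t * I) hφ.continuousOn (by fun_prop)
    (fun t _ => by rw [he, exp_add, exp_log (by exact_mod_cast hr)])
    (mem_univ 0) (mem_univ (2 * Real.pi))
  rw [hp] at h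
  simp [Real.pi_ne_zero] at h

/-- A set is logarithmically saturated when each `z - p`, `p` outside the set, has a
continuous logarithm on it. -/
def LogSaturated (K : Set ℂ) : Prop := ∀ p ∉ K, HasLogOn (fun z => z - p) K

lemma hasLogOn_sub_of_norm_lt {K : Set ℂ} {p : ℂ} (h : ∀ z ∈ K, ‖z‖ < ‖p‖) :
    HasLogOn (fun z => z - p) K :=
  HasLogOn.of_norm_sub_lt (c := -p) (by fun_prop) (by simpa using h)

lemma hasLogOn_sub_div_of_dist_lt {K : Set ℂ} {p q : ℂ} (h : ∀ z ∈ K, dist q p < dist z p) :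
    HasLogOn (fun z => (z - q) / (z - p)) K := by
  have h0 : ∀ z ∈ K, z - p ≠ 0 := fun z hz =>
    sub_ne_zero.2 (dist_pos.1 (dist_nonneg.trans_lt (h z hz)))
  refine HasLogOn.of_norm_sub_lt (c := 1) ?_ fun z hz => ?_
  · exact ContinuousOn.div (by fun_prop) (by fun_prop) h0
  · rw [div_sub_one (h0 z hz), norm_div, norm_one, div_lt_one (norm_pos_iff.2 (h0 z hz))]
    have := h z hz
    rw [dist_eq, dist_eq, norm_sub_rev] at this
    simpa using this

/-- Points of a connected set off `K` are not separated by `K`. -/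
lemma IsPreconnected.hasLogOn_sub_div {K V : Set ℂ} (hK : IsClosed K) (hV : IsPreconnected V)
    (hd : Disjoint V K) {p q : ℂ} (hp : p ∈ V) (hq : q ∈ V) :
    HasLogOn (fun z => (z - q) / (z - p)) K := by
  have hnear : ∀ x ∉ K, ∃ ε > 0, ∀ z ∈ K, ε ≤ dist z x := by
    intro x hx
    obtain ⟨ε, h0, hε⟩ := Metric.isOpen_iff.1 hK.isOpen_compl x hx
    exact ⟨ε, h0, fun z hz => not_lt.1 fun hlt => hε hlt hz⟩
  let u : Set ℂ := {x | x ∉ K ∧ HasLogOn (fun z => (z - x) / (z - p)) K}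
  have step : ∀ x y, x ∈ u → y ∉ K → (∀ z ∈ K, dist y x < dist z x) → y ∈ u := by
    intro x y hx hy h
    refine ⟨hy, ((hasLogOn_sub_div_of_dist_lt h).mul hx.2).congr fun z hz => ?_⟩
    rw [div_mul_div_cancel₀ (sub_ne_zero.2 (ne_of_mem_of_not_mem hz hx.1))]
  have hpK := disjoint_left.1 hd hp
  have hu : V ⊆ u := by
    refine hV.subset_of_closure_inter_subset ?_ ⟨p, hp, hpK, ?_⟩ ?_
    · rw [Metric.isOpen_iff]
      intro x hx
      obtain ⟨ε, h0, hε⟩ := hnear x hx.1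
      exact ⟨ε, h0, fun y hy => step x y hx
        (fun hyK => absurd (mem_ball.1 hy) (not_lt.2 (hε y hyK)))
        fun z hz => (mem_ball.1 hy).trans_le (hε z hz)⟩
    · exact (HasLogOn.const one_ne_zero).congr fun z hz =>
        div_self (sub_ne_zero.2 (ne_of_mem_of_not_mem hz hpK))
    · rintro x ⟨hx, hxV⟩
      have hxK := disjoint_left.1 hd hxV
      obtain ⟨ε, h0, hε⟩ := hnear x hxK
      obtain ⟨y, hy, hxy⟩ := Metric.mem_closure_iff.1 hx (ε / 2) (half_pos h0)
      refine step y x hy hxK fun z hz => ?_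
      have := dist_triangle z y x
      have := hε z hz
      rw [dist_comm y x] at *
      linarith
  exact (hu hq).2

lemma IsPreconnected.hasLogOn_sub {K V : Set ℂ} (hK : IsClosed K) (hV : IsPreconnected V)
    (hd : Disjoint V K) {p q : ℂ} (hp : p ∈ V) (hq : q ∈ V)
    (h : HasLogOn (fun z => z - p) K) : HasLogOn (fun z => z - q) K :=
  ((hV.hasLogOn_sub_div hK hd hp hq).mul h).congr fun _ hz => by
    rw [div_mul_cancel₀ _ (sub_ne_zero.2 (ne_of_mem_of_not_mem hz (disjoint_left.1 hd hp)))]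

lemma isPreconnected_setOf_lt_norm {R : ℝ} (hR : 0 < R) : IsPreconnected {z : ℂ | R < ‖z‖} := by
  have h : {z : ℂ | R < ‖z‖} = exp '' {w | Real.log R < w.re} := by
    ext z
    constructor
    · intro hz
      have hz0 : 0 < ‖z‖ := hR.trans hz
      refine ⟨log z, ?_, exp_log (norm_pos_iff.1 hz0)⟩
      simpa [log_re] using Real.log_lt_log hR hz
    · rintro ⟨w, hw, rfl⟩
      simpa [norm_exp, Real.log_lt_iff_lt_exp hR] using hw
  rw [h]
  exact ((convex_halfSpace_re_gt _).isPreconnected).image _ continuous_exp.continuousOn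

lemma logSaturated_of_isPreconnected_compl {K : Set ℂ} (hK : IsCompact K)
    (h : IsPreconnected Kᶜ) : LogSaturated K := by
  intro p hp
  obtain ⟨R, hR⟩ := hK.isBounded.subset_ball 0
  have h0 : ∀ z ∈ K, ‖z‖ < ‖((|R| : ℝ) : ℂ)‖ := fun z hz => by
    simpa using (mem_ball_zero_iff.1 (hR hz)).trans_le (le_abs_self R)
  refine h.hasLogOn_sub hK.isClosed disjoint_compl_left (p := ((|R| : ℝ) : ℂ)) ?_ hp
    (hasLogOn_sub_of_norm_lt h0)
  exact fun hmem => lt_irrefl _ (h0 _ hmem)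

lemma Convex.logSaturated {K : Set ℂ} (hK : Convex ℝ K) (hc : IsClosed K) : LogSaturated K := by
  intro p hp
  obtain ⟨f, u, h1, h2⟩ := geometric_hahn_banach_point_closed hK hc hp
  let c : ℂ := ⟨f 1, -f I⟩
  have hf : ∀ z, (c * z).re = f z := by
    intro z
    have : z = z.re • (1 : ℂ) + z.im • I := by simp [re_add_im]
    conv_rhs => rw [this, map_add, map_smul, map_smul]
    simp [c, mul_re]; ring
  have hpos : ∀ z ∈ K, 0 < (c * (z - p)).re := fun z hz => by
    rw [hf, map_sub]; linarith [h2 z hz]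
  rcases K.eq_empty_or_nonempty with rfl | ⟨z₀, hz₀⟩
  · exact ⟨0, continuousOn_empty _, by simp⟩
  have hc0 : c ≠ 0 := by
    intro h0
    have := hpos z₀ hz₀
    simp [h0] at this
  have h3 : HasLogOn (fun z => c * (z - p)) K :=
    HasLogOn.of_slitPlane (by fun_prop) fun z hz => Or.inl (hpos z hz)
  refine (h3.div (HasLogOn.const hc0)).congr fun z _ => ?_
  field_simp

lemma LogSaturated.inter {K L : Set ℂ} (hK : LogSaturated K) (hL : LogSaturated L) :
    LogSaturated (K ∩ L) := by
  intro p hp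
  by_cases h : p ∈ K
  · exact (hL p fun h' => hp ⟨h, h'⟩).mono inter_subset_right
  · exact (hK p h).mono inter_subset_left

end ContinuousLogarithms

section PlaneLogarithms

open Complex Metric

/-- For `p` on the line `Re (z / u) = b` and outside `K`, there are logarithms of `1` on the two
halves of `K` which agree on the lower part of the line and differ by a prescribed
period on its upper part. -/
lemma LogSaturated.exists_jump {K : Set ℂ} (hs : LogSaturated K) {u : ℂ} (hu : u ≠ 0) (b t : ℝ)
    (hp : u * (b + t * I) ∉ K) (n : ℤ) :
    ∃ e₁ e₂ : ℂ → ℂ, ContinuousOn e₁ (K ∩ {z | (z / u).re ≤ b}) ∧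
      ContinuousOn e₂ (K ∩ {z | b ≤ (z / u).re}) ∧
      (∀ z ∈ K ∩ {z | (z / u).re ≤ b}, exp (e₁ z) = 1) ∧
      (∀ z ∈ K ∩ {z | b ≤ (z / u).re}, exp (e₂ z) = 1) ∧
      (∀ s < t, e₁ (u * (b + s * I)) - e₂ (u * (b + s * I)) = 0) ∧
      (∀ s > t, e₁ (u * (b + s * I)) - e₂ (u * (b + s * I)) = n * (2 * Real.pi * I)) := by
  set p : ℂ := u * (b + t * I) with hpdef
  obtain ⟨l, hl, he⟩ := hs p hp
  have hpu : p / u = b + t * I := by rw [hpdef]; field_simp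
  have hre : ∀ z, ((z - p) / u).re = (z / u).re - b := fun z => by
    rw [sub_div, hpu]; simp
  have hne : ∀ z ∈ K, (z - p) / u ≠ 0 := fun z hz =>
    div_ne_zero (sub_ne_zero.2 (ne_of_mem_of_not_mem hz hp)) hu
  have hslit : ∀ w : ℂ, 0 ≤ w.re → w ≠ 0 → w ∈ slitPlane := by
    intro w hw h0
    rcases hw.lt_or_eq with h | h
    · exact Or.inl h
    · exact Or.inr fun hi => h0 (Complex.ext h.symm hi)
  have hs1 : ∀ z ∈ K ∩ {z | (z / u).re ≤ b}, -((z - p) / u) ∈ slitPlane := by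
    rintro z ⟨hz, hb⟩
    refine hslit _ ?_ (neg_ne_zero.2 (hne z hz))
    rw [neg_re, hre]
    have : (z / u).re ≤ b := hb
    linarith
  have hs2 : ∀ z ∈ K ∩ {z | b ≤ (z / u).re}, (z - p) / u ∈ slitPlane := by
    rintro z ⟨hz, hb⟩
    refine hslit _ ?_ (hne z hz)
    rw [hre]
    have : b ≤ (z / u).re := hb
    linarith
  have hexp : ∀ (m : ℤ) (a z : ℂ), z ∈ K → exp a = z - p → exp (m * (a - l z)) = 1 := by
    intro m a z hz ha
    rw [exp_int_mul, exp_sub, ha, he z hz, div_self (sub_ne_zero.2 (ne_of_mem_of_not_mem hz hp)), one_zpow]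
  have hq : ∀ s : ℝ, (u * (b + s * I) - p) / u = ((s - t : ℝ) : ℂ) * I := fun s => by
    rw [hpdef]; field_simp; push_cast; ring
  refine ⟨fun z => (-n : ℤ) * (log (-((z - p) / u)) - Real.pi * I + log u - l z),
    fun z => (-n : ℤ) * (log ((z - p) / u) + log u - l z), ?_, ?_, ?_, ?_, ?_, ?_⟩
  · refine continuousOn_const.mul ((ContinuousOn.add (ContinuousOn.sub
      (ContinuousOn.clog (by fun_prop) hs1) continuousOn_const) continuousOn_const).sub
      (hl.mono inter_subset_left))
  · refine continuousOn_const.mul ((ContinuousOn.add (ContinuousOn.clog (by fun_prop) hs2)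
      continuousOn_const).sub (hl.mono inter_subset_left))
  · rintro z hz
    refine hexp _ _ _ hz.1 ?_
    rw [exp_add, exp_sub, exp_pi_mul_I, exp_log hu, exp_log (slitPlane_ne_zero (hs1 z hz))]
    field_simp
  · rintro z hz
    refine hexp _ _ _ hz.1 ?_
    rw [exp_add, exp_log hu, exp_log (slitPlane_ne_zero (hs2 z hz))]
    field_simp
  · intro s hst
    have h0 : 0 < t - s := sub_pos.2 hst
    have e1 : -(((s - t : ℝ) : ℂ) * I) = ((t - s : ℝ) : ℂ) * I := by push_cast; ring
    have e2 : ((s - t : ℝ) : ℂ) * I = ((t - s : ℝ) : ℂ) * (-I) := by push_cast; ring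
    simp only [hq]
    rw [e1, e2, log_ofReal_mul h0 I_ne_zero, log_ofReal_mul h0 (neg_ne_zero.2 I_ne_zero), log_I,
      log_neg_I]
    ring
  · intro s hst
    have h0 : 0 < s - t := sub_pos.2 hst
    have e1 : -(((s - t : ℝ) : ℂ) * I) = ((s - t : ℝ) : ℂ) * (-I) := by push_cast; ring
    simp only [hq]
    rw [e1, log_ofReal_mul h0 I_ne_zero, log_ofReal_mul h0 (neg_ne_zero.2 I_ne_zero), log_I,
      log_neg_I]
    push_cast
    ring

lemma LogSaturated.hasLogOn_of_halfPlanes {K : Set ℂ} (hK : IsCompact K) (hs : LogSaturated K)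
    {u : ℂ} (hu : u ≠ 0) (b : ℝ) {g : ℂ → ℂ} (h₁ : HasLogOn g (K ∩ {z | (z / u).re ≤ b}))
    (h₂ : HasLogOn g (K ∩ {z | b ≤ (z / u).re})) : HasLogOn g K := by
  obtain ⟨l₁, c₁, x₁⟩ := h₁
  obtain ⟨l₂, c₂, x₂⟩ := h₂
  set q : ℝ → ℂ := fun s => u * (b + s * I) with hq
  have hqc : Continuous q := by fun_prop
  have hqu : ∀ s, q s / u = b + s * I := fun s => by simp only [hq]; field_simp
  have hqre : ∀ s, (q s / u).re = b := fun s => by simp [hqu]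
  have hqim : ∀ s, (q s / u).im = s := fun s => by simp [hqu]
  have hq1 : ∀ s, q s ∈ K → q s ∈ K ∩ {z | (z / u).re ≤ b} := fun s h => ⟨h, (hqre s).le⟩
  have hq2 : ∀ s, q s ∈ K → q s ∈ K ∩ {z | b ≤ (z / u).re} := fun s h => ⟨h, (hqre s).ge⟩
  have hLc : IsCompact (q ⁻¹' K) := by
    refine IsCompact.of_isClosed_subset (hK.image (f := fun z => (z / u).im) (by fun_prop))
      (hK.isClosed.preimage hqc) fun s hsK => ⟨q s, hsK, hqim s⟩
  set D : ℝ → ℂ := fun s => l₁ (q s) - l₂ (q s) with hD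
  have hDc : ContinuousOn D (q ⁻¹' K) :=
    (c₁.comp hqc.continuousOn fun s h => hq1 s h).sub (c₂.comp hqc.continuousOn fun s h => hq2 s h)
  have hDe : ∀ s, q s ∈ K → exp (D s) = 1 := fun s h => by
    rw [hD]
    simp only
    rw [exp_sub, x₁ _ (hq1 s h), x₂ _ (hq2 s h), div_self]
    rw [← x₁ _ (hq1 s h)]; exact exp_ne_zero _
  obtain ⟨δ, hδ, hδD⟩ : ∃ δ > 0, ∀ s s', q s ∈ K → q s' ∈ K → |s - s'| ≤ δ → D s = D s' := by
    obtain ⟨δ, h0, h⟩ := Metric.uniformContinuousOn_iff.1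
      (hLc.uniformContinuousOn_of_continuous hDc) 6 (by norm_num)
    refine ⟨δ / 2, half_pos h0, fun s s' h1 h2 h3 => ?_⟩
    refine eq_of_exp_eq_of_norm_sub_lt (by rw [hDe s h1, hDe s' h2]) ?_
    rw [← Complex.dist_eq]
    exact h s h1 s' h2 (by rw [Real.dist_eq]; linarith)
  obtain ⟨M, hM⟩ := hLc.isBounded.subset_ball 0
  have hM' : ∀ s, q s ∈ K → |s| < M := fun s h => by simpa using hM h
  have key : ∀ k : ℕ, ∃ e₁ e₂ : ℂ → ℂ, ∃ n : ℤ, ContinuousOn e₁ (K ∩ {z | (z / u).re ≤ b}) ∧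
      ContinuousOn e₂ (K ∩ {z | b ≤ (z / u).re}) ∧
      (∀ z ∈ K ∩ {z | (z / u).re ≤ b}, exp (e₁ z) = 1) ∧
      (∀ z ∈ K ∩ {z | b ≤ (z / u).re}, exp (e₂ z) = 1) ∧
      (∀ s ≤ -M + k * δ, q s ∈ K → e₁ (q s) - e₂ (q s) = D s) ∧
      (∀ s ≥ -M + k * δ, q s ∈ K → e₁ (q s) - e₂ (q s) = n * (2 * Real.pi * I)) := by
    intro k
    induction k with
    | zero =>
      refine ⟨0, 0, 0, continuousOn_const, continuousOn_const, by simp, by simp, ?_, by simp⟩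
      intro s hs' hsK
      have := (abs_lt.1 (hM' s hsK)).1
      simp only [Nat.cast_zero, zero_mul, add_zero] at hs'
      linarith
    | succ k ih =>
      obtain ⟨e₁, e₂, n, k₁, k₂, y₁, y₂, hlo, hhi⟩ := ih
      set t : ℝ := -M + k * δ with ht
      have ht' : -M + ((k + 1 : ℕ) : ℝ) * δ = t + δ := by rw [ht]; push_cast; ring
      rw [ht']
      by_cases hex : ∃ τ, q τ ∈ K ∧ t < τ ∧ τ ≤ t + δ
      · obtain ⟨τ, hτK, hτ1, hτ2⟩ := hex
        obtain ⟨m, hm⟩ := exp_eq_one_iff.1 (hDe τ hτK)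
        obtain ⟨j₁, j₂, a₁, a₂, z₁, z₂, jlo, jhi⟩ : ∃ j₁ j₂ : ℂ → ℂ,
            ContinuousOn j₁ (K ∩ {z | (z / u).re ≤ b}) ∧
            ContinuousOn j₂ (K ∩ {z | b ≤ (z / u).re}) ∧
            (∀ z ∈ K ∩ {z | (z / u).re ≤ b}, exp (j₁ z) = 1) ∧
            (∀ z ∈ K ∩ {z | b ≤ (z / u).re}, exp (j₂ z) = 1) ∧
            (∀ s ≤ t, q s ∈ K → j₁ (q s) - j₂ (q s) = 0) ∧
            (∀ s > t, q s ∈ K → j₁ (q s) - j₂ (q s) = (m - n : ℤ) * (2 * Real.pi * I)) := by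
          by_cases hp : q t ∈ K
          · have hnm : (m - n : ℤ) * (2 * Real.pi * I) = (0 : ℂ) := by
              have h1 := hlo t le_rfl hp
              rw [hhi t le_rfl hp, hδD t τ hp hτK (by rw [abs_le]; constructor <;> linarith),
                hm] at h1
              push_cast
              rw [sub_mul, h1, sub_self]
            exact ⟨0, 0, continuousOn_const, continuousOn_const, by simp, by simp, by simp,
              fun s _ _ => by rw [hnm]; simp⟩
          · obtain ⟨j₁, j₂, a₁, a₂, z₁, z₂, jlo, jhi⟩ := hs.exists_jump hu b t hp (m - n)
            refine ⟨j₁, j₂, a₁, a₂, z₁, z₂, fun s hst hsK => jlo s (lt_of_le_of_ne hst ?_),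
              fun s hst _ => jhi s hst⟩
            rintro rfl
            exact hp hsK
        refine ⟨fun z => e₁ z + j₁ z, fun z => e₂ z + j₂ z, m, k₁.add a₁, k₂.add a₂,
          fun z hz => by rw [exp_add, y₁ z hz, z₁ z hz, one_mul],
          fun z hz => by rw [exp_add, y₂ z hz, z₂ z hz, one_mul], ?_, ?_⟩
        · intro s hsd hsK
          rcases le_or_gt s t with h | h
          · linear_combination hlo s h hsK + jlo s h hsK
          · have h1 := hδD s τ hsK hτK (by rw [abs_le]; constructor <;> linarith)
            have h2 := jhi s h hsK
            push_cast at h2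
            linear_combination hhi s h.le hsK + h2 - h1 - hm
        · intro s hsd hsK
          have h : t < s := by linarith
          have h2 := jhi s h hsK
          push_cast at h2
          linear_combination hhi s h.le hsK + h2
      · refine ⟨e₁, e₂, n, k₁, k₂, y₁, y₂, fun s hsd hsK => ?_,
          fun s hsd hsK => hhi s (by linarith) hsK⟩
        rcases le_or_gt s t with h | h
        · exact hlo s h hsK
        · exact absurd ⟨s, hsK, h, hsd⟩ hex
  obtain ⟨k, hk⟩ := exists_nat_gt (2 * M / δ)
  rw [div_lt_iff₀ hδ] at hk
  obtain ⟨e₁, e₂, n, k₁, k₂, y₁, y₂, hlo, -⟩ := key k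
  have hu1 : K = K ∩ {z | (z / u).re ≤ b} ∪ K ∩ {z | b ≤ (z / u).re} := by
    ext z
    simp only [mem_union, mem_inter_iff, mem_ofPred_eq]
    have := le_total (z / u).re b
    tauto
  rw [hu1]
  have hcre : Continuous fun z : ℂ => (z / u).re := by fun_prop
  refine HasLogOn.union_of_eqOn (h₁ := fun z => l₁ z - e₁ z) (h₂ := fun z => l₂ z - e₂ z)
    (hK.isClosed.inter (isClosed_le hcre continuous_const))
    (hK.isClosed.inter (isClosed_le continuous_const hcre)) (c₁.sub k₁) (c₂.sub k₂)
    (fun z hz => by rw [exp_sub, x₁ z hz, y₁ z hz, div_one])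
    (fun z hz => by rw [exp_sub, x₂ z hz, y₂ z hz, div_one]) ?_
  rintro z ⟨⟨hzK, hz1⟩, -, hz2⟩
  have hzq : z = q (z / u).im := by
    have h1 : z / u = b + (z / u).im * I := by
      apply Complex.ext <;> simp
      exact le_antisymm hz1 hz2
    simp only [hq]
    rw [← h1]; field_simp
  have h2 := hlo (z / u).im (by
    have := (abs_lt.1 (hM' (z / u).im (hzq ▸ hzK))).2
    linarith) (hzq ▸ hzK)
  rw [hD] at h2
  simp only at h2
  rw [← hzq] at h2
  linear_combination -h2

/-- On a compact logarithmically saturated plane set every nonvanishing continuous function has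
a continuous logarithm. -/
theorem LogSaturated.hasLogOn {K : Set ℂ} (hK : IsCompact K) (hs : LogSaturated K) {g : ℂ → ℂ}
    (hg : ContinuousOn g K) (h0 : ∀ z ∈ K, g z ≠ 0) : HasLogOn g K := by
  rcases K.eq_empty_or_nonempty with rfl | hne
  · exact ⟨0, continuousOn_empty _, by simp⟩
  obtain ⟨z₀, hz₀, hmin⟩ := hK.exists_isMinOn hne hg.norm
  obtain ⟨δ, hδ, hu⟩ := Metric.uniformContinuousOn_iff.1
    (hK.uniformContinuousOn_of_continuous hg) ‖g z₀‖ (norm_pos_iff.2 (h0 z₀ hz₀))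
  obtain ⟨R, hR⟩ := hK.isBounded.subset_ball 0
  obtain ⟨η, hη, hηδ⟩ : ∃ η > 0, η + η < δ := ⟨δ / 3, by positivity, by linarith⟩
  let B : ℝ → ℝ → ℝ → ℝ → Set ℂ := fun x₁ x₂ y₁ y₂ => Icc x₁ x₂ ×ℂ Icc y₁ y₂
  have hB : ∀ x₁ x₂ y₁ y₂, IsClosed (B x₁ x₂ y₁ y₂) ∧ Convex ℝ (B x₁ x₂ y₁ y₂) := fun _ _ _ _ =>
    ⟨isClosed_Icc.reProdIm isClosed_Icc, ((convex_Icc _ _).linear_preimage reLm).inter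
      ((convex_Icc _ _).linear_preimage imLm)⟩
  have hKB : ∀ x₁ x₂ y₁ y₂, IsCompact (K ∩ B x₁ x₂ y₁ y₂) ∧ LogSaturated (K ∩ B x₁ x₂ y₁ y₂) :=
    fun _ _ _ _ => ⟨hK.inter_right (hB _ _ _ _).1,
      hs.inter ((hB _ _ _ _).2.logSaturated (hB _ _ _ _).1)⟩
  have small : ∀ x y, HasLogOn g (K ∩ B x (x + η) y (y + η)) := by
    intro x y
    rcases (K ∩ B x (x + η) y (y + η)).eq_empty_or_nonempty with h | ⟨w, hwK, hw⟩
    · rw [h]; exact ⟨0, continuousOn_empty _, by simp⟩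
    · refine HasLogOn.of_norm_sub_lt (c := g w) (hg.mono inter_subset_left) ?_
      rintro z ⟨hzK, hz⟩
      refine lt_of_lt_of_le ?_ (hmin hwK)
      rw [← dist_eq_norm]
      refine hu z hzK w hwK ?_
      rw [dist_eq_norm]
      refine (norm_le_abs_re_add_abs_im _).trans_lt (lt_of_le_of_lt ?_ hηδ)
      obtain ⟨⟨a1, a2⟩, a3, a4⟩ := hz
      obtain ⟨⟨b1, b2⟩, b3, b4⟩ := hw
      refine add_le_add ?_ ?_ <;> simp only [sub_re, sub_im, abs_le] <;> constructor <;> linarith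
  have column : ∀ (x : ℝ) (k : ℕ), HasLogOn g (K ∩ B x (x + η) (-R) (-R + k * η)) := by
    intro x k
    induction k with
    | zero =>
      refine (small x (-R)).mono fun z hz => ⟨hz.1, hz.2.1, hz.2.2.1, ?_⟩
      have := hz.2.2.2
      simp only [Nat.cast_zero, zero_mul, add_zero] at this
      linarith
    | succ k ih =>
      have hI : ∀ z : ℂ, (z / I).re = z.im := fun z => by simp [div_I]
      refine (hKB _ _ _ _).2.hasLogOn_of_halfPlanes (hKB _ _ _ _).1 I_ne_zero (-R + k * η)
        (ih.mono ?_) ((small x (-R + k * η)).mono ?_)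
      · rintro z ⟨⟨hzK, hz1, hz2, hz3⟩, hz4⟩
        simp only [hI, mem_ofPred_eq] at hz4
        exact ⟨hzK, hz1, hz2, hz4⟩
      · rintro z ⟨⟨hzK, hz1, hz2, hz3⟩, hz4⟩
        simp only [hI, mem_ofPred_eq] at hz4
        refine ⟨hzK, hz1, hz4, hz3.trans ?_⟩
        push_cast; linarith
  obtain ⟨k, hk⟩ := exists_nat_gt (2 * R / η)
  rw [div_lt_iff₀ hη] at hk
  have hKR : ∀ z ∈ K, z.re ∈ Icc (-R) (-R + k * η) ∧ z.im ∈ Icc (-R) (-R + k * η) := by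
    intro z hz
    have h1 := mem_ball_zero_iff.1 (hR hz)
    have h2 := abs_le.1 (abs_re_le_norm z)
    have h3 := abs_le.1 (abs_im_le_norm z)
    refine ⟨⟨?_, ?_⟩, ?_, ?_⟩ <;> linarith
  have rows : ∀ j : ℕ, HasLogOn g (K ∩ B (-R) (-R + j * η) (-R) (-R + k * η)) := by
    intro j
    induction j with
    | zero =>
      refine (column (-R) k).mono fun z hz => ⟨hz.1, ⟨hz.2.1.1, ?_⟩, hz.2.2⟩
      have := hz.2.1.2
      simp only [Nat.cast_zero, zero_mul, add_zero] at this
      linarith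
    | succ j ih =>
      refine (hKB _ _ _ _).2.hasLogOn_of_halfPlanes (hKB _ _ _ _).1 one_ne_zero (-R + j * η)
        (ih.mono ?_) ((column (-R + j * η) k).mono ?_)
      · rintro z ⟨⟨hzK, hz1, hz2⟩, hz4⟩
        simp only [div_one, mem_ofPred_eq] at hz4
        exact ⟨hzK, ⟨hz1.1, hz4⟩, hz2⟩
      · rintro z ⟨⟨hzK, hz1, hz2⟩, hz4⟩
        simp only [div_one, mem_ofPred_eq] at hz4
        refine ⟨hzK, ⟨hz4, hz1.2.trans ?_⟩, hz2⟩
        push_cast; linarith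
  exact (rows k).mono fun z hz => ⟨hz, hKR z hz⟩

/-- Borsuk's criterion: `z - p` has no continuous logarithm on the frontier of a bounded open
set containing `p`, even after division by a function not vanishing on the closed set. -/
theorem not_hasLogOn_sub_div {K W : Set ℂ} (hK : IsClosed K) (hW : IsOpen W)
    (hb : Bornology.IsBounded W) (hf : frontier W ⊆ K) {p : ℂ} (hp : p ∈ W) {ψ : ℂ → ℂ}
    (hψ : ContinuousOn ψ (closure W)) (hψ0 : ∀ z ∈ closure W, ψ z ≠ 0) :
    ¬ HasLogOn (fun z => (z - p) / ψ z) K := by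
  classical
  rintro ⟨h, hc, he⟩
  obtain ⟨H, hH⟩ := ContinuousMap.exists_restrict_eq hK ⟨K.domRestrict h, hc.domRestrict⟩
  have hH' : ∀ z ∈ K, H z = h z := fun z hz => DFunLike.congr_fun hH ⟨z, hz⟩
  have hnW : frontier W ∩ W = ∅ := by rw [hW.frontier_eq]; simp
  let F : ℂ → ℂ := (closure W).piecewise (fun z => exp (H z) * ψ z) fun z => z - p
  have hF1 : EqOn F (fun z => exp (H z) * ψ z) (closure W) := piecewise_eqOn _ _ _
  have hF2 : EqOn F (fun z => z - p) Wᶜ := by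
    intro z hz
    by_cases hcl : z ∈ closure W
    · rw [hF1 hcl]
      have hzK : z ∈ K := hf (by rw [hW.frontier_eq]; exact ⟨hcl, hz⟩)
      simp only
      rw [hH' z hzK, he z hzK, div_mul_cancel₀ _ (hψ0 z hcl)]
    · simp [F, hcl]
  have hun : closure W ∪ Wᶜ = univ := by
    rw [eq_univ_iff_forall]
    intro z
    by_cases hz : z ∈ W
    · exact Or.inl (subset_closure hz)
    · exact Or.inr hz
  have hFc : Continuous F := by
    rw [← continuousOn_univ, ← hun]
    refine ContinuousOn.union_of_isClosed ?_ ?_ isClosed_closure hW.isClosed_compl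
    · exact ContinuousOn.congr (ContinuousOn.mul (by fun_prop) hψ) hF1
    · exact ContinuousOn.congr (by fun_prop) hF2
  have hF0 : ∀ z, F z ≠ 0 := by
    intro z
    by_cases hz : z ∈ W
    · rw [hF1 (subset_closure hz)]
      exact mul_ne_zero (exp_ne_zero _) (hψ0 z (subset_closure hz))
    · rw [hF2 hz]
      exact sub_ne_zero.2 fun h => hz (h ▸ hp)
  obtain ⟨L, hLc, hLe⟩ := HasLogOn.of_contractibleSpace hFc hF0
  obtain ⟨R, hR⟩ := hb.subset_ball p
  have hR0 : 0 < R := by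
    have := hR hp
    simpa using this
  rw [continuousOn_univ] at hLc
  refine not_exists_continuous_exp_eq_circle (r := R) (φ := fun t => L (p + R * exp (t * I)))
    (by fun_prop) ?_ (fun t => ?_) hR0.ne'
  · simp [exp_two_pi_mul_I]
  · rw [hLe _ (mem_univ _), hF2]
    · ring
    · intro hmem
      have := hR hmem
      simp [norm_exp, abs_of_pos hR0] at this

lemma frontier_subset_of_connectedComponentIn {K : Set ℂ} (hK : IsClosed K) (w : ℂ) :
    frontier (connectedComponentIn Kᶜ w) ⊆ K := by
  intro z hz
  by_contra hzK
  have hop : IsOpen (connectedComponentIn Kᶜ w) := hK.isOpen_compl.connectedComponentIn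
  rw [hop.frontier_eq] at hz
  have h1 : IsOpen (connectedComponentIn Kᶜ z) := hK.isOpen_compl.connectedComponentIn
  obtain ⟨y, hy1, hy2⟩ := mem_closure_iff.1 hz.1 _ h1 (mem_connectedComponentIn hzK)
  have h2 := connectedComponentIn_eq hy1
  rw [← connectedComponentIn_eq hy2] at h2
  exact hz.2 (h2 ▸ mem_connectedComponentIn hzK)

/-- The unbounded components of the complement of a bounded plane set contain a common
neighbourhood of infinity. -/
lemma exists_forall_subset_connectedComponentIn {K : Set ℂ} (hK : Bornology.IsBounded K) :
    ∃ R > 0, {z : ℂ | R < ‖z‖} ⊆ Kᶜ ∧ ∀ w, ¬ Bornology.IsBounded (connectedComponentIn Kᶜ w) →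
      {z : ℂ | R < ‖z‖} ⊆ connectedComponentIn Kᶜ w := by
  obtain ⟨R, hR⟩ := hK.subset_ball 0
  have hR1 : 0 < max R 1 := by positivity
  have hfar : {z : ℂ | max R 1 < ‖z‖} ⊆ Kᶜ := fun z hz hzK => by
    have h1 := mem_ball_zero_iff.1 (hR hzK)
    have h2 : max R 1 < ‖z‖ := hz
    linarith [le_max_left R 1]
  refine ⟨max R 1, hR1, hfar, fun w hw => ?_⟩
  have : ∃ y ∈ connectedComponentIn Kᶜ w, max R 1 < ‖y‖ := by
    by_contra! hcon
    exact hw ((isBounded_closedBall (x := (0 : ℂ)) (r := max R 1)).subset fun y hy => by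
      simpa using hcon y hy)
  obtain ⟨y, hy, hyR⟩ := this
  rw [connectedComponentIn_eq hy]
  exact (isPreconnected_setOf_lt_norm hR1).subset_connectedComponentIn hyR hfar

lemma exists_lt_norm (R : ℝ) : ∃ z : ℂ, R < ‖z‖ :=
  ⟨((|R| + 1 : ℝ) : ℂ), by
    rw [norm_real, Real.norm_eq_abs]
    exact (le_abs_self R).trans_lt ((lt_add_one _).trans_le (le_abs_self _))⟩

/-- Points outside a compact plane set `K` in different components of the complement: then
`(z - p) / (z - q)` has no logarithm on `K`. -/
theorem mem_connectedComponentIn_of_hasLogOn {K : Set ℂ} (hK : IsCompact K) {p q : ℂ}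
    (hp : p ∉ K) (hq : q ∉ K) (h : HasLogOn (fun z => (z - p) / (z - q)) K) :
    q ∈ connectedComponentIn Kᶜ p := by
  by_contra hne
  have hop : ∀ w, IsOpen (connectedComponentIn Kᶜ w) := fun w =>
    hK.isClosed.isOpen_compl.connectedComponentIn
  have hne' : p ∉ connectedComponentIn Kᶜ q := fun hmem => hne <| by
    rw [← connectedComponentIn_eq hmem]; exact mem_connectedComponentIn hq
  have main : ∀ {a b : ℂ}, a ∉ K → b ∉ K → b ∉ connectedComponentIn Kᶜ a →
      HasLogOn (fun z => (z - a) / (z - b)) K →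
      ¬ Bornology.IsBounded (connectedComponentIn Kᶜ a) := by
    intro a b ha hb' hab hl hbd
    refine not_hasLogOn_sub_div hK.isClosed (hop a) hbd
      (frontier_subset_of_connectedComponentIn hK.isClosed a) (mem_connectedComponentIn ha)
      (ψ := fun z => z - b) (by fun_prop) (fun z hz => sub_ne_zero.2 ?_) hl
    rintro rfl
    have : z ∈ frontier (connectedComponentIn Kᶜ a) := by
      rw [(hop a).frontier_eq]; exact ⟨hz, hab⟩
    exact hb' (frontier_subset_of_connectedComponentIn hK.isClosed a this)
  have hl' : HasLogOn (fun z => (z - q) / (z - p)) K := by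
    refine ((HasLogOn.const one_ne_zero).div h).congr fun z _ => ?_
    rw [one_div_div]
  obtain ⟨R, -, -, meets⟩ := exists_forall_subset_connectedComponentIn hK.isBounded
  obtain ⟨x, hz⟩ := exists_lt_norm R
  have h1 := meets p (main hp hq hne h) hz
  have h2 := meets q (main hq hp hne' hl') hz
  rw [connectedComponentIn_eq h1, ← connectedComponentIn_eq h2] at hne
  exact hne (mem_connectedComponentIn hq)

/-- Janiszewski's theorem: if two compact plane sets with connected intersection
do not separate two points, then neither does their union. -/
theorem mem_connectedComponentIn_compl_union {A B : Set ℂ} (hA : IsCompact A) (hB : IsCompact B)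
    (hAB : IsPreconnected (A ∩ B)) {p q : ℂ} (hpA : p ∉ A) (hpB : p ∉ B)
    (h₁ : q ∈ connectedComponentIn Aᶜ p) (h₂ : q ∈ connectedComponentIn Bᶜ p) :
    q ∈ connectedComponentIn (A ∪ B)ᶜ p := by
  have hq₁ : q ∉ A := connectedComponentIn_subset _ _ h₁
  have hq₂ : q ∉ B := connectedComponentIn_subset _ _ h₂
  have main : ∀ {K : Set ℂ}, IsCompact K → p ∉ K → q ∈ connectedComponentIn Kᶜ p →
      HasLogOn (fun z => (z - p) / (z - q)) K := by
    intro K hK hpK hq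
    exact isPreconnected_connectedComponentIn.hasLogOn_sub_div hK.isClosed
      (disjoint_left.2 fun x hx => connectedComponentIn_subset _ _ hx) hq
      (mem_connectedComponentIn hpK)
  exact mem_connectedComponentIn_of_hasLogOn (hA.union hB) (by simp [hpA, hpB])
    (by simp [hq₁, hq₂]) (HasLogOn.union_of_isPreconnected_inter hA.isClosed hB.isClosed hAB
      (main hA hpA h₁) (main hB hpB h₂))

end PlaneLogarithms

section JordanCurves

open Complex Metric

lemma Topology.IsEmbedding.continuousOn_invFun {X Y : Type*} [TopologicalSpace X]
    [TopologicalSpace Y] [Nonempty X] {f : X → Y} (hf : IsEmbedding f) :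
    ContinuousOn (Function.invFun f) (range f) := by
  rw [hf.isInducing.continuousOn_iff]
  exact continuousOn_id.congr fun y hy => Function.invFun_eq hy

variable {γ : Circle → ℂ}

lemma not_isPreconnected_compl_range_circle (hγ : Continuous γ) (hi : Function.Injective γ) :
    ¬ IsPreconnected (range γ)ᶜ := by
  intro hpre
  have hK : IsCompact (range γ) := isCompact_range hγ
  have hc := (hγ.isClosedEmbedding hi).isEmbedding.continuousOn_invFun
  obtain ⟨h, hh, he⟩ := (logSaturated_of_isPreconnected_compl hK hpre).hasLogOn hK
    (g := fun z => ((Function.invFun γ z : Circle) : ℂ)) (continuous_subtype_val.comp_continuousOn hc)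
    fun z _ => Circle.coe_ne_zero _
  refine not_exists_continuous_exp_eq_circle (r := 1) (φ := fun t => h (γ (Circle.exp t)))
    (hh.comp_continuous (hγ.comp Circle.exp.continuous) fun t => mem_range_self _) (by simp)
    (fun t => ?_) one_ne_zero
  rw [he _ (mem_range_self _)]
  simp [Function.leftInverse_invFun hi _]

lemma exists_isBounded_connectedComponentIn_compl {K : Set ℂ} (hK : Bornology.IsBounded K)
    (h : ¬ IsPreconnected Kᶜ) :
    ∃ p ∉ K, Bornology.IsBounded (connectedComponentIn Kᶜ p) := by
  by_contra! hcon
  obtain ⟨R, -, hR, hsub⟩ := exists_forall_subset_connectedComponentIn hK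
  obtain ⟨x, hx⟩ := exists_lt_norm R
  refine h (isPreconnected_of_forall x fun y hy => ⟨connectedComponentIn Kᶜ y,
    connectedComponentIn_subset _ _, hsub y (hcon y hy) hx, mem_connectedComponentIn hy,
    isPreconnected_connectedComponentIn⟩)

/-- A nonvanishing continuous function on a circle has a logarithm off any point. -/
lemma hasLogOn_range_circle_diff_singleton (hγ : Continuous γ) (hi : Function.Injective γ)
    {g : ℂ → ℂ} (hg : ContinuousOn g (range γ)) (h0 : ∀ z ∈ range γ, g z ≠ 0) (u : Circle) :
    HasLogOn g (range γ \ {γ u}) := by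
  have hc := (hγ.isClosedEmbedding hi).isEmbedding.continuousOn_invFun
  obtain ⟨l, hl, he⟩ := HasLogOn.of_contractibleSpace
    (g := fun t : ℝ => g (γ (-u * Circle.exp t)))
    (hg.comp_continuous (by fun_prop) fun t => mem_range_self _)
    (fun t => h0 _ (mem_range_self _))
  rw [continuousOn_univ] at hl
  refine ⟨fun z => l (arg ((-Function.invFun γ z * u⁻¹ : Circle) : ℂ)), ?_, ?_⟩
  · refine hl.comp_continuousOn (ContinuousOn.comp (t := slitPlane) (g := arg)
      (f := fun z => ((-Function.invFun γ z * u⁻¹ : Circle) : ℂ)) ?_ ?_ ?_)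
    · exact fun z hz => (continuousAt_arg hz).continuousWithinAt
    · exact continuous_subtype_val.comp_continuousOn
        (((hc.mono sdiff_subset).neg).mul continuousOn_const)
    · rintro _ ⟨⟨v, rfl⟩, hv⟩
      simp only [Function.leftInverse_invFun hi _]
      rw [mem_slitPlane_iff_arg]
      refine ⟨fun h => hv ?_, Circle.coe_ne_zero _⟩
      have h1 := Circle.exp_arg (-v * u⁻¹)
      have h2 : Circle.exp Real.pi = -1 := Circle.ext (by simp)
      rw [h, h2, neg_mul, neg_inj, eq_comm, mul_inv_eq_one] at h1
      rw [h1]; rfl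
  · rintro _ ⟨⟨v, rfl⟩, hv⟩
    rw [he _ (mem_univ _)]
    simp only [Function.leftInverse_invFun hi _, Circle.exp_arg]
    simp

lemma frontier_connectedComponentIn_compl_range_circle (hγ : Continuous γ)
    (hi : Function.Injective γ) {p : ℂ} (hp : p ∉ range γ)
    (hb : Bornology.IsBounded (connectedComponentIn (range γ)ᶜ p)) :
    frontier (connectedComponentIn (range γ)ᶜ p) = range γ := by
  have hcl : IsClosed (range γ) := (isCompact_range hγ).isClosed
  have hsub := frontier_subset_of_connectedComponentIn hcl p
  refine hsub.antisymm ?_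
  rintro _ ⟨u, rfl⟩
  by_contra hu
  refine not_hasLogOn_sub_div isClosed_frontier hcl.isOpen_compl.connectedComponentIn hb
    subset_rfl (mem_connectedComponentIn hp) (ψ := 1) continuousOn_const
    (fun _ _ => one_ne_zero) ?_
  refine ((hasLogOn_range_circle_diff_singleton hγ hi (g := fun z => z - p) (by fun_prop)
    (fun z hz => sub_ne_zero.2 (ne_of_mem_of_not_mem hz hp)) u).mono ?_).congr
    fun z _ => div_one _
  exact fun z hz => ⟨hsub hz, fun h => hu (h ▸ hz)⟩

lemma isPreconnected_compl_connectedComponentIn {K : Set ℂ} (hK : IsClosed K)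
    (hc : IsPreconnected K) (hne : K.Nonempty) (p : ℂ) :
    IsPreconnected (connectedComponentIn Kᶜ p)ᶜ := by
  obtain ⟨x, hx⟩ := hne
  have hKs : K ⊆ (connectedComponentIn Kᶜ p)ᶜ := fun z hz h =>
    connectedComponentIn_subset _ _ h hz
  refine isPreconnected_of_forall x fun y hy => ?_
  by_cases hyK : y ∈ K
  · exact ⟨K, hKs, hx, hyK, hc⟩
  set V := connectedComponentIn Kᶜ y with hV
  have hyV : y ∈ V := mem_connectedComponentIn hyK
  have hVo : IsOpen V := hK.isOpen_compl.connectedComponentIn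
  have hdis : Disjoint V (connectedComponentIn Kᶜ p) := by
    rw [disjoint_left]
    intro z hz hzp
    rw [connectedComponentIn_eq hzp, ← connectedComponentIn_eq hz] at hy
    exact hy hyV
  have hfr : (frontier V).Nonempty := by
    rw [nonempty_frontier_iff]
    refine ⟨⟨y, hyV⟩, fun h => ?_⟩
    exact connectedComponentIn_subset _ _ (h ▸ mem_univ x : x ∈ V) hx
  obtain ⟨w, hw⟩ := hfr
  refine ⟨K ∪ closure V, union_subset hKs ?_, Or.inl hx, Or.inr (subset_closure hyV), ?_⟩
  · rw [subset_compl_iff_disjoint_right]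
    exact hdis.closure_left hK.isOpen_compl.connectedComponentIn
  · exact hc.union w (frontier_subset_of_connectedComponentIn hK y hw) (frontier_subset_closure hw)
      isPreconnected_connectedComponentIn.closure

lemma IsPreconnected.thickening {S : Set ℂ} (hS : IsPreconnected S) (δ : ℝ) :
    IsPreconnected (thickening δ S) := by
  rcases le_or_gt δ 0 with hδ | hδ
  · rw [thickening_of_nonpos hδ]; exact isPreconnected_empty
  rcases S.eq_empty_or_nonempty with rfl | ⟨x, hx⟩
  · rw [thickening_empty]; exact isPreconnected_empty
  refine isPreconnected_of_forall x fun y hy => ?_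
  obtain ⟨w, hw, hyw⟩ := mem_thickening_iff.1 hy
  exact ⟨S ∪ ball w δ, union_subset (self_subset_thickening hδ S) (ball_subset_thickening hw δ),
    Or.inl hx, Or.inr hyw, hS.union w hw (mem_ball_self hδ) (convex_ball w δ).isPreconnected⟩

/-- On a bounded plane domain with connected complement every nonvanishing continuous function
has a continuous logarithm. -/
theorem hasLogOn_of_isPreconnected_compl {Ω : Set ℂ} (ho : IsOpen Ω) (hc : IsPreconnected Ω)
    (hb : Bornology.IsBounded Ω) (hcc : IsPreconnected Ωᶜ) {f : ℂ → ℂ} (hf : ContinuousOn f Ω)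
    (h0 : ∀ z ∈ Ω, f z ≠ 0) : HasLogOn f Ω := by
  rcases Ω.eq_empty_or_nonempty with rfl | ⟨p, hp⟩
  · exact ⟨0, continuousOn_empty _, by simp⟩
  have hne : Ωᶜ.Nonempty := by
    rw [nonempty_compl]
    rintro rfl
    exact NormedSpace.unbounded_univ ℝ ℂ hb
  let K : ℕ → Set ℂ := fun n => {z | 1 / ((n : ℝ) + 1) ≤ infDist z Ωᶜ}
  have hKΩ : ∀ n, K n ⊆ Ω := fun n z hz => by
    by_contra hzΩ
    have h1 : 1 / ((n : ℝ) + 1) ≤ infDist z Ωᶜ := hz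
    rw [infDist_zero_of_mem hzΩ] at h1
    exact absurd h1 (not_le.2 (by positivity))
  have hKc : ∀ n, IsCompact (K n) := fun n => isCompact_of_isClosed_isBounded
    (isClosed_le continuous_const (continuous_infDist_pt _)) (hb.subset (hKΩ n))
  have hKs : ∀ n, LogSaturated (K n) := fun n => by
    refine logSaturated_of_isPreconnected_compl (hKc n) ?_
    have : (K n)ᶜ = thickening (1 / ((n : ℝ) + 1)) Ωᶜ := by
      ext z
      rw [mem_thickening_iff_infDist_lt hne]
      simp [K]
    rw [this]
    exact hcc.thickening _
  have hlog : ∀ n, ∃ h : ℂ → ℂ, ContinuousOn h (K n) ∧ (∀ z ∈ K n, exp (h z) = f z) ∧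
      (p ∈ K n → h p = log (f p)) := by
    intro n
    obtain ⟨h, hh, he⟩ := (hKs n).hasLogOn (hKc n) (hf.mono (hKΩ n)) fun z hz => h0 z (hKΩ n hz)
    by_cases hpK : p ∈ K n
    · refine ⟨fun z => h z + (log (f p) - h p), hh.add continuousOn_const, fun z hz => ?_,
        fun _ => by ring⟩
      rw [exp_add, he z hz, exp_sub, exp_log (h0 p hp), he p hpK, div_self (h0 p hp), mul_one]
    · exact ⟨h, hh, he, fun h => absurd h hpK⟩
  choose h hh he hhp using hlog
  have hS : ∀ z ∈ Ω, ∃ ε > 0, ∃ N, ball z ε ⊆ K N ∧ ∀ n ≥ N, ∀ w ∈ ball z ε, h n w = h N w := by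
    intro z hz
    obtain ⟨ε, hε, hball⟩ := Metric.nhds_basis_closedBall.mem_iff.1 (ho.mem_nhds hz)
    have hj : JoinedIn Ω p z :=
      ((ho.isConnected_iff_isPathConnected).1 ⟨⟨p, hp⟩, hc⟩).joinedIn p hp z hz
    obtain ⟨P, hP⟩ := hj
    set S := range P ∪ closedBall z ε with hSdef
    have hSΩ : S ⊆ Ω := union_subset (range_subset_iff.2 hP) hball
    have hScomp : IsCompact S := (isCompact_range P.continuous).union (isCompact_closedBall z ε)
    have hSpre : IsPreconnected S := (isPreconnected_range P.continuous).union z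
      ⟨1, P.target⟩ (mem_closedBall_self hε.le) (convex_closedBall z ε).isPreconnected
    have hpS : p ∈ S := Or.inl ⟨0, P.source⟩
    obtain ⟨w, hw, hmin⟩ := hScomp.exists_isMinOn ⟨p, hpS⟩
      (continuous_infDist_pt Ωᶜ).continuousOn
    have hpos : 0 < infDist w Ωᶜ :=
      (ho.isClosed_compl.notMem_iff_infDist_pos hne).1 fun h => h (hSΩ hw)
    obtain ⟨N, hN⟩ := exists_nat_one_div_lt hpos
    have hSK : ∀ n ≥ N, S ⊆ K n := fun n hn x hx => by
      have h1 : infDist w Ωᶜ ≤ infDist x Ωᶜ := hmin hx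
      exact ((Nat.one_div_le_one_div hn).trans hN.le).trans h1
    have hbS : ball z ε ⊆ S := ball_subset_closedBall.trans subset_union_right
    refine ⟨ε, hε, N, hbS.trans (hSK N le_rfl), fun n hn x hx => ?_⟩
    have := hSpre.sub_eq_sub_of_exp_eq ((hh n).mono (hSK n hn)) ((hh N).mono (hSK N le_rfl))
      (fun y hy => by rw [he n y (hSK n hn hy), he N y (hSK N le_rfl hy)]) hpS (hbS hx)
    rw [hhp n (hSK n hn hpS), hhp N (hSK N le_rfl hpS), sub_self] at this
    exact (sub_eq_zero.1 this.symm)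
  choose! ε hε N hK hN using hS
  refine ⟨fun z => h (N z) z, fun z hz => ContinuousAt.continuousWithinAt ?_, fun z hz =>
    he _ _ (hK z hz (mem_ball_self (hε z hz)))⟩
  have hnhds := ball_mem_nhds z (hε z hz)
  refine (((hh (N z)).mono (hK z hz)).continuousAt hnhds).congr ?_
  filter_upwards [hnhds] with w hw
  have hwΩ := hKΩ _ (hK z hz hw)
  rw [← hN z hz (max (N z) (N w)) (le_max_left _ _) w hw,
    hN w hwΩ _ (le_max_right _ _) w (mem_ball_self (hε w hwΩ))]

lemma differentiableOn_of_exp_eq {Ω : Set ℂ} (ho : IsOpen Ω) {f h : ℂ → ℂ}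
    (hf : DifferentiableOn ℂ f Ω) (hh : ContinuousOn h Ω) (he : ∀ z ∈ Ω, exp (h z) = f z) :
    DifferentiableOn ℂ h Ω := by
  intro z hz
  have hz0 : f z ≠ 0 := he z hz ▸ exp_ne_zero _
  have hn := ho.mem_nhds hz
  have hfd : DifferentiableAt ℂ (fun w => f w / f z) z := (hf.differentiableAt hn).div_const _
  have h1 : f z / f z ∈ slitPlane := by rw [div_self hz0]; exact one_mem_slitPlane
  have hld : DifferentiableAt ℂ (fun w => log (f w / f z) + h z) z := (hfd.clog h1).add_const _
  have hc : ContinuousAt (fun w => h w - (log (f w / f z) + h z)) z :=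
    (hh.continuousAt hn).sub hld.continuousAt
  have hev : ∀ᶠ w in 𝓝 z, ‖h w - (log (f w / f z) + h z)‖ < 6 := by
    refine hc.norm.eventually_lt continuousAt_const ?_
    simp [div_self hz0]
  refine (hld.congr_of_eventuallyEq ?_).differentiableWithinAt
  filter_upwards [hev, hn] with w hw hwΩ
  refine Complex.eq_of_exp_eq_of_norm_sub_lt ?_ hw
  have hw0 : f w ≠ 0 := he w hwΩ ▸ exp_ne_zero _
  rw [exp_add, exp_log (div_ne_zero hw0 hz0), he w hwΩ, he z hz, div_mul_cancel₀ _ hz0]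

end JordanCurves

section RiemannMapping

open Complex Metric Filter ComplexConjugate

lemma Complex.norm_sub_lt_norm_one_sub_conj_mul {z w : ℂ} (hz : ‖z‖ < 1) (hw : ‖w‖ < 1) :
    ‖z - w‖ < ‖1 - conj w * z‖ := by
  have h1 : ‖1 - conj w * z‖ ^ 2 - ‖z - w‖ ^ 2 = (1 - ‖z‖ ^ 2) * (1 - ‖w‖ ^ 2) := by
    simp only [Complex.sq_norm, normSq_apply, sub_re, sub_im, mul_re, mul_im, conj_re, conj_im,
      one_re, one_im]
    ring
  have h2 : ‖z‖ ^ 2 < 1 := by nlinarith [norm_nonneg z]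
  have h3 : ‖w‖ ^ 2 < 1 := by nlinarith [norm_nonneg w]
  have h4 : 0 < (1 - ‖z‖ ^ 2) * (1 - ‖w‖ ^ 2) := mul_pos (by linarith) (by linarith)
  exact lt_of_pow_lt_pow_left₀ 2 (norm_nonneg _) (by linarith)

lemma Complex.one_sub_conj_mul_ne_zero {z w : ℂ} (hz : ‖z‖ < 1) (hw : ‖w‖ < 1) :
    1 - conj w * z ≠ 0 :=
  norm_pos_iff.1 ((norm_nonneg _).trans_lt (norm_sub_lt_norm_one_sub_conj_mul hz hw))

/-- The disk automorphism sending `w` to `0`. -/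
noncomputable def Complex.diskMap (w z : ℂ) : ℂ := (z - w) / (1 - conj w * z)

lemma Complex.norm_diskMap_lt_one {z w : ℂ} (hz : ‖z‖ < 1) (hw : ‖w‖ < 1) :
    ‖diskMap w z‖ < 1 := by
  rw [diskMap, norm_div, div_lt_one (norm_pos_iff.2 (one_sub_conj_mul_ne_zero hz hw))]
  exact norm_sub_lt_norm_one_sub_conj_mul hz hw

lemma Complex.diskMap_injOn {w : ℂ} (hw : ‖w‖ < 1) : InjOn (diskMap w) (ball 0 1) := by
  intro x hx y hy h
  rw [mem_ball_zero_iff] at hx hy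
  rw [diskMap, diskMap, div_eq_div_iff (one_sub_conj_mul_ne_zero hx hw)
    (one_sub_conj_mul_ne_zero hy hw)] at h
  have h1 : (x - y) * (1 - conj w * w) = 0 := by linear_combination h
  rcases mul_eq_zero.1 h1 with h2 | h2
  · exact sub_eq_zero.1 h2
  · exact absurd h2 (one_sub_conj_mul_ne_zero hw hw)

lemma DifferentiableOn.diskMap {f : ℂ → ℂ} {U : Set ℂ} (hf : DifferentiableOn ℂ f U)
    (hm : MapsTo f U (ball 0 1)) {w : ℂ} (hw : ‖w‖ < 1) :
    DifferentiableOn ℂ (fun z => diskMap w (f z)) U :=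
  (hf.sub_const w).div ((hf.const_mul (conj w)).const_sub 1) fun _ hz =>
    one_sub_conj_mul_ne_zero (mem_ball_zero_iff.1 (hm hz)) hw

lemma Complex.norm_diskMap_sq_lt {z w : ℂ} (hz : ‖z‖ < 1) (hw : ‖w‖ < 1) (h : z ≠ w) :
    ‖diskMap (w ^ 2) (z ^ 2)‖ < ‖diskMap w z‖ := by
  have h1 := one_sub_conj_mul_ne_zero hz hw
  have hw' : ‖-w‖ < 1 := by rwa [norm_neg]
  have h2 := one_sub_conj_mul_ne_zero hz hw'
  have h3 : diskMap (w ^ 2) (z ^ 2) = diskMap w z * diskMap (-w) z := by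
    rw [diskMap, diskMap, diskMap, div_mul_div_comm]
    congr 1
    · ring
    · simp only [map_pow, map_neg]; ring
  rw [h3, norm_mul]
  refine mul_lt_of_lt_one_right (norm_pos_iff.2 ?_) (norm_diskMap_lt_one hz hw')
  exact div_ne_zero (sub_ne_zero.2 h) h1

lemma Complex.diskMap_diskMap {a b w : ℂ} (ha : ‖a‖ < 1) (hb : ‖b‖ < 1) (hw : ‖w‖ < 1) :
    ‖diskMap (diskMap w a) (diskMap w b)‖ = ‖diskMap a b‖ := by
  have h1 := one_sub_conj_mul_ne_zero ha hw
  have h2 := one_sub_conj_mul_ne_zero hb hw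
  have h3 := one_sub_conj_mul_ne_zero hw hw
  have h4 := one_sub_conj_mul_ne_zero hb ha
  have h1' : 1 - w * conj a ≠ 0 := by
    have := (map_ne_zero (starRingEnd ℂ)).2 h1
    simpa using this
  have e1 : diskMap w b - diskMap w a =
      (b - a) * (1 - conj w * w) / ((1 - conj w * b) * (1 - conj w * a)) := by
    rw [diskMap, diskMap, div_sub_div _ _ h2 h1]
    congr 1
    ring
  have e2 : 1 - conj (diskMap w a) * diskMap w b =
      (1 - conj a * b) * (1 - conj w * w) / ((1 - conj w * b) * (1 - w * conj a)) := by
    simp only [diskMap, map_div₀, map_sub, map_one, map_mul, conj_conj]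
    rw [div_mul_div_comm, one_sub_div (mul_ne_zero h1' h2), mul_comm (1 - w * conj a)]
    congr 1
    ring
  have e3 : ‖1 - w * conj a‖ = ‖1 - conj w * a‖ := by
    rw [← norm_conj]; simp
  have n1 := norm_ne_zero_iff.2 h1
  have n2 := norm_ne_zero_iff.2 h2
  have n3 := norm_ne_zero_iff.2 h3
  have n4 := norm_ne_zero_iff.2 h4
  rw [diskMap, e1, e2, diskMap]
  simp only [norm_div, norm_mul, e3]
  rw [div_div_div_cancel_right₀ (mul_ne_zero n2 n1), mul_div_mul_right _ _ n3]

lemma not_eventually_eq_of_injOn {U : Set ℂ} (ho : IsOpen U) {f : ℂ → ℂ} (hi : InjOn f U) {z : ℂ}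
    (hz : z ∈ U) : ¬ ∀ᶠ y in 𝓝 z, f y = f z := by
  intro h
  have h1 : ∀ᶠ y in 𝓝 z, y = z := by
    filter_upwards [h, ho.mem_nhds hz] with y hy hyU using hi hyU hz hy
  have h2 : ∀ᶠ y in 𝓝[≠] z, False := by
    filter_upwards [h1.filter_mono nhdsWithin_le_nhds, self_mem_nhdsWithin] with y a b using b a
  exact NeBot.ne inferInstance (eventually_false_iff_eq_bot.1 h2)

lemma nhds_le_map_nhds_of_injOn {U : Set ℂ} (ho : IsOpen U) {f : ℂ → ℂ}
    (hf : DifferentiableOn ℂ f U) (hi : InjOn f U) {z : ℂ} (hz : z ∈ U) :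
    𝓝 (f z) ≤ map f (𝓝 z) :=
  ((hf.analyticOnNhd ho z hz).eventually_constant_or_nhds_le_map_nhds_aux).resolve_left
    (not_eventually_eq_of_injOn ho hi hz)

lemma isOpen_image_of_injOn {U : Set ℂ} (ho : IsOpen U) {f : ℂ → ℂ}
    (hf : DifferentiableOn ℂ f U) (hi : InjOn f U) : IsOpen (f '' U) := by
  rw [isOpen_iff_mem_nhds]
  rintro _ ⟨z, hz, rfl⟩
  exact nhds_le_map_nhds_of_injOn ho hf hi hz (image_mem_map (ho.mem_nhds hz))

/-- The inverse of an injective holomorphic function is holomorphic. -/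
lemma differentiableOn_of_leftInvOn {U : Set ℂ} (ho : IsOpen U) {f g : ℂ → ℂ}
    (hf : DifferentiableOn ℂ f U) (hi : InjOn f U) (hg : LeftInvOn g f U) :
    DifferentiableOn ℂ g (f '' U) := by
  have hio := isOpen_image_of_injOn ho hf hi
  have hcont : ∀ z ∈ U, ContinuousAt g (f z) := by
    intro z hz V hV
    rw [hg hz] at hV
    have h1 := nhds_le_map_nhds_of_injOn ho hf hi hz
      (image_mem_map (inter_mem hV (ho.mem_nhds hz)))
    refine mem_map.2 (mem_of_superset h1 ?_)
    rintro _ ⟨y, ⟨hyV, hyU⟩, rfl⟩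
    rw [mem_preimage, hg hyU]
    exact hyV
  have hfg : ∀ w ∈ f '' U, f (g w) = w := by
    rintro _ ⟨z, hz, rfl⟩
    rw [hg hz]
  have hgU : ∀ w ∈ f '' U, g w ∈ U := by
    rintro _ ⟨z, hz, rfl⟩
    rwa [hg hz]
  rintro _ ⟨z, hz, rfl⟩
  have hd : ∀ᶠ y in 𝓝[≠] z, deriv f y ≠ 0 := by
    refine ((hf.analyticOnNhd ho).deriv z hz).eventually_eq_zero_or_eventually_ne_zero.resolve_left
      fun h0 => not_eventually_eq_of_injOn ho hi hz ?_
    obtain ⟨ε, hε, hball⟩ := Metric.eventually_nhds_iff_ball.1 (h0.and (ho.mem_nhds hz))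
    filter_upwards [ball_mem_nhds z hε] with y hy
    exact isOpen_ball.is_const_of_deriv_eq_zero (convex_ball z ε).isPreconnected
      (hf.mono fun x hx => (hball x hx).2) (fun x hx => (hball x hx).1) hy (mem_ball_self hε)
  refine (analyticAt_of_differentiable_on_punctured_nhds_of_continuousAt ?_
    (hcont z hz)).differentiableAt.differentiableWithinAt
  have ht : Tendsto g (𝓝[≠] f z) (𝓝[≠] z) := by
    refine tendsto_nhdsWithin_iff.2 ⟨?_, ?_⟩
    · have := (hcont z hz).tendsto
      rw [hg hz] at this
      exact this.mono_left nhdsWithin_le_nhds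
    · filter_upwards [self_mem_nhdsWithin, mem_nhdsWithin_of_mem_nhds
        (hio.mem_nhds (mem_image_of_mem f hz))] with w hw hwU hgw
      exact hw (by rw [← hfg w hwU, hgw]; rfl)
  filter_upwards [ht.eventually hd, mem_nhdsWithin_of_mem_nhds
    (hio.mem_nhds (mem_image_of_mem f hz))] with w hw hwU
  have hc : ContinuousAt g w := by
    have := hcont (g w) (hgU w hwU)
    rwa [hfg w hwU] at this
  exact (HasDerivAt.of_local_left_inverse hc
    (hf.differentiableAt (ho.mem_nhds (hgU w hwU))).hasDerivAt hw
    (by filter_upwards [hio.mem_nhds hwU] with y hy using hfg y hy)).differentiableAt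

/-- A sequence of holomorphic maps into the disk has a locally uniform limit along the
hyperfilter. -/
lemma exists_tendstoLocallyUniformlyOn_hyperfilter {U : Set ℂ} (ho : IsOpen U) {F : ℕ → ℂ → ℂ}
    (hF : ∀ n, DifferentiableOn ℂ (F n) U) (hm : ∀ n, MapsTo (F n) U (ball 0 1)) :
    ∃ f, TendstoLocallyUniformlyOn F f (hyperfilter ℕ : Filter ℕ) U ∧
      MapsTo f U (closedBall 0 1) := by
  have h1 : ∀ z ∈ U, ∃ w ∈ closedBall (0 : ℂ) 1,
      Tendsto (fun n => F n z) (hyperfilter ℕ : Filter ℕ) (𝓝 w) := by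
    intro z hz
    exact (isCompact_closedBall (0 : ℂ) 1).ultrafilter_le_nhds ((hyperfilter ℕ).map fun n => F n z)
      (tendsto_principal.2 (Eventually.of_forall fun n => ball_subset_closedBall (hm n hz)))
  choose! f hfm hf using h1
  refine ⟨f, Metric.tendstoLocallyUniformlyOn_iff.2 fun ε hε z hz => ?_, hfm⟩
  obtain ⟨r, hr, hball⟩ := Metric.isOpen_iff.1 ho z hz
  have hlip : ∀ n : ℕ, ∀ y ∈ ball z r, dist (F n y) (F n z) ≤ 2 / r * dist y z := fun n y hy => by
    refine dist_le_div_mul_dist_of_mapsTo_ball ((hF n).mono hball) (fun x hx => ?_) hy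
    have a := mem_ball_zero_iff.1 (hm n (hball hx))
    have b := mem_ball_zero_iff.1 (hm n hz)
    rw [mem_closedBall, dist_eq_norm]
    exact (norm_sub_le _ _).trans (by linarith)
  have hlip' : ∀ y ∈ ball z r, dist (f y) (f z) ≤ 2 / r * dist y z := fun y hy =>
    le_of_tendsto ((hf y (hball hy)).dist (hf z hz)) (Eventually.of_forall fun n => hlip n y hy)
  refine ⟨ball z r ∩ ball z (ε / 3 / (2 / r)), mem_nhdsWithin_of_mem_nhds
    (inter_mem (ball_mem_nhds z hr) (ball_mem_nhds z (by positivity))), ?_⟩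
  filter_upwards [Metric.tendsto_nhds.1 (hf z hz) (ε / 3) (by positivity)] with n hn y hy
  have h3 : 2 / r * dist y z < ε / 3 := by
    have := mem_ball.1 hy.2
    rwa [lt_div_iff₀ (by positivity), mul_comm] at this
  have h4 := hlip n y hy.1
  have h5 := hlip' y hy.1
  have h6 := dist_triangle4 (f y) (f z) (F n z) (F n y)
  rw [dist_comm (f z), dist_comm (F n z) (F n y)] at h6
  linarith

/-- Hurwitz: a nonconstant limit of injective holomorphic functions is injective. -/
lemma TendstoLocallyUniformlyOn.injOn {ι : Type*} {U : Set ℂ} (ho : IsOpen U)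
    (hc : IsPreconnected U) {F : ι → ℂ → ℂ} {f : ℂ → ℂ} {l : Filter ι} [l.NeBot]
    (h : TendstoLocallyUniformlyOn F f l U) (hF : ∀ n, DifferentiableOn ℂ (F n) U)
    (hi : ∀ n, InjOn (F n) U) {p q : ℂ} (hp : p ∈ U) (hq : q ∈ U) (hpq : f p ≠ f q) :
    InjOn f U := by
  have hf : DifferentiableOn ℂ f U := h.differentiableOn (Eventually.of_forall hF) ho
  intro a ha b hb hab
  by_contra hne
  have han : AnalyticAt ℂ (fun z => f z - f a) b := (hf.analyticOnNhd ho b hb).sub analyticAt_const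
  have hev : ∀ᶠ z in 𝓝[≠] b, f z - f a ≠ 0 := by
    refine han.eventually_eq_zero_or_eventually_ne_zero.resolve_left fun h0 => hpq ?_
    have h2 : EqOn f (fun _ => f a) U :=
      (hf.analyticOnNhd ho).eqOn_of_preconnected_of_eventuallyEq
        (fun _ _ => analyticAt_const) hc hb (by
          filter_upwards [h0] with z hz using sub_eq_zero.1 hz)
    rw [h2 hp, h2 hq]
  have hev' : ∀ᶠ z in 𝓝 b, (z ≠ b → f z - f a ≠ 0) ∧ z ∈ U ∧ z ≠ a :=
    (eventually_nhdsWithin_iff.1 hev).and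
      ((ho.eventually_mem hb).and (isOpen_ne.eventually_mem (Ne.symm hne)))
  obtain ⟨r, hr, hball⟩ := Metric.nhds_basis_closedBall.eventually_iff.1 hev'
  have hS : sphere b r ⊆ U := fun z hz => (hball (sphere_subset_closedBall hz)).2.1
  obtain ⟨z₀, hz₀, hmin⟩ := (isCompact_sphere b r).exists_isMinOn (NormedSpace.sphere_nonempty.2 hr.le)
    ((hf.continuousOn.mono hS).sub continuousOn_const : ContinuousOn (fun z => f z - f a) _).norm
  set m := ‖f z₀ - f a‖ with hm
  have hm0 : 0 < m := by
    refine norm_pos_iff.2 ((hball (sphere_subset_closedBall hz₀)).1 ?_)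
    exact ne_of_mem_sphere hz₀ hr.ne'
  have hu := (tendstoLocallyUniformlyOn_iff_tendstoUniformlyOn_of_compact
    (isCompact_sphere b r)).1 (h.mono hS)
  have ht : ∀ z ∈ U, Tendsto (fun n => F n z) l (𝓝 (f z)) := fun z hz => h.tendsto_at hz
  obtain ⟨n, h1, h2, h3⟩ := ((Metric.tendstoUniformlyOn_iff.1 hu (m / 4) (by positivity)).and
    ((Metric.tendsto_nhds.1 (ht a ha) (m / 4) (by positivity)).and
    (Metric.tendsto_nhds.1 (ht b hb) (m / 4) (by positivity)))).exists
  have hne0 : ∀ z ∈ closedBall b r, F n z - F n a ≠ 0 := fun z hz h0 =>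
    (hball hz).2.2 (hi n (hball hz).2.1 ha (sub_eq_zero.1 h0))
  have hd : DiffContOnCl ℂ (fun z => (F n z - F n a)⁻¹) (ball b r) := by
    refine DifferentiableOn.diffContOnCl ?_
    rw [closure_ball b hr.ne']
    exact (((hF n).mono fun z hz => (hball hz).2.1).sub_const _).inv hne0
  have hbd := norm_le_of_forall_mem_frontier_norm_le isBounded_ball hd (C := (m / 2)⁻¹) (z := b)
    (fun z hz => by
      rw [frontier_ball b hr.ne'] at hz
      rw [norm_inv]
      refine inv_anti₀ (by positivity) ?_
      have e1 : m ≤ ‖f z - f a‖ := hmin hz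
      have e2 := h1 z hz
      rw [← dist_eq_norm] at e1 ⊢
      have e3 := dist_triangle4 (f z) (F n z) (F n a) (f a)
      linarith) (subset_closure (mem_ball_self hr))
  rw [norm_inv] at hbd
  have h5 := (inv_le_inv₀ (norm_pos_iff.2 (hne0 b (mem_closedBall_self hr.le))) (by positivity)).1 hbd
  rw [← dist_eq_norm] at h5
  have e3 := dist_triangle (F n b) (f b) (F n a)
  rw [← hab, dist_comm (f a)] at e3
  rw [← hab] at h3
  linarith

/-- The Riemann mapping theorem for bounded domains on which nonvanishing continuous functions
have continuous logarithms. -/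
theorem exists_injOn_image_ball_eq {U : Set ℂ} (ho : IsOpen U) (hc : IsPreconnected U)
    (hb : Bornology.IsBounded U) (hne : U.Nonempty)
    (hlog : ∀ f : ℂ → ℂ, ContinuousOn f U → (∀ z ∈ U, f z ≠ 0) → HasLogOn f U) :
    ∃ g : ℂ → ℂ, DifferentiableOn ℂ g (ball 0 1) ∧ InjOn g (ball 0 1) ∧ g '' ball 0 1 = U := by
  obtain ⟨p, hp⟩ := hne
  obtain ⟨q, hq, hqp⟩ : ∃ q ∈ U, q ≠ p := by
    have h1 : ∀ᶠ y in 𝓝[≠] p, y ∈ U ∧ y ≠ p :=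
      ((ho.eventually_mem hp).filter_mono nhdsWithin_le_nhds).and self_mem_nhdsWithin
    exact h1.exists
  let S : Set ℝ := {t | ∃ f : ℂ → ℂ, DifferentiableOn ℂ f U ∧ InjOn f U ∧ MapsTo f U (ball 0 1) ∧
    f p = 0 ∧ ‖f q‖ = t}
  have hSb : BddAbove S := ⟨1, by
    rintro _ ⟨f, -, -, hm, -, rfl⟩
    exact (mem_ball_zero_iff.1 (hm hq)).le⟩
  obtain ⟨R, hR⟩ := hb.subset_ball p
  have hR0 : 0 < R := by simpa using hR hp
  have hRC : (R : ℂ) ≠ 0 := ofReal_ne_zero.2 hR0.ne'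
  have hS0 : ‖(q - p) / R‖ ∈ S := by
    refine ⟨fun z => (z - p) / R, by fun_prop, fun x _ y _ h => ?_, fun z hz => ?_, by simp, rfl⟩
    · simpa [div_left_inj' hRC] using h
    · rw [mem_ball_zero_iff, norm_div, norm_real, Real.norm_of_nonneg hR0.le, div_lt_one hR0]
      simpa [dist_eq_norm] using hR hz
  obtain ⟨u, -, hu, huS⟩ := exists_seq_tendsto_sSup ⟨_, hS0⟩ hSb
  choose F hFd hFi hFm hFp hFq using huS
  obtain ⟨f, hf, hfm⟩ := exists_tendstoLocallyUniformlyOn_hyperfilter ho hFd hFm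
  have hfd : DifferentiableOn ℂ f U := hf.differentiableOn (Eventually.of_forall hFd) ho
  have hle : (hyperfilter ℕ : Filter ℕ) ≤ atTop := Nat.hyperfilter_le_atTop
  have hfp : f p = 0 := by
    refine tendsto_nhds_unique (hf.tendsto_at hp) ?_
    simp only [hFp]
    exact tendsto_const_nhds
  have hfq : ‖f q‖ = sSup S := by
    refine tendsto_nhds_unique (hf.tendsto_at hq).norm ?_
    simp only [hFq]
    exact hu.mono_left hle
  have hpos : 0 < ‖f q‖ := by
    rw [hfq]
    refine lt_of_lt_of_le ?_ (le_csSup hSb hS0)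
    exact norm_pos_iff.2 (div_ne_zero (sub_ne_zero.2 hqp) hRC)
  have hpq : f p ≠ f q := by
    rw [hfp]
    exact (norm_pos_iff.1 hpos).symm
  have hfi : InjOn f U := hf.injOn ho hc hFd hFi hp hq hpq
  have hfm' : MapsTo f U (ball 0 1) := by
    intro z hz
    have h1 := mem_closedBall_zero_iff.1 (hfm hz)
    refine mem_ball_zero_iff.2 (lt_of_le_of_ne h1 fun h2 => ?_)
    have h3 := eqOn_of_isPreconnected_of_isMaxOn_norm hc ho hfd hz (fun y hy => by
      simpa [h2] using hfm hy)
    exact hpq ((h3 hp).trans (h3 hq).symm)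
  have hsurj : f '' U = ball 0 1 := by
    refine (image_subset_iff.2 hfm').antisymm fun w hw => ?_
    by_contra hwU
    have hw1 := mem_ball_zero_iff.1 hw
    have hfn : ∀ z ∈ U, ‖f z‖ < 1 := fun z hz => mem_ball_zero_iff.1 (hfm' hz)
    have hψd : DifferentiableOn ℂ (fun z => diskMap w (f z)) U := hfd.diskMap hfm' hw1
    obtain ⟨L, hL, hLe⟩ := hlog _ hψd.continuousOn fun z hz => div_ne_zero
      (sub_ne_zero.2 fun h => hwU ⟨z, hz, h⟩) (one_sub_conj_mul_ne_zero (hfn z hz) hw1)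
    have hLd := differentiableOn_of_exp_eq ho hψd hL hLe
    let s : ℂ → ℂ := fun z => exp (L z / 2)
    have hs2 : ∀ z ∈ U, s z ^ 2 = diskMap w (f z) := fun z hz => by
      refine Eq.trans ?_ (hLe z hz)
      rw [← exp_nat_mul]
      congr 1; push_cast; ring
    have hsn : ∀ z ∈ U, ‖s z‖ < 1 := fun z hz => by
      have h1 := norm_diskMap_lt_one (hfn z hz) hw1
      rw [← hs2 z hz, norm_pow] at h1
      by_contra! h2
      exact absurd h1 (not_lt.2 (one_le_pow₀ h2))
    have hsd : DifferentiableOn ℂ s U := (hLd.div_const 2).cexp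
    have hsm : MapsTo s U (ball 0 1) := fun z hz => mem_ball_zero_iff.2 (hsn z hz)
    have hsi : InjOn s U := fun x hx y hy h => hfi hx hy (diskMap_injOn hw1 (hfm' hx) (hfm' hy) (by
      rw [← hs2 x hx, ← hs2 y hy, h]))
    have hmem : ‖diskMap (s p) (s q)‖ ∈ S := by
      refine ⟨fun z => diskMap (s p) (s z), hsd.diskMap hsm (hsn p hp), fun x hx y hy h => ?_,
        fun z hz => mem_ball_zero_iff.2 (norm_diskMap_lt_one (hsn z hz) (hsn p hp)), ?_, rfl⟩
      · exact hsi hx hy (diskMap_injOn (hsn p hp) (hsm hx) (hsm hy) h)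
      · simp [diskMap]
    have h1 := norm_diskMap_sq_lt (hsn q hq) (hsn p hp) fun h => hqp (hsi hq hp h)
    rw [hs2 p hp, hs2 q hq, diskMap_diskMap (hfn p hp) (hfn q hq) hw1, hfp] at h1
    have h2 := le_csSup hSb hmem
    rw [← hfq] at h2
    simp only [diskMap, map_zero, zero_mul, sub_zero, div_one] at h1 h2
    linarith
  refine ⟨Function.invFunOn f U, ?_, ?_, ?_⟩
  · rw [← hsurj]
    exact differentiableOn_of_leftInvOn ho hfd hfi hfi.leftInvOn_invFunOn
  · rw [← hsurj]
    exact (Function.invFunOn_injOn_image f U)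
  · rw [← hsurj, hfi.leftInvOn_invFunOn.image_image]

end RiemannMapping

section LengthArea

open Complex Metric MeasureTheory

/-- The area of the image of a univalent function. -/
theorem Complex.lintegral_sq_norm_deriv_eq_volume_image {f : ℂ → ℂ} {U : Set ℂ} (ho : IsOpen U)
    (hf : DifferentiableOn ℂ f U) (hi : InjOn f U) :
    ∫⁻ s in U, ENNReal.ofReal (‖deriv f s‖ ^ 2) = volume (f '' U) := by
  rw [← lintegral_abs_det_fderiv_eq_addHaar_image volume ho.measurableSet
    (f' := fun s => (fderiv ℂ f s).restrictScalars ℝ) (fun s hs =>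
      (((hf s hs).differentiableAt (ho.mem_nhds hs)).hasFDerivAt.restrictScalars
        ℝ).hasFDerivWithinAt) hi]
  refine lintegral_congr fun s => ?_
  congr 1
  have h : fderiv ℂ f s = ContinuousLinearMap.toSpanSingleton ℂ (deriv f s) :=
    (ContinuousLinearMap.toSpanSingleton_apply_map_one ..).symm
  have h2 : ((fderiv ℂ f s).restrictScalars ℝ).det = ‖deriv f s‖ ^ 2 := by
    rw [h]
    simp [ContinuousLinearMap.det, LinearMap.det_restrictScalars,
      Algebra.norm_complex_eq, Complex.normSq_eq_norm_sq]
  rw [h2, abs_of_nonneg (by positivity)]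

theorem Complex.exists_lt_lintegral_le {f : ℂ → ENNReal} (hf : Measurable f)
    (hfin : ∫⁻ s, f s ≠ ⊤) {c : ENNReal} (hc : c ≠ 0) (x₀ : ℝ) :
    ∃ x < x₀, ∫⁻ y : ℝ, f ⟨x, y⟩ ≤ c := by
  by_contra! h
  have hm : Measurable (f ∘ measurableEquivRealProd.symm) :=
    hf.comp measurableEquivRealProd.symm.measurable
  have h1 : ∫⁻ s, f s = ∫⁻ x : ℝ, ∫⁻ y : ℝ, f ⟨x, y⟩ := by
    have := volume_preserving_equiv_real_prod.lintegral_comp_emb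
      measurableEquivRealProd.measurableEmbedding (f ∘ measurableEquivRealProd.symm)
    rw [Measure.volume_eq_prod, lintegral_prod _ hm.aemeasurable] at this
    simpa [measurableEquivRealProd_symm_apply] using this
  refine hfin (top_unique ?_)
  rw [h1]
  calc ⊤ = ∫⁻ x in Iio x₀, c := by simp [hc]
    _ ≤ ∫⁻ x in Iio x₀, ∫⁻ y : ℝ, f ⟨x, y⟩ :=
        setLIntegral_mono' measurableSet_Iio fun x hx => (h x hx).le
    _ ≤ _ := setLIntegral_le_lintegral _ _

/-- A Cauchy–Schwarz bound for the length of a path. -/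
theorem norm_sub_le_of_lintegral_sq_le {f f' : ℝ → ℂ} {a b L ε : ℝ} (hab : a ≤ b)
    (hL : b - a ≤ L) (hL0 : 0 < L) (hε : 0 < ε) (hf : ∀ y ∈ Icc a b, HasDerivAt f (f' y) y)
    (hc : ContinuousOn f' (Icc a b))
    (h : ∫⁻ y in Icc a b, ENNReal.ofReal (‖f' y‖ ^ 2) ≤ ENNReal.ofReal (ε ^ 2 / L)) :
    ‖f b - f a‖ ≤ ε := by
  have hc' : ContinuousOn f' (uIcc a b) := by rwa [uIcc_of_le hab]
  have hsq : ContinuousOn (fun y => ‖f' y‖ ^ 2) (uIcc a b) := hc'.norm.pow 2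
  have h1 : ∫ y in a..b, ‖f' y‖ ^ 2 ≤ ε ^ 2 / L := by
    rw [intervalIntegral.integral_of_le hab, ← integral_Icc_eq_integral_Ioc]
    rw [← ENNReal.ofReal_le_ofReal_iff (by positivity), ofReal_integral_eq_lintegral_ofReal]
    · exact h
    · exact (hc.norm.pow 2).integrableOn_compact isCompact_Icc
    · exact Filter.Eventually.of_forall fun y => by positivity
  set k := L / (2 * ε) with hk
  have hk0 : 0 < k := by positivity
  rw [← intervalIntegral.integral_eq_sub_of_hasDerivAt (f := f) (f' := f')
    (by rwa [uIcc_of_le hab]) hc'.intervalIntegrable]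
  calc ‖∫ y in a..b, f' y‖ ≤ ∫ y in a..b, ‖f' y‖ :=
        intervalIntegral.norm_integral_le_integral_norm hab
    _ ≤ ∫ y in a..b, (k * ‖f' y‖ ^ 2 + 1 / (4 * k)) := by
        refine intervalIntegral.integral_mono_on hab hc'.norm.intervalIntegrable
          ((hsq.const_smul k).add continuousOn_const).intervalIntegrable fun y _ => ?_
        have : k * ‖f' y‖ ^ 2 + 1 / (4 * k) - ‖f' y‖ = k * (‖f' y‖ - 1 / (2 * k)) ^ 2 := by
          field_simp
          ring
        have : 0 ≤ k * (‖f' y‖ - 1 / (2 * k)) ^ 2 := by positivity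
        linarith
    _ = k * (∫ y in a..b, ‖f' y‖ ^ 2) + (b - a) * (1 / (4 * k)) := by
        rw [intervalIntegral.integral_add, intervalIntegral.integral_const_mul,
          intervalIntegral.integral_const, smul_eq_mul]
        · exact (hsq.const_smul k).intervalIntegrable
        · exact intervalIntegrable_const
    _ ≤ k * (ε ^ 2 / L) + L * (1 / (4 * k)) := by gcongr
    _ = ε := by rw [hk]; field_simp; ring

theorem Complex.mem_ball_one_iff {w : ℂ} (hw : w ≠ 0) :
    w ∈ ball (1 : ℂ) 1 ↔ ‖w‖ < 2 * Real.cos (arg w) := by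
  have hw' : 0 < ‖w‖ := norm_pos_iff.2 hw
  rw [mem_ball, dist_eq, ← sq_lt_sq₀ (norm_nonneg _) zero_le_one, ← Complex.normSq_eq_norm_sq,
    cos_arg hw, normSq_apply, ← mul_lt_mul_iff_left₀ (b := ‖w‖) hw',
    show 2 * (w.re / ‖w‖) * ‖w‖ = 2 * w.re by field_simp]
  have : ‖w‖ * ‖w‖ = w.re * w.re + w.im * w.im := by
    rw [← sq, ← Complex.normSq_eq_norm_sq, normSq_apply]
  rw [this]
  simp
  constructor <;> intro h <;> nlinarith

theorem Complex.exp_mem_ball_one_of_mem_Icc {x a b y : ℝ} (ha : |a| ≤ Real.pi / 2)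
    (hb : |b| ≤ Real.pi / 2) (h1 : Real.exp x < 2 * Real.cos a) (h2 : Real.exp x < 2 * Real.cos b)
    (hy : y ∈ Icc a b) : |y| < Real.pi ∧ exp (⟨x, y⟩ : ℂ) ∈ ball (1 : ℂ) 1 := by
  rw [abs_le] at ha hb
  have hpi := Real.pi_pos
  have h3 := strictConcaveOn_cos_Icc.concaveOn.min_le_of_mem_Icc ha hb hy
  have h4 : Real.exp x < 2 * Real.cos y := by
    rcases min_le_iff.1 h3 with h | h <;> linarith
  have hyp : |y| < Real.pi := abs_lt.2 ⟨by linarith [hy.1], by linarith [hy.2]⟩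
  refine ⟨hyp, ?_⟩
  have harg : arg (exp (⟨x, y⟩ : ℂ)) = y := by
    rw [arg_exp, toIocMod_eq_self]
    rw [abs_lt] at hyp
    exact ⟨hyp.1, by simp only; linarith⟩
  rw [mem_ball_one_iff (exp_ne_zero _), harg, norm_exp]
  exact h4

/-- Wolff's lemma: a bounded univalent function on a disk oscillates little on suitable
circular arcs centred at a boundary point. -/
theorem exists_forall_dist_le {G : ℂ → ℂ} (hG : DifferentiableOn ℂ G (ball 1 1))
    (hi : InjOn G (ball 1 1)) (hb : Bornology.IsBounded (G '' ball 1 1)) {δ ε : ℝ} (hδ : 0 < δ)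
    (hε : 0 < ε) :
    ∃ r, 0 < r ∧ r < δ ∧ ∀ w₁ ∈ ball (1 : ℂ) 1, ∀ w₂ ∈ ball (1 : ℂ) 1, ‖w₁‖ = r → ‖w₂‖ = r →
      dist (G w₁) (G w₂) ≤ ε := by
  have hpi := Real.pi_pos
  set T : Set ℂ := {s | |s.im| < Real.pi ∧ exp s ∈ ball (1 : ℂ) 1} with hT
  set H : ℂ → ℂ := fun s => G (exp s) with hH
  have hTo : IsOpen T :=
    (isOpen_lt (f := fun s : ℂ => |s.im|) (by fun_prop) continuous_const).inter
      (isOpen_ball.preimage continuous_exp)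
  have hHd : DifferentiableOn ℂ H T :=
    hG.comp differentiable_exp.differentiableOn fun s hs => hs.2
  have hHi : InjOn H T := fun s hs t ht h => by
    have h1 := hi hs.2 ht.2 h
    have h2 := abs_lt.1 hs.1
    have h3 := abs_lt.1 ht.1
    exact exp_inj_of_neg_pi_lt_of_le_pi h2.1 h2.2.le h3.1 h3.2.le h1
  have hvol : volume (H '' T) ≠ ⊤ := by
    refine (hb.subset ?_).measure_lt_top.ne
    rintro _ ⟨s, hs, rfl⟩
    exact ⟨_, hs.2, rfl⟩
  set F : ℂ → ENNReal := T.indicator fun s => ENNReal.ofReal (‖deriv H s‖ ^ 2) with hF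
  have hFm : Measurable F :=
    (((measurable_deriv H).norm.pow_const 2).ennreal_ofReal).indicator hTo.measurableSet
  have hFi : ∫⁻ s, F s ≠ ⊤ := by
    rw [hF, lintegral_indicator hTo.measurableSet,
      lintegral_sq_norm_deriv_eq_volume_image hTo hHd hHi]
    exact hvol
  obtain ⟨x, hx, hle⟩ := exists_lt_lintegral_le hFm hFi
    (c := ENNReal.ofReal (ε ^ 2 / (2 * Real.pi))) (by simp; positivity) (Real.log δ)
  refine ⟨Real.exp x, Real.exp_pos x, (Real.lt_log_iff_exp_lt hδ).1 hx, ?_⟩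
  have key : ∀ w₁ ∈ ball (1 : ℂ) 1, ∀ w₂ ∈ ball (1 : ℂ) 1, ‖w₁‖ = Real.exp x →
      ‖w₂‖ = Real.exp x → arg w₁ ≤ arg w₂ → dist (G w₁) (G w₂) ≤ ε := by
    intro w₁ h₁ w₂ h₂ hn₁ hn₂ harg
    have hz : ∀ w : ℂ, ‖w‖ = Real.exp x → w ≠ 0 := fun w hw h => by
      rw [h, norm_zero] at hw
      exact (Real.exp_pos x).ne hw
    have hlog : ∀ w : ℂ, ‖w‖ = Real.exp x → exp ⟨x, arg w⟩ = w := fun w hw => by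
      rw [show (⟨x, arg w⟩ : ℂ) = log w from
        Complex.ext (by simp [log_re, hw]) (by simp [log_im]), exp_log (hz w hw)]
    have hcos : ∀ w ∈ ball (1 : ℂ) 1, ‖w‖ = Real.exp x →
        |arg w| ≤ Real.pi / 2 ∧ Real.exp x < 2 * Real.cos (arg w) := fun w hw hn => by
      have h := (mem_ball_one_iff (hz w hn)).1 hw
      rw [hn] at h
      refine ⟨?_, h⟩
      rw [abs_arg_le_pi_div_two_iff]
      have h0 := Real.exp_pos x
      rw [cos_arg (hz w hn), hn] at h
      have : 0 < w.re / Real.exp x := by linarith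
      exact ((div_pos_iff_of_pos_right h0).1 this).le
    obtain ⟨ha, ha'⟩ := hcos w₁ h₁ hn₁
    obtain ⟨hb, hb'⟩ := hcos w₂ h₂ hn₂
    have hseg : ∀ y ∈ Icc (arg w₁) (arg w₂), (⟨x, y⟩ : ℂ) ∈ T := fun y hy =>
      exp_mem_ball_one_of_mem_Icc ha hb ha' hb' hy
    have hline : ∀ y : ℝ, HasDerivAt (fun y : ℝ => (⟨x, y⟩ : ℂ)) I y := fun y => by
      have h := ((hasDerivAt_id y).ofReal_comp.mul_const I).const_add (x : ℂ)
      refine (h.congr_deriv (by simp)).congr_of_eventuallyEq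
        (Filter.Eventually.of_forall fun t => ?_)
      apply Complex.ext <;> simp
    have hdc : ContinuousOn (deriv H) T := (hHd.deriv hTo).continuousOn
    have hmain := norm_sub_le_of_lintegral_sq_le (f := fun y : ℝ => H ⟨x, y⟩)
      (f' := fun y : ℝ => deriv H ⟨x, y⟩ * I) (L := 2 * Real.pi) harg
      (by linarith [neg_pi_lt_arg w₁, arg_le_pi w₂]) (by positivity) hε
      (fun y hy => ((hHd _ (hseg y hy)).differentiableAt
        (hTo.mem_nhds (hseg y hy))).hasDerivAt.comp y (hline y))
      ((hdc.comp (fun y _ => (hline y).continuousAt.continuousWithinAt) hseg).mul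
        continuousOn_const)
      (by
        refine le_trans ?_ hle
        refine le_trans (le_of_eq ?_) (setLIntegral_le_lintegral (Icc (arg w₁) (arg w₂)) _)
        refine setLIntegral_congr_fun measurableSet_Icc fun y hy => ?_
        simp [hF, indicator_of_mem (hseg y hy)])
    simp only [hH, hlog w₁ hn₁, hlog w₂ hn₂] at hmain
    rwa [dist_comm, dist_eq]
  intro w₁ h₁ w₂ h₂ hn₁ hn₂
  rcases le_total (arg w₁) (arg w₂) with h | h
  · exact key w₁ h₁ w₂ h₂ hn₁ hn₂ h
  · rw [dist_comm]
    exact key w₂ h₂ w₁ h₁ hn₂ hn₁ h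

end LengthArea

section CircleImages

open Metric

theorem Circle.isPreconnected_compl_singleton (u : Circle) : IsPreconnected ({u}ᶜ : Set Circle) := by
  have h2 : Circle.exp Real.pi = -1 := Circle.ext (by simp)
  have h : ({u}ᶜ : Set Circle) = (fun t : ℝ => -u * Circle.exp t) '' Ioo (-Real.pi) Real.pi := by
    ext v
    constructor
    · intro hv
      have h1 := Circle.exp_arg (-v * u⁻¹)
      refine ⟨Complex.arg ((-v * u⁻¹ : Circle) : ℂ), ⟨Complex.neg_pi_lt_arg _,
        (Complex.arg_le_pi _).lt_of_ne fun h => hv ?_⟩, ?_⟩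
      · rw [h, h2, neg_mul, neg_inj, eq_comm, mul_inv_eq_one] at h1
        exact h1
      · simp only [h1]
        simp
    · rintro ⟨t, ht, rfl⟩ (h : -u * Circle.exp t = u)
      have h3 : Circle.exp t = -1 := by
        rw [neg_mul, neg_eq_iff_eq_neg] at h
        exact mul_left_cancel (h.trans (by simp : -u = u * -1))
      have h4 := Circle.arg_exp ht.1 ht.2.le
      rw [h3] at h4
      simp only [Circle.coe_neg, Circle.coe_one, Complex.arg_neg_one] at h4
      exact ht.2.ne h4.symm
  rw [h]
  exact isPreconnected_Ioo.image _ (by fun_prop)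

theorem isPreconnected_range_circle_diff_singleton {γ : Circle → ℂ} (hγ : Continuous γ)
    (hi : Function.Injective γ) (c : ℂ) : IsPreconnected (range γ \ {c}) := by
  by_cases hc : c ∈ range γ
  · obtain ⟨u, rfl⟩ := hc
    rw [← image_univ, ← image_singleton, ← image_sdiff hi, ← compl_eq_univ_sdiff]
    exact (Circle.isPreconnected_compl_singleton u).image _ hγ.continuousOn
  · rw [sdiff_singleton_eq_self hc]
    exact isPreconnected_range hγ

instance Circle.instLocallyConnectedSpace : LocallyConnectedSpace Circle :=
  (Circle.isCoveringMap_exp.isQuotientMap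
    fun z => ⟨_, Circle.exp_arg z⟩).isCoinducing.locallyConnectedSpace

/-- An embedded compact locally connected space is uniformly locally connected. -/
theorem exists_isPreconnected_subset_closedBall {X : Type*} [TopologicalSpace X] [CompactSpace X]
    [LocallyConnectedSpace X] {γ : X → ℂ} (hγ : Continuous γ) (hi : Function.Injective γ)
    {ε : ℝ} (hε : 0 < ε) :
    ∃ η, 0 < η ∧ η ≤ ε ∧ ∀ a, ∃ K ⊆ range γ, IsCompact K ∧ IsPreconnected K ∧
      range γ ∩ closedBall a η ⊆ K ∧ K ⊆ closedBall a ε := by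
  have hemb := (hγ.isClosedEmbedding hi).isInducing
  have h1 : ∀ x : X, ∃ W : Set ℂ, IsOpen W ∧ γ x ∈ W ∧ IsPreconnected (γ ⁻¹' W) ∧
      γ ⁻¹' W ⊆ γ ⁻¹' closedBall (γ x) (ε / 4) := by
    intro x
    obtain ⟨V, hVs, hVo, hxV, hVc⟩ := locallyConnectedSpace_iff_subsets_isOpen_isConnected.1
      inferInstance x _ (hγ.continuousAt.preimage_mem_nhds
        (closedBall_mem_nhds (γ x) (by positivity : 0 < ε / 4)))
    obtain ⟨W, hWo, rfl⟩ := hemb.isOpen_iff.1 hVo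
    exact ⟨W, hWo, hxV, hVc.isPreconnected, hVs⟩
  choose W hWo hxW hWc hWs using h1
  obtain ⟨δ, hδ, hleb⟩ := lebesgue_number_lemma_of_metric (isCompact_range hγ) hWo (by
    rintro _ ⟨x, rfl⟩
    exact mem_iUnion.2 ⟨x, hxW x⟩)
  have hη : 0 < min (δ / 3) (ε / 2) := by positivity
  have hη1 : min (δ / 3) (ε / 2) ≤ δ / 3 := min_le_left _ _
  have hη2 : min (δ / 3) (ε / 2) ≤ ε / 2 := min_le_right _ _
  refine ⟨min (δ / 3) (ε / 2), hη, by linarith, fun a => ?_⟩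
  generalize min (δ / 3) (ε / 2) = η at *
  rcases (range γ ∩ closedBall a η).eq_empty_or_nonempty with h | ⟨p, hp, hpa⟩
  · exact ⟨∅, empty_subset _, isCompact_empty, isPreconnected_empty, h.subset, empty_subset _⟩
  obtain ⟨x, hx⟩ := hleb p hp
  have hcl : closure (γ ⁻¹' W x) ⊆ γ ⁻¹' closedBall (γ x) (ε / 4) :=
    closure_minimal (hWs x) (isClosed_closedBall.preimage hγ)
  refine ⟨γ '' closure (γ ⁻¹' W x), image_subset_range _ _,
    isClosed_closure.isCompact.image hγ, (hWc x).closure.image _ hγ.continuousOn, ?_, ?_⟩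
  · rintro _ ⟨⟨y, rfl⟩, hy⟩
    refine ⟨y, subset_closure (hx ?_), rfl⟩
    rw [mem_ball]
    rw [mem_closedBall] at hy hpa
    linarith [dist_triangle_right (γ y) p a]
  · rintro _ ⟨y, hy, rfl⟩
    obtain ⟨z, rfl⟩ := hp
    have h2 := hcl hy
    have h3 := hWs x (hx (mem_ball_self hδ) : z ∈ γ ⁻¹' W x)
    simp only [mem_preimage, mem_closedBall] at h2 h3 hpa ⊢
    linarith [dist_triangle_right (γ y) (γ z) (γ x), dist_triangle (γ y) (γ z) a]

theorem Complex.isPreconnected_compl_closedBall (a : ℂ) {r : ℝ} (hr : 0 < r) :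
    IsPreconnected (closedBall a r)ᶜ := by
  have h : (closedBall a r)ᶜ = (fun z => z + a) '' {z : ℂ | r < ‖z‖} := by
    ext z
    simp [dist_eq_norm, sub_eq_add_neg]
  rw [h]
  exact (isPreconnected_setOf_lt_norm hr).image _ (by fun_prop)

/-- A crosscut of a simply connected domain separates its two sides, also in the complement of a
continuum meeting the boundary of the domain in a connected set. -/
theorem notMem_connectedComponentIn_of_crosscut {B Ω C K : Set ℂ} (hBo : IsOpen B)
    (hBc : IsPreconnected B) {g : ℂ → ℂ} (hg : DifferentiableOn ℂ g B) (hi : InjOn g B)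
    (him : g '' B = Ω) (hC : IsCompact C) (hfr : frontier Ω = C) (hK : IsCompact K)
    (hKC : IsPreconnected (K ∩ C)) {φ : ℂ → ℝ} (hφ : Continuous φ)
    (hφK : ∀ z ∈ B, φ z = 0 → g z ∈ K) {p q : ℂ} (hp : p ∈ B) (hq : q ∈ B) (hp0 : φ p < 0)
    (hq0 : 0 < φ q) (hpK : g p ∉ K) : g q ∉ connectedComponentIn Kᶜ (g p) := by
  intro hmem
  have hΩo : IsOpen Ω := him ▸ isOpen_image_of_injOn hBo hg hi
  have hΩC : Disjoint Ω C := by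
    rw [← hfr, hΩo.frontier_eq]
    exact disjoint_sdiff_right
  have hpΩ : g p ∈ Ω := him ▸ mem_image_of_mem g hp
  have hqΩ : g q ∈ Ω := him ▸ mem_image_of_mem g hq
  have hpC := disjoint_left.1 hΩC hpΩ
  have hΩc : IsPreconnected Ω := him ▸ hBc.image _ hg.continuousOn
  have h1 : g q ∈ connectedComponentIn Cᶜ (g p) :=
    hΩc.subset_connectedComponentIn hpΩ (disjoint_left.1 hΩC) hqΩ
  have h2 := mem_connectedComponentIn_compl_union hK hC hKC hpK hpC hmem h1
  set S := connectedComponentIn (K ∪ C)ᶜ (g p) with hS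
  have hSs : S ⊆ (K ∪ C)ᶜ := connectedComponentIn_subset _ _
  have hpS : g p ∈ S := mem_connectedComponentIn (by simp [hpK, hpC])
  have hSΩ : S ⊆ Ω := by
    refine isPreconnected_connectedComponentIn.subset_of_closure_inter_subset hΩo
      ⟨_, hpS, hpΩ⟩ ?_
    rintro z ⟨hz, hzS⟩
    by_contra hzΩ
    refine hSs hzS (Or.inr ?_)
    rw [← hfr, hΩo.frontier_eq]
    exact ⟨hz, hzΩ⟩
  have hinv : LeftInvOn (Function.invFunOn g B) g B := hi.leftInvOn_invFunOn
  have hk : ContinuousOn (Function.invFunOn g B) S :=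
    ((differentiableOn_of_leftInvOn hBo hg hi hinv).continuousOn.mono
      (hSΩ.trans him.symm.subset))
  obtain ⟨w, hw, hw0⟩ := isPreconnected_connectedComponentIn.intermediate_value hpS h2
    (f := fun w => φ (Function.invFunOn g B w)) (hφ.comp_continuousOn hk)
    (by simp only [hinv hp, hinv hq]; exact ⟨hp0.le, hq0.le⟩ : (0 : ℝ) ∈ _)
  obtain ⟨z, hz, rfl⟩ : w ∈ g '' B := him ▸ hSΩ hw
  simp only [hinv hz] at hw0
  exact hSs hw (Or.inl (hφK z hz hw0))

end CircleImages

section Caratheodory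

open Complex Metric Filter

variable {γ : Circle → ℂ} {g : ℂ → ℂ} {Ω : Set ℂ}

theorem exists_forall_dist_le_of_mem_ball (hγ : Continuous γ) (hγi : Function.Injective γ)
    (hg : DifferentiableOn ℂ g (ball 1 1)) (hi : InjOn g (ball 1 1)) (him : g '' ball 1 1 = Ω)
    (hb : Bornology.IsBounded Ω) (hfr : frontier Ω = range γ) {ε : ℝ} (hε : 0 < ε) :
    ∃ r > 0, ∀ w₁ ∈ ball (1 : ℂ) 1, ∀ w₂ ∈ ball (1 : ℂ) 1, ‖w₁‖ < r → ‖w₂‖ < r →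
      dist (g w₁) (g w₂) ≤ ε := by
  have m1 : (1 : ℂ) ∈ ball (1 : ℂ) 1 := mem_ball_self one_pos
  have m2 : (3 / 2 : ℂ) ∈ ball (1 : ℂ) 1 := by
    rw [mem_ball, dist_eq, show (3 / 2 - 1 : ℂ) = ((1 / 2 : ℝ) : ℂ) by push_cast; ring, norm_real]
    norm_num
  have hd : 0 < dist (g 1) (g (3 / 2)) := by
    refine dist_pos.2 fun h => ?_
    have := hi m1 m2 h
    norm_num at this
  obtain ⟨ε₀, hε₀, hε₁, hε₂⟩ : ∃ ε₀ > 0, 2 * ε₀ ≤ ε ∧ 2 * ε₀ < dist (g 1) (g (3 / 2)) := by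
    refine ⟨min (ε / 2) (dist (g 1) (g (3 / 2)) / 3), by positivity, ?_, ?_⟩
    · linarith [min_le_left (ε / 2) (dist (g 1) (g (3 / 2)) / 3)]
    · linarith [min_le_right (ε / 2) (dist (g 1) (g (3 / 2)) / 3)]
  have hfar : ∀ a x y : ℂ, 2 * ε₀ < dist x y → x ∉ closedBall a ε₀ ∨ y ∉ closedBall a ε₀ := by
    intro a x y h
    by_contra! h'
    rw [mem_closedBall, mem_closedBall] at h'
    linarith [dist_triangle_right x y a]
  obtain ⟨η, hη, hηε, harc⟩ := exists_isPreconnected_subset_closedBall hγ hγi hε₀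
  obtain ⟨r, hr, hr2, hosc⟩ := exists_forall_dist_le hg hi (him ▸ hb) one_half_pos hη
  have mr : (r : ℂ) ∈ ball (1 : ℂ) 1 := by
    rw [mem_ball, dist_eq, ← ofReal_one, ← ofReal_sub, norm_real, Real.norm_eq_abs, abs_lt]
    constructor <;> linarith
  have nr : ‖(r : ℂ)‖ = r := by rw [norm_real, Real.norm_of_nonneg hr.le]
  obtain ⟨L, hLs, hLc, hLp, hL1, hL2⟩ := harc (g r)
  set J := closure (g '' (ball 1 1 ∩ sphere 0 r)) with hJ
  have hJs : J ⊆ closedBall (g r) η := by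
    refine closure_minimal ?_ isClosed_closedBall
    rintro _ ⟨w, ⟨hw, hwr⟩, rfl⟩
    exact hosc w hw r mr (mem_sphere_zero_iff_norm.1 hwr) nr
  have hJc : IsCompact J := (isCompact_closedBall (g r) η).of_isClosed_subset isClosed_closure hJs
  have hKs : J ∪ L ⊆ closedBall (g r) ε₀ :=
    union_subset (hJs.trans (closedBall_subset_closedBall hηε)) hL2
  have hKL : (J ∪ L) ∩ range γ = L := by
    rw [union_inter_distrib_right, inter_eq_left.2 hLs, union_eq_right]
    exact fun z hz => hL1 ⟨hz.2, hJs hz.1⟩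
  refine ⟨r, hr, fun w₁ h₁ w₂ h₂ hn₁ hn₂ => ?_⟩
  by_contra! hlt
  obtain ⟨w, hw, hwr, hwB⟩ : ∃ w ∈ ball (1 : ℂ) 1, ‖w‖ < r ∧ g w ∉ closedBall (g r) ε₀ := by
    rcases hfar (g r) _ _ (hε₁.trans_lt hlt) with h | h
    exacts [⟨w₁, h₁, hn₁, h⟩, ⟨w₂, h₂, hn₂, h⟩]
  obtain ⟨q, hq, hqr, hqB⟩ : ∃ q ∈ ball (1 : ℂ) 1, r < ‖q‖ ∧ g q ∉ closedBall (g r) ε₀ := by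
    rcases hfar (g r) _ _ hε₂ with h | h
    · exact ⟨1, m1, by rw [norm_one]; linarith, h⟩
    · refine ⟨_, m2, ?_, h⟩
      rw [show (3 / 2 : ℂ) = ((3 / 2 : ℝ) : ℂ) by push_cast; ring, norm_real]
      norm_num
      linarith
  refine notMem_connectedComponentIn_of_crosscut isOpen_ball (convex_ball _ _).isPreconnected hg hi
    him (isCompact_range hγ) hfr (hJc.union hLc) (by rwa [hKL]) (φ := fun w => ‖w‖ - r)
    (by fun_prop) (fun z hz h => Or.inl (subset_closure ⟨z, ⟨hz, ?_⟩, rfl⟩)) hw hq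
    (by simpa using hwr) (by simpa using hqr) (fun h => hwB (hKs h)) ?_
  · exact mem_sphere_zero_iff_norm.2 (sub_eq_zero.1 h)
  · exact (isPreconnected_compl_closedBall _ hε₀).subset_connectedComponentIn hwB
      (compl_subset_compl.2 hKs) hqB

theorem exists_tendsto_of_mem_sphere (hγ : Continuous γ) (hγi : Function.Injective γ)
    (hg : DifferentiableOn ℂ g (ball 0 1)) (hi : InjOn g (ball 0 1)) (him : g '' ball 0 1 = Ω)
    (hb : Bornology.IsBounded Ω) (hfr : frontier Ω = range γ)
    {ζ : ℂ} (hζ : ‖ζ‖ = 1) :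
    ∃ y, Tendsto g (𝓝[ball 0 1] ζ) (𝓝 y) := by
  have hζ0 : ζ ≠ 0 := norm_pos_iff.1 (hζ ▸ one_pos)
  have hne : (𝓝[ball 0 1] ζ).NeBot := by
    rw [← mem_closure_iff_nhdsWithin_neBot, closure_ball _ one_ne_zero]
    exact mem_closedBall_zero_iff.2 hζ.le
  have hmap : ∀ w ∈ ball (1 : ℂ) 1, ζ * (1 - w) ∈ ball (0 : ℂ) 1 := fun w hw => by
    rw [mem_ball, dist_comm, dist_eq] at hw
    rwa [mem_ball_zero_iff, norm_mul, hζ, one_mul]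
  have hmap' : ∀ z ∈ ball (0 : ℂ) 1, 1 - z / ζ ∈ ball (1 : ℂ) 1 := fun z hz => by
    rw [mem_ball_zero_iff] at hz
    rw [mem_ball, dist_eq]
    simpa [hζ] using hz
  have hinv : ∀ z, ζ * (1 - (1 - z / ζ)) = z := fun z => by field_simp; ring
  have him' : (fun w => g (ζ * (1 - w))) '' ball 1 1 = Ω := by
    rw [← him]
    ext y
    constructor
    · rintro ⟨w, hw, rfl⟩
      exact ⟨_, hmap w hw, rfl⟩
    · rintro ⟨z, hz, rfl⟩
      exact ⟨_, hmap' z hz, by simp only [hinv]⟩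
  rw [← cauchy_map_iff_exists_tendsto, Metric.cauchy_iff]
  refine ⟨hne.map g, fun ε hε => ?_⟩
  obtain ⟨r, hr, h⟩ := exists_forall_dist_le_of_mem_ball hγ hγi
    (g := fun w => g (ζ * (1 - w))) (hg.comp (by fun_prop) hmap)
    (fun w hw w' hw' h => by
      have := mul_left_cancel₀ hζ0 (hi (hmap w hw) (hmap w' hw') h)
      linear_combination -this) him' hb hfr (half_pos hε)
  refine ⟨g '' (ball 0 1 ∩ ball ζ r), image_mem_map (inter_mem_nhdsWithin _ (ball_mem_nhds ζ hr)),
    ?_⟩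
  have hn : ∀ z ∈ ball ζ r, ‖1 - z / ζ‖ < r := fun z hz => by
    rw [show 1 - z / ζ = (ζ - z) / ζ by field_simp, norm_div, hζ, div_one, ← dist_eq, dist_comm]
    exact hz
  rintro _ ⟨z₁, ⟨h₁, h₁'⟩, rfl⟩ _ ⟨z₂, ⟨h₂, h₂'⟩, rfl⟩
  have := h _ (hmap' z₁ h₁) _ (hmap' z₂ h₂) (hn z₁ h₁') (hn z₂ h₂')
  simp only [hinv] at this
  linarith

theorem exists_continuousOn_closedBall_eqOn (hγ : Continuous γ) (hγi : Function.Injective γ)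
    (hg : DifferentiableOn ℂ g (ball 0 1)) (hi : InjOn g (ball 0 1)) (him : g '' ball 0 1 = Ω)
    (hb : Bornology.IsBounded Ω) (hfr : frontier Ω = range γ) :
    ∃ f : ℂ → ℂ, ContinuousOn f (closedBall 0 1) ∧ EqOn f g (ball 0 1) := by
  have hc : closure (ball (0 : ℂ) 1) = closedBall 0 1 := closure_ball _ one_ne_zero
  refine ⟨extendFrom (ball 0 1) g, continuousOn_extendFrom hc.symm.subset fun x hx => ?_,
    extendFrom_extends hg.continuousOn⟩
  rcases (mem_closedBall_zero_iff.1 hx).eq_or_lt with h | h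
  · exact exists_tendsto_of_mem_sphere hγ hγi hg hi him hb hfr h
  · exact ⟨g x, hg.continuousOn x (mem_ball_zero_iff.2 h)⟩

theorem image_sphere_eq_range (hg : DifferentiableOn ℂ g (ball 0 1)) (hi : InjOn g (ball 0 1))
    (him : g '' ball 0 1 = Ω) (hfr : frontier Ω = range γ)
    {f : ℂ → ℂ} (hf : ContinuousOn f (closedBall 0 1)) (hfg : EqOn f g (ball 0 1)) : f '' sphere 0 1 = range γ := by
  have hΩo : IsOpen Ω := him ▸ isOpen_image_of_injOn isOpen_ball hg hi
  have hc : closure (ball (0 : ℂ) 1) = closedBall 0 1 := closure_ball _ one_ne_zero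
  rw [← hfr, hΩo.frontier_eq]
  have h1 : f '' ball 0 1 = Ω := by rw [hfg.image_eq, him]
  have h2 : closure Ω = f '' closedBall 0 1 := by
    refine (closure_minimal ?_ ((isCompact_closedBall _ _).image_of_continuousOn hf).isClosed).antisymm
      ?_
    · rw [← h1]
      exact image_mono ball_subset_closedBall
    · rw [← h1, ← hc]
      exact ContinuousOn.image_closure (hc.symm ▸ hf)
  apply subset_antisymm
  · rintro _ ⟨ζ, hζ, rfl⟩
    refine ⟨h2 ▸ mem_image_of_mem f (sphere_subset_closedBall hζ), fun hmem => ?_⟩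
    rw [← him] at hmem
    obtain ⟨z, hz, hzf⟩ := hmem
    have hinv : LeftInvOn (Function.invFunOn g (ball 0 1)) g (ball 0 1) := hi.leftInvOn_invFunOn
    have hk := (differentiableOn_of_leftInvOn isOpen_ball hg hi hinv).continuousOn
    have hfζ : f ζ ∈ g '' ball 0 1 := ⟨z, hz, hzf⟩
    have hne : (𝓝[ball 0 1] ζ).NeBot := by
      rw [← mem_closure_iff_nhdsWithin_neBot, hc]
      exact sphere_subset_closedBall hζ
    have t1 : Tendsto f (𝓝[ball 0 1] ζ) (𝓝[g '' ball 0 1] (f ζ)) := by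
      refine tendsto_nhdsWithin_iff.2 ⟨((hf ζ (sphere_subset_closedBall hζ)).mono
        ball_subset_closedBall), ?_⟩
      filter_upwards [self_mem_nhdsWithin] with x hx
      exact hfg hx ▸ mem_image_of_mem g hx
    have t2 := (hk (f ζ) hfζ).tendsto.comp t1
    have t3 : Tendsto (fun x : ℂ => x) (𝓝[ball 0 1] ζ)
        (𝓝 (Function.invFunOn g (ball 0 1) (f ζ))) := by
      refine t2.congr' ?_
      filter_upwards [self_mem_nhdsWithin] with x hx
      simp only [Function.comp, hfg hx, hinv hx]
    have t4 : Tendsto (fun x : ℂ => x) (𝓝[ball 0 1] ζ) (𝓝 ζ) := tendsto_nhdsWithin_of_tendsto_nhds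
      tendsto_id
    have := tendsto_nhds_unique t3 t4
    rw [← hzf, hinv hz] at this
    rw [mem_ball_zero_iff, this, mem_sphere_zero_iff_norm.1 hζ] at hz
    exact hz.false
  · rintro y ⟨hy, hyΩ⟩
    rw [h2] at hy
    obtain ⟨z, hz, rfl⟩ := hy
    refine ⟨z, ?_, rfl⟩
    rw [mem_sphere_zero_iff_norm]
    refine (mem_closedBall_zero_iff.1 hz).eq_of_not_lt fun h => hyΩ ?_
    exact h1 ▸ mem_image_of_mem f (mem_ball_zero_iff.2 h)

end Caratheodory

section BoundaryInjectivity

open Complex Metric Filter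

/-- Boundary uniqueness: a function on the closed disk that is constant on a boundary arc takes
the same value at the centre. -/
theorem eq_of_eqOn_sphere_inter {f : ℂ → ℂ} (hf : DiffContOnCl ℂ f (ball 0 1)) {V : Set ℂ}
    (hV : IsOpen V) {ζ₀ : ℂ} (hζ₀ : ζ₀ ∈ sphere (0 : ℂ) 1) (hζV : ζ₀ ∈ V) {c : ℂ}
    (hc : ∀ ζ ∈ sphere (0 : ℂ) 1, ζ ∈ V → f ζ = c) : f 0 = c := by
  have hn : ∀ ζ ∈ sphere (0 : ℂ) 1, ‖ζ‖ = 1 := fun ζ hζ => mem_sphere_zero_iff_norm.1 hζ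
  have hne : ∀ ζ ∈ sphere (0 : ℂ) 1, ζ ≠ 0 := fun ζ hζ => norm_pos_iff.1 (hn ζ hζ ▸ one_pos)
  obtain ⟨t, ht⟩ := (isCompact_sphere (0 : ℂ) 1).elim_finite_subcover
    (fun u : sphere (0 : ℂ) 1 => (fun ζ => (u : ℂ) * ζ) ⁻¹' V)
    (fun u => hV.preimage (by fun_prop)) (fun ζ hζ => mem_iUnion.2
      ⟨⟨ζ₀ / ζ, by rw [mem_sphere_zero_iff_norm, norm_div, hn _ hζ, hn _ hζ₀, div_one]⟩, by
        simpa [div_mul_cancel₀ _ (hne ζ hζ)] using hζV⟩)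
  have hrot : ∀ u : sphere (0 : ℂ) 1, DiffContOnCl ℂ (fun z => f ((u : ℂ) * z) - c) (ball 0 1) := by
    intro u
    refine DiffContOnCl.sub_const (hf.comp (g := fun z => (u : ℂ) * z)
      (Differentiable.diffContOnCl (by fun_prop)) fun z hz => ?_) c
    rw [mem_ball_zero_iff] at hz ⊢
    rwa [norm_mul, hn _ u.2, one_mul]
  have hprod : DiffContOnCl ℂ (fun z => ∏ u ∈ t, (f ((u : ℂ) * z) - c)) (ball 0 1) :=
    ⟨DifferentiableOn.fun_finsetProd fun u _ => (hrot u).differentiableOn,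
      continuousOn_finsetProd _ fun u _ => (hrot u).continuousOn⟩
  have h := eqOn_of_eqOn_frontier isBounded_ball hprod
    (diffContOnCl_const (c := (0 : ℂ))) (fun ζ hζ => by
      rw [frontier_ball _ one_ne_zero] at hζ
      obtain ⟨u, hu, huV⟩ := mem_iUnion₂.1 (ht hζ)
      refine Finset.prod_eq_zero hu (sub_eq_zero.2 (hc _ ?_ huV))
      rw [mem_sphere_zero_iff_norm, norm_mul, hn _ u.2, hn _ hζ, one_mul]) (mem_ball_self one_pos)
  simp only [mul_zero] at h
  obtain ⟨u, -, hu⟩ := Finset.prod_eq_zero_iff.1 h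
  exact sub_eq_zero.1 hu

/-- A real-affine function vanishing on the line through two points. -/
noncomputable def Complex.lineForm (a b z : ℂ) : ℝ := ((z - a) / (b - a)).im

theorem Complex.continuous_lineForm (a b : ℂ) : Continuous (lineForm a b) := by
  unfold lineForm
  fun_prop

theorem Complex.lineForm_swap {a b : ℂ} (h : a ≠ b) (z : ℂ) : lineForm b a z = -lineForm a b z := by
  have h1 : b - a ≠ 0 := sub_ne_zero.2 h.symm
  have h2 : a - b ≠ 0 := sub_ne_zero.2 h
  have : (z - b) / (a - b) = 1 - (z - a) / (b - a) := by
    field_simp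
    ring
  rw [lineForm, lineForm, this]
  simp

theorem Complex.convex_setOf_lineForm_pos (a b : ℂ) : Convex ℝ {z | 0 < lineForm a b z} := by
  intro x hx y hy s t hs ht hst
  have h : lineForm a b (s • x + t • y) = s * lineForm a b x + t * lineForm a b y := by
    have : ((s • x + t • y) - a) / (b - a) = s • ((x - a) / (b - a)) + t • ((y - a) / (b - a)) := by
      have : (s : ℂ) + t = 1 := by exact_mod_cast hst
      simp only [real_smul]
      rw [← sub_eq_zero]
      linear_combination (a / (b - a)) * this
    rw [lineForm, this]
    simp [lineForm]
  have h2 : 0 ≤ s * lineForm a b x := mul_nonneg hs (le_of_lt hx)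
  have h3 : 0 ≤ t * lineForm a b y := mul_nonneg ht (le_of_lt hy)
  rw [mem_ofPred_eq, h]
  rcases hs.eq_or_lt with rfl | hs
  · rw [zero_add] at hst
    subst hst
    simpa using hy
  · have := mul_pos hs hx
    linarith

theorem Complex.eq_or_eq_of_lineForm_eq_zero {a b z : ℂ} (hab : a ≠ b) (ha : ‖a‖ = 1)
    (hb : ‖b‖ = 1) (hz : ‖z‖ = 1) (h : lineForm a b z = 0) : z = a ∨ z = b := by
  have h1 : b - a ≠ 0 := sub_ne_zero.2 hab.symm
  set t := ((z - a) / (b - a)).re with ht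
  have h2 : z = a + t * (b - a) := by
    have : (z - a) / (b - a) = t := Complex.ext (by simp [ht]) (by simpa [lineForm] using h)
    rw [← this]
    field_simp
    ring
  have hsq : ∀ w : ℂ, ‖w‖ = 1 → w.re * w.re + w.im * w.im = 1 := fun w hw => by
    rw [← normSq_apply, normSq_eq_norm_sq, hw, one_pow]
  have hz' := hsq z hz
  have ha' := hsq a ha
  have hb' := hsq b hb
  have hd : 0 < (b.re - a.re) * (b.re - a.re) + (b.im - a.im) * (b.im - a.im) := by
    have := normSq_pos.2 h1
    rwa [normSq_apply, sub_re, sub_im] at this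
  rw [h2] at hz'
  simp at hz'
  have h3 : t * (1 - t) * ((b.re - a.re) * (b.re - a.re) + (b.im - a.im) * (b.im - a.im)) = 0 := by
    linear_combination (1 - t) * ha' + t * hb' - hz'
  rcases mul_eq_zero.1 ((mul_eq_zero.1 h3).resolve_right hd.ne') with h4 | h4
  · left
    rw [h2, h4]
    simp
  · right
    rw [h2, show t = 1 by linarith]
    simp

theorem Complex.exists_lineForm_pos {a b : ℂ} (hab : a ≠ b) (ha : ‖a‖ = 1) (hb : ‖b‖ = 1) :
    ∃ ζ ∈ sphere (0 : ℂ) 1, 0 < lineForm a b ζ := by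
  have h1 : b - a ≠ 0 := sub_ne_zero.2 hab.symm
  set φ : ℝ → ℂ := fun s => (a + b) / 2 + (s : ℂ) * (I * (b - a)) with hφ
  have hl : ∀ s, lineForm a b (φ s) = s := fun s => by
    have : (φ s - a) / (b - a) = ((1 / 2 : ℝ) : ℂ) + (s : ℂ) * I := by
      simp only [hφ]
      field_simp
      push_cast
      ring
    rw [lineForm, this]
    simp
  have hlt : ‖φ 0‖ < 1 := by
    have : φ 0 = (1 / 2 : ℝ) • a + (1 / 2 : ℝ) • b := by simp [hφ]; ring
    rw [this]
    exact (norm_combo_lt_of_ne ha.le hb.le hab (by norm_num) (by norm_num) (by norm_num))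
  have hn : 0 < ‖b - a‖ := norm_pos_iff.2 h1
  have hgt : 1 ≤ ‖φ (2 / ‖b - a‖)‖ := by
    have e : ‖φ (2 / ‖b - a‖) - φ 0‖ = 2 := by
      rw [show φ (2 / ‖b - a‖) - φ 0 = ((2 / ‖b - a‖ : ℝ) : ℂ) * (I * (b - a)) by
        simp only [hφ]; push_cast; ring]
      rw [norm_mul, norm_mul, norm_I, one_mul, norm_real, Real.norm_of_nonneg (by positivity)]
      field_simp
    linarith [norm_sub_le (φ (2 / ‖b - a‖)) (φ 0)]
  obtain ⟨s, hs, hs1⟩ := intermediate_value_Icc (f := fun s => ‖φ s‖)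
    (by positivity : (0 : ℝ) ≤ 2 / ‖b - a‖) (by simp only [hφ]; fun_prop) ⟨hlt.le, hgt⟩
  refine ⟨φ s, mem_sphere_zero_iff_norm.2 hs1, ?_⟩
  rw [hl]
  refine hs.1.lt_of_ne fun h => ?_
  simp only [← h] at hs1
  exact hlt.ne hs1

theorem image_subset_connectedComponentIn_of_convex {f : ℂ → ℂ}
    (hf : DiffContOnCl ℂ f (ball 0 1)) {C Γ H : Set ℂ} (hΓ : IsClosed Γ) {c e : ℂ}
    (hfC : f '' sphere 0 1 ⊆ C) (hCe : C \ {c} ⊆ connectedComponentIn Γᶜ e) (h0 : f 0 ≠ c)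
    (hHo : IsOpen H) (hHc : Convex ℝ H) (hH : (sphere 0 1 ∩ H).Nonempty)
    (hHΓ : ∀ z ∈ ball (0 : ℂ) 1, z ∈ H → f z ∉ Γ) :
    ∀ z ∈ ball (0 : ℂ) 1, z ∈ H → f z ∈ connectedComponentIn Γᶜ e := by
  intro p hp hpH
  by_contra hpe
  obtain ⟨ζ₀, hζ₀, hζ₀H⟩ := hH
  have hcl : closure (ball (0 : ℂ) 1) = closedBall 0 1 := closure_ball _ one_ne_zero
  refine h0 (eq_of_eqOn_sphere_inter hf hHo hζ₀ hζ₀H fun ζ hζ hζH => ?_)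
  by_contra hne
  have hfe : f ζ ∈ connectedComponentIn Γᶜ e := hCe ⟨hfC ⟨ζ, hζ, rfl⟩, hne⟩
  have hEo : IsOpen (connectedComponentIn Γᶜ e) := hΓ.isOpen_compl.connectedComponentIn
  have hζc : ζ ∈ closure (ball (0 : ℂ) 1) := hcl ▸ sphere_subset_closedBall hζ
  have ht : Tendsto f (𝓝[ball 0 1] ζ) (𝓝 (f ζ)) :=
    (hf.continuousOn ζ hζc).mono subset_closure
  have hnb : (𝓝[ball 0 1] ζ).NeBot := mem_closure_iff_nhdsWithin_neBot.1 hζc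
  obtain ⟨z, ⟨hze, hzH⟩, hz⟩ := (((ht.eventually (hEo.eventually_mem hfe)).and
    (mem_nhdsWithin_of_mem_nhds (hHo.mem_nhds hζH))).and self_mem_nhdsWithin).exists
  have hS : IsPreconnected (f '' (ball 0 1 ∩ H)) :=
    ((convex_ball _ _).inter hHc).isPreconnected.image _
      (hf.differentiableOn.continuousOn.mono inter_subset_left)
  have hsub := hS.subset_connectedComponentIn (F := Γᶜ) ⟨z, ⟨hz, hzH⟩, rfl⟩ (by
    rintro _ ⟨w, ⟨hw, hwH⟩, rfl⟩
    exact hHΓ w hw hwH)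
  rw [← connectedComponentIn_eq hze] at hsub
  exact hpe (hsub ⟨p, ⟨hp, hpH⟩, rfl⟩)

theorem injOn_sphere_of_eqOn {γ : Circle → ℂ} {f g : ℂ → ℂ} {Ω : Set ℂ} (hγ : Continuous γ)
    (hγi : Function.Injective γ) (hg : DifferentiableOn ℂ g (ball 0 1)) (hi : InjOn g (ball 0 1))
    (him : g '' ball 0 1 = Ω) (hfr : frontier Ω = range γ)
    (hf : ContinuousOn f (closedBall 0 1)) (hfg : EqOn f g (ball 0 1)) :
    InjOn f (sphere 0 1) := by
  intro a ha b hb hab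
  by_contra hne
  have hcl : closure (ball (0 : ℂ) 1) = closedBall 0 1 := closure_ball _ one_ne_zero
  have hΩo : IsOpen Ω := him ▸ isOpen_image_of_injOn isOpen_ball hg hi
  have hΩC : Disjoint Ω (range γ) := by
    rw [← hfr, hΩo.frontier_eq]
    exact disjoint_sdiff_right
  have hfd : DiffContOnCl ℂ f (ball 0 1) := ⟨hg.congr hfg, hcl.symm ▸ hf⟩
  have hsph := image_sphere_eq_range hg hi him hfr hf hfg
  have hfi : InjOn f (ball 0 1) := fun x hx y hy h => hi hx hy (by rwa [← hfg hx, ← hfg hy])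
  have hfΩ : ∀ z ∈ ball (0 : ℂ) 1, f z ∈ Ω := fun z hz => by
    rw [← him, hfg hz]
    exact mem_image_of_mem g hz
  have hfC : ∀ z ∈ ball (0 : ℂ) 1, f z ∉ range γ := fun z hz => disjoint_left.1 hΩC (hfΩ z hz)
  have ha1 := mem_sphere_zero_iff_norm.1 ha
  have hb1 := mem_sphere_zero_iff_norm.1 hb
  have hcC : f a ∈ range γ := hsph ▸ mem_image_of_mem f ha
  set R := closedBall (0 : ℂ) 1 ∩ {z | lineForm a b z = 0} with hR
  have hRc : IsCompact R := (isCompact_closedBall _ _).inter_right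
    (isClosed_eq (continuous_lineForm a b) continuous_const)
  have hΓc : IsCompact (f '' R) := hRc.image_of_continuousOn (hf.mono inter_subset_left)
  have haR : a ∈ R := ⟨sphere_subset_closedBall ha, by simp [lineForm]⟩
  have hΓC : f '' R ∩ range γ = {f a} := by
    apply subset_antisymm
    · rintro _ ⟨⟨z, ⟨hz, hz0⟩, rfl⟩, hzC⟩
      have hz1 : ‖z‖ = 1 := (mem_closedBall_zero_iff.1 hz).eq_of_not_lt fun h =>
        hfC z (mem_ball_zero_iff.2 h) hzC
      rcases eq_or_eq_of_lineForm_eq_zero hne ha1 hb1 hz1 hz0 with rfl | rfl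
      · rfl
      · exact hab.symm
    · rintro _ rfl
      exact ⟨⟨a, haR, rfl⟩, hcC⟩
  obtain ⟨e, heC, hea⟩ : ∃ e ∈ range γ, e ≠ f a := by
    by_contra! h
    exact one_ne_zero' ℝ (by
      have h1 := hγi ((h _ ⟨1, rfl⟩).trans (h _ ⟨-1, rfl⟩).symm)
      have := congrArg (fun z : Circle => (z : ℂ).re) h1
      simp at this
      linarith)
  have hCe : range γ \ {f a} ⊆ connectedComponentIn (f '' R)ᶜ e :=
    (isPreconnected_range_circle_diff_singleton hγ hγi (f a)).subset_connectedComponentIn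
      ⟨heC, hea⟩ fun z hz hzΓ => hz.2 (hΓC.subset ⟨hzΓ, hz.1⟩)
  have hnot : ∀ z ∈ ball (0 : ℂ) 1, lineForm a b z ≠ 0 → f z ∉ f '' R := by
    rintro z hz hz0 ⟨w, ⟨hw, hw0⟩, hwz⟩
    have hw1 : w ∈ ball (0 : ℂ) 1 := by
      refine mem_ball_zero_iff.2 ((mem_closedBall_zero_iff.1 hw).lt_of_ne fun h => ?_)
      refine hfC z hz (hwz ▸ hsph ▸ mem_image_of_mem f (mem_sphere_zero_iff_norm.2 h))
    exact hz0 (hfi hw1 hz hwz ▸ hw0)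
  have h0 : f 0 ≠ f a := fun h => hfC 0 (mem_ball_self one_pos) (h ▸ hcC)
  have hex : ∀ V : Set ℂ, IsOpen V → (sphere 0 1 ∩ V).Nonempty → (ball 0 1 ∩ V).Nonempty := by
    rintro V hV ⟨ζ, hζ, hζV⟩
    rw [inter_comm]
    exact mem_closure_iff.1 (hcl.symm ▸ sphere_subset_closedBall hζ) V hV hζV
  obtain ⟨ζ, hζ, hζ0⟩ := exists_lineForm_pos hne ha1 hb1
  obtain ⟨ξ, hξ, hξ0⟩ := exists_lineForm_pos (Ne.symm hne) hb1 ha1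
  have o₁ : IsOpen {z | 0 < lineForm a b z} := isOpen_lt continuous_const (continuous_lineForm a b)
  have o₂ : IsOpen {z | 0 < lineForm b a z} := isOpen_lt continuous_const (continuous_lineForm b a)
  obtain ⟨q, hq, hq0⟩ := hex _ o₁ ⟨ζ, hζ, hζ0⟩
  obtain ⟨p, hp, hp0⟩ := hex _ o₂ ⟨ξ, hξ, hξ0⟩
  have hqe := image_subset_connectedComponentIn_of_convex hfd hΓc.isClosed hsph.subset hCe h0 o₁
    (convex_setOf_lineForm_pos a b) ⟨ζ, hζ, hζ0⟩
    (fun z hz hz0 => hnot z hz (ne_of_gt hz0)) q hq hq0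
  have hpe := image_subset_connectedComponentIn_of_convex hfd hΓc.isClosed hsph.subset hCe h0 o₂
    (convex_setOf_lineForm_pos b a) ⟨ξ, hξ, hξ0⟩
    (fun z hz hz0 => hnot z hz fun h => by
      have hz0' : 0 < lineForm b a z := hz0
      rw [lineForm_swap hne, h, neg_zero] at hz0'
      exact hz0'.false) p hp hp0
  have hp0' : lineForm a b p < 0 := by
    have : 0 < lineForm b a p := hp0
    rw [lineForm_swap hne] at this
    linarith
  rw [connectedComponentIn_eq hpe, hfg hp, hfg hq] at hqe
  refine notMem_connectedComponentIn_of_crosscut isOpen_ball (convex_ball _ _).isPreconnected hg hi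
    him (isCompact_range hγ) hfr hΓc (hΓC ▸ isPreconnected_singleton) (continuous_lineForm a b)
    (fun z hz hz0 => ⟨z, ⟨ball_subset_closedBall hz, hz0⟩, hfg hz⟩) hp hq hp0' hq0 ?_ hqe
  exact hfg hp ▸ hnot p hp hp0'.ne

end BoundaryInjectivity

section Schoenflies

open Complex Metric

/-- The Jordan–Schoenflies theorem for the bounded side: a Jordan curve bounds a closed disk whose
interior is open in the plane. -/
theorem exists_injOn_closedBall_image_sphere_eq {γ : Circle → ℂ} (hγ : Continuous γ)
    (hγi : Function.Injective γ) :
    ∃ f : ℂ → ℂ, ContinuousOn f (closedBall 0 1) ∧ InjOn f (closedBall 0 1) ∧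
      f '' sphere 0 1 = range γ ∧ IsOpen (f '' ball 0 1) := by
  have hC := isCompact_range hγ
  have hCc : IsPreconnected (range γ) := isPreconnected_range hγ
  obtain ⟨p, hp, hb⟩ := exists_isBounded_connectedComponentIn_compl hC.isBounded
    (not_isPreconnected_compl_range_circle hγ hγi)
  set Ω := connectedComponentIn (range γ)ᶜ p with hΩ
  have ho : IsOpen Ω := hC.isClosed.isOpen_compl.connectedComponentIn
  have hc : IsPreconnected Ω := isPreconnected_connectedComponentIn
  have hfr : frontier Ω = range γ := frontier_connectedComponentIn_compl_range_circle hγ hγi hp hb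
  have hcc : IsPreconnected Ωᶜ :=
    isPreconnected_compl_connectedComponentIn hC.isClosed hCc (range_nonempty γ) p
  obtain ⟨g, hg, hi, him⟩ := exists_injOn_image_ball_eq ho hc hb ⟨p, mem_connectedComponentIn hp⟩
    fun f hf h0 => hasLogOn_of_isPreconnected_compl ho hc hb hcc hf h0
  obtain ⟨f, hf, hfg⟩ := exists_continuousOn_closedBall_eqOn hγ hγi hg hi him hb hfr
  have hsph := image_sphere_eq_range hg hi him hfr hf hfg
  have hball : f '' ball 0 1 = Ω := by rw [hfg.image_eq, him]
  refine ⟨f, hf, ?_, hsph, hball ▸ ho⟩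
  have hdis : ∀ z ∈ ball (0 : ℂ) 1, ∀ w ∈ sphere (0 : ℂ) 1, f z ≠ f w := fun z hz w hw h =>
    connectedComponentIn_subset _ _ (hball ▸ mem_image_of_mem f hz : f z ∈ Ω)
      (h ▸ hsph ▸ mem_image_of_mem f hw)
  have hs := injOn_sphere_of_eqOn hγ hγi hg hi him hfr hf hfg
  intro z hz w hw h
  rw [← ball_union_sphere] at hz hw
  rcases hz with hz | hz <;> rcases hw with hw | hw
  · exact hi hz hw (by rwa [← hfg hz, ← hfg hw])
  · exact absurd h (hdis z hz w hw)
  · exact absurd h.symm (hdis w hw z hz)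
  · exact hs hz hw h

/-- A Jordan curve bounds a closed disk disjoint from the unbounded complementary component. -/
theorem exists_injOn_closedBall_disjoint {γ : Circle → ℂ} (hγ : Continuous γ)
    (hγi : Function.Injective γ) {p : ℂ}
    (hp : ¬Bornology.IsBounded (connectedComponentIn (range γ)ᶜ p)) :
    ∃ f : ℂ → ℂ, ContinuousOn f (closedBall 0 1) ∧ InjOn f (closedBall 0 1) ∧
      f '' sphere 0 1 = range γ ∧
      Disjoint (f '' closedBall 0 1) (connectedComponentIn (range γ)ᶜ p) := by
  obtain ⟨f, hf, hi, hs, ho⟩ := exists_injOn_closedBall_image_sphere_eq hγ hγi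
  refine ⟨f, hf, hi, hs, ?_⟩
  have hk : IsCompact (f '' closedBall 0 1) := (isCompact_closedBall _ _).image_of_continuousOn hf
  have hu : f '' closedBall 0 1 = f '' ball 0 1 ∪ range γ := by
    rw [← ball_union_sphere, image_union, hs]
  rw [hu, disjoint_union_left]
  refine ⟨?_, disjoint_left.2 fun z hz h => connectedComponentIn_subset _ _ h hz⟩
  rw [disjoint_iff_inter_eq_empty, ← not_nonempty_iff_eq_empty]
  rintro ⟨z, hz, hzW⟩
  refine hp (hk.isBounded.subset ?_)
  refine Subset.trans ?_ (image_mono ball_subset_closedBall)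
  refine isPreconnected_connectedComponentIn.subset_of_closure_inter_subset ho ⟨z, hzW, hz⟩ ?_
  rintro w ⟨hw, hwW⟩
  have hw' : w ∈ f '' closedBall 0 1 :=
    closure_minimal (image_mono ball_subset_closedBall) hk.isClosed hw
  rw [hu] at hw'
  exact hw'.resolve_right fun h => connectedComponentIn_subset _ _ hwW h

end Schoenflies

section Annulus

open Complex Metric

/-- The embedding of the annulus in the plane, with `C₀` as the outer boundary. -/
noncomputable def annulusMap (p : Circle × Icc (0 : ℝ) 1) : ℂ := ((2 - p.2 : ℝ) : ℂ) * p.1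

theorem continuous_annulusMap : Continuous annulusMap := by
  unfold annulusMap
  fun_prop

theorem norm_annulusMap (p : Circle × Icc (0 : ℝ) 1) : ‖annulusMap p‖ = 2 - p.2 := by
  rw [annulusMap, norm_mul, norm_real, Circle.norm_coe, mul_one, Real.norm_of_nonneg]
  linarith [p.2.2.2]

theorem injective_annulusMap : Function.Injective annulusMap := by
  rintro p q h
  have h2 : (p.2 : ℝ) = q.2 := by
    have := congrArg norm h
    rw [norm_annulusMap, norm_annulusMap] at this
    linarith
  refine Prod.ext (Circle.ext ?_) (Subtype.ext h2)
  rw [annulusMap, annulusMap, h2] at h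
  refine mul_left_cancel₀ (ofReal_ne_zero.2 ?_) h
  linarith [q.2.2.2]

theorem mem_range_annulusMap {z : ℂ} (h1 : 1 ≤ ‖z‖) (h2 : ‖z‖ ≤ 2) : z ∈ range annulusMap := by
  refine ⟨⟨Circle.exp (arg z), ⟨2 - ‖z‖, by linarith, by linarith⟩⟩, ?_⟩
  rw [annulusMap]
  simp

theorem IsCircle.exists_range_eq {X : Type*} [TopologicalSpace X] {C : Set X} (hC : IsCircle C) :
    ∃ γ : Circle → X, Continuous γ ∧ Function.Injective γ ∧ range γ = C := by
  obtain ⟨h⟩ := hC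
  refine ⟨fun u => h.symm u, continuous_subtype_val.comp h.symm.continuous,
    Subtype.val_injective.comp h.symm.injective, ?_⟩
  rw [range_comp' Subtype.val, h.symm.surjective.range_eq, image_univ, Subtype.range_coe]

theorem boundsADisk_of_injOn_closedBall {X : Type*} [TopologicalSpace X] [T2Space X]
    [CompactSpace X] {ι : X → ℂ} (hι : Continuous ι) (hιi : Function.Injective ι) {C : Set X}
    {f : ℂ → ℂ} (hf : ContinuousOn f (closedBall 0 1)) (hi : InjOn f (closedBall 0 1))
    (hs : f '' sphere 0 1 = ι '' C) (hr : f '' closedBall 0 1 ⊆ range ι) : BoundsADisk C := by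
  set φ := Complex.orthonormalBasisOneI.repr.symm with hφ
  have hm : ∀ x : closedBall (0 : EuclideanSpace ℝ (Fin 2)) 1, φ x ∈ closedBall (0 : ℂ) 1 :=
    fun x => by
      have h := mem_closedBall_zero_iff.1 x.2
      rwa [mem_closedBall_zero_iff, φ.norm_map]
  have hex : ∀ x : closedBall (0 : EuclideanSpace ℝ (Fin 2)) 1, ∃ a, ι a = f (φ x) :=
    fun x => hr ⟨_, hm x, rfl⟩
  choose F hF using hex
  have hemb := (hι.isClosedEmbedding hιi).isEmbedding
  have hFc : Continuous F := by
    rw [hemb.isInducing.continuous_iff, show ι ∘ F = _ from funext hF]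
    exact hf.comp_continuous (φ.continuous.comp continuous_subtype_val) hm
  have hFi : Function.Injective F := fun x y h => by
    have := congrArg ι h
    rw [hF, hF] at this
    exact Subtype.ext (φ.injective (hi (hm x) (hm y) this))
  refine ⟨F, (hFc.isClosedEmbedding hFi).isEmbedding, hιi.image_injective ?_⟩
  rw [← hs, image_image]
  ext y
  constructor
  · rintro ⟨x, hx, rfl⟩
    exact ⟨φ x, by simpa using hx, (hF x).symm⟩
  · rintro ⟨z, hz, rfl⟩
    have hz' : φ.symm z ∈ sphere (0 : EuclideanSpace ℝ (Fin 2)) 1 := by simpa using hz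
    exact ⟨⟨φ.symm z, sphere_subset_closedBall hz'⟩, hz', by simp only [hF]; simp⟩

end Annulus

open Complex Metric in
/-- In the annulus `A = Circle × [0,1]`, let `D` be a circle with `D ≠ C₀` and
`D ∩ C₀ ≠ ∅`, and let `U` be a connected component of `A \ D` with `U ∩ C₁ = ∅`.
Then every circle contained in `U` bounds a disk in `A`. -/
theorem circle_in_component_bounds_disk
    (D : Set (Circle × Set.Icc (0:ℝ) 1)) (hD : IsCircle D)
    (hne : D ≠ {p : Circle × Set.Icc (0:ℝ) 1 | (p.2 : ℝ) = 0})
    (hmeet : D ∩ {p : Circle × Set.Icc (0:ℝ) 1 | (p.2 : ℝ) = 0} ≠ ∅)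
    (U : Set (Circle × Set.Icc (0:ℝ) 1))
    (hU : ∃ x ∈ Dᶜ, U = connectedComponentIn Dᶜ x)
    (hU1 : U ∩ {p : Circle × Set.Icc (0:ℝ) 1 | (p.2 : ℝ) = 1} = ∅) :
    ∀ C : Set (Circle × Set.Icc (0:ℝ) 1), C ⊆ U → IsCircle C → BoundsADisk C := by
  intro C hCU hC
  obtain ⟨x, hx, rfl⟩ := hU
  obtain ⟨γ, hγ, hγi, rfl⟩ := hC.exists_range_eq
  obtain ⟨d, hd, -, rfl⟩ := hD.exists_range_eq
  have hι := continuous_annulusMap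
  have hιi := injective_annulusMap
  have hΓ : range (annulusMap ∘ γ) = annulusMap '' range γ := range_comp _ _
  have hΓc : Continuous (annulusMap ∘ γ) := hι.comp hγ
  set K := range (annulusMap ∘ γ) with hK
  have hK1 : ∀ z ∈ K, 1 ≤ ‖z‖ := by
    rintro _ ⟨u, rfl⟩
    rw [Function.comp, norm_annulusMap]
    linarith [(γ u).2.2.2]
  have hK2 : ∀ z ∈ K, ‖z‖ ≤ 2 := by
    rintro _ ⟨u, rfl⟩
    rw [Function.comp, norm_annulusMap]
    linarith [(γ u).2.2.1]
  have hCD : ∀ p ∈ range γ, p ∉ range d := fun p hp => connectedComponentIn_subset _ _ (hCU hp)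
  have hKD : ∀ p ∈ range d, annulusMap p ∉ K := by
    rintro p hp ⟨u, hu⟩
    exact hCD _ ⟨u, rfl⟩ (hιi hu ▸ hp)
  have hout : {z : ℂ | 2 < ‖z‖} ⊆ Kᶜ := fun z hz h => (hK2 z h).not_gt hz
  set W := connectedComponentIn Kᶜ 3 with hW
  have hoW : {z : ℂ | 2 < ‖z‖} ⊆ W :=
    (isPreconnected_setOf_lt_norm two_pos).subset_connectedComponentIn (by norm_num) hout
  have hWb : ¬Bornology.IsBounded W := fun h => by
    obtain ⟨R, hR⟩ := (h.subset hoW).exists_norm_le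
    obtain ⟨z, hz⟩ := exists_lt_norm (max R 2)
    exact (hR z ((le_max_right _ _).trans_lt hz)).not_gt ((le_max_left _ _).trans_lt hz)
  have hDW : ∀ p ∈ range d, annulusMap p ∈ W := by
    obtain ⟨p, hp, hp0⟩ := nonempty_iff_ne_empty.2 hmeet
    rw [mem_ofPred_eq] at hp0
    have hpn : ‖annulusMap p‖ = 2 := by rw [norm_annulusMap, hp0, sub_zero]
    have hpcl : annulusMap p ∈ closure {z : ℂ | 2 < ‖z‖} := by
      have h : {z : ℂ | 2 < ‖z‖} = (closedBall 0 2)ᶜ := by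
        ext z
        simp
      rw [h, closure_compl, interior_closedBall _ two_ne_zero, mem_compl_iff, mem_ball_zero_iff]
      exact hpn.not_lt
    have hpW : annulusMap p ∈ W :=
      ((isPreconnected_setOf_lt_norm two_pos).subset_closure (subset_insert _ _)
        (insert_subset hpcl subset_closure)).subset_connectedComponentIn
        (mem_insert_of_mem _ (by norm_num)) (insert_subset (hKD p hp) hout) (mem_insert _ _)
    have hDp : IsPreconnected (annulusMap '' range d) :=
      (isPreconnected_range hd).image _ hι.continuousOn
    have := hDp.subset_connectedComponentIn (F := Kᶜ) ⟨p, hp, rfl⟩ (image_subset_iff.2 hKD)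
    rw [← connectedComponentIn_eq hpW] at this
    exact fun q hq => this ⟨q, hq, rfl⟩
  have h0 : (0 : ℂ) ∈ W := by
    by_contra h0
    obtain ⟨_, ⟨u, rfl⟩, hmin⟩ := (isCompact_range hΓc).exists_isMinOn (range_nonempty _)
      continuous_norm.continuousOn
    have hmin' : ∀ z ∈ K, ‖(annulusMap ∘ γ) u‖ ≤ ‖z‖ := fun z hz => hmin hz
    set c := γ u with hc
    have hin : ball (0 : ℂ) ‖annulusMap c‖ ⊆ Kᶜ := fun z hz hzK =>
      (hmin' z hzK).not_gt (mem_ball_zero_iff.1 hz)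
    have hbW : ∀ z ∈ ball (0 : ℂ) ‖annulusMap c‖, z ∉ W := by
      intro z hz hzW
      refine h0 ?_
      rw [hW, connectedComponentIn_eq hzW]
      refine (convex_ball _ _).isPreconnected.subset_connectedComponentIn hz hin
        (mem_ball_self ?_)
      exact one_pos.trans_le (hK1 _ ⟨u, rfl⟩)
    set S : Set (Circle × Icc (0 : ℝ) 1) := (fun s => (c.1, s)) '' Icc c.2 1 with hS
    have hSp : IsPreconnected S :=
      isPreconnected_Icc.image _ (by fun_prop)
    have hSD : S ⊆ (range d)ᶜ := by
      rintro _ ⟨s, hs, rfl⟩ hsD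
      rcases hs.1.eq_or_lt with h | h
      · rw [← h] at hsD
        exact hCD c ⟨u, rfl⟩ hsD
      · refine hbW _ ?_ (hDW _ hsD)
        rw [mem_ball_zero_iff, norm_annulusMap, norm_annulusMap]
        have : (c.2 : ℝ) < s := h
        linarith
    have hcU := hCU ⟨u, rfl⟩
    have hSU := hSp.subset_connectedComponentIn (x := c) ⟨c.2, ⟨le_rfl, c.2.2.2⟩, rfl⟩ hSD
    rw [← connectedComponentIn_eq hcU] at hSU
    exact hU1.subset ⟨hSU ⟨1, ⟨c.2.2.2, le_rfl⟩, rfl⟩, by simp⟩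
  have h1W : ball (0 : ℂ) 1 ⊆ W := by
    have := (convex_ball (0 : ℂ) 1).isPreconnected.subset_connectedComponentIn (F := Kᶜ)
      (mem_ball_self one_pos) fun z hz h => (hK1 z h).not_gt (mem_ball_zero_iff.1 hz)
    rwa [← connectedComponentIn_eq h0] at this
  obtain ⟨f, hf, hfi, hfs, hfW⟩ := exists_injOn_closedBall_disjoint hΓc (hιi.comp hγi) hWb
  refine boundsADisk_of_injOn_closedBall hι hιi hf hfi (hfs.trans hΓ) fun z hz => ?_
  have hzW := disjoint_left.1 hfW hz
  refine mem_range_annulusMap (not_lt.1 fun h => hzW (h1W (mem_ball_zero_iff.2 h)))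
    (not_lt.1 fun h => hzW (hoW h))
end

section
/- If 𝒞 is a circle decomposition of the annulus A, then both boundary circles C₀ and C₁ belong to 𝒞. -/
open Topology Set

theorem IsPreconnected.eqOn_const_of_exp_eq {X : Type*} [TopologicalSpace X] {s : Set X}
    (hs : IsPreconnected s) {f : X → ℂ} (hf : ContinuousOn f s) {c : ℂ}
    (h : ∀ x ∈ s, Complex.exp (f x) = c) {x y : X} (hx : x ∈ s) (hy : y ∈ s) : f x = f y := by
  have : PreconnectedSpace s := isPreconnected_iff_preconnectedSpace.mp hs
  exact Complex.isCoveringMap_exp.const_of_comp (g := fun x : s ↦ f x)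
    (continuousOn_iff_continuous_domRestrict.mp hf)
    (fun u v ↦ Subtype.ext ((h u u.2).trans (h v v.2).symm)) ⟨x, hx⟩ ⟨y, hy⟩

/-- The quotient `(z - b) / (z - a)` has a continuous logarithm off any path from `a` to `b`. -/
theorem Path.exists_log_compl_range {a b : ℂ} (γ : Path a b) :
    ∃ L : ℂ → ℂ, ContinuousOn L (range γ)ᶜ ∧
      ∀ z ∉ range γ, Complex.exp (L z) = (z - b) / (z - a) := by
  have hne (t : unitInterval) (z : ↥(range γ)ᶜ) : (z : ℂ) - γ t ≠ 0 := fun h ↦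
    z.2 ⟨t, (sub_eq_zero.mp h).symm⟩
  have hna (z : ↥(range γ)ᶜ) : (z : ℂ) - a ≠ 0 := by simpa using hne 0 z
  let H : C(unitInterval × ↥(range γ)ᶜ, {z : ℂ // z ≠ 0}) :=
    ⟨fun p ↦ ⟨(p.2 - γ p.1) / (p.2 - a), div_ne_zero (hne _ _) (hna _)⟩, by
      refine Continuous.subtype_mk (Continuous.div ?_ ?_ fun p ↦ hna _) _ <;> fun_prop⟩
  let F := Complex.isCoveringMap_exp.liftHomotopy H (.const _ 0) fun z ↦ by
    ext; simp [H, div_self (hna z)]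
  have hF : ∀ p, Complex.exp (F p) = (p.2 - γ p.1) / (p.2 - a) := fun p ↦
    congrArg Subtype.val (congrFun (Complex.isCoveringMap_exp.liftHomotopy_lifts H _ _) p)
  classical
  refine ⟨fun z ↦ if hz : z ∈ (range γ)ᶜ then F (1, ⟨z, hz⟩) else 0, ?_, fun z hz ↦ ?_⟩
  · rw [continuousOn_iff_continuous_domRestrict]
    have : Continuous fun z : ↥(range γ)ᶜ ↦ F (1, z) := by fun_prop
    convert this using 2 with z
    simp only [domRestrict_apply]
    rw [dif_pos z.2]
  · simp only
    rw [dif_pos (mem_compl hz), hF]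
    simp

theorem not_exists_log_div_sub {a b : ℂ} (hab : a ≠ b) {L : ℂ → ℂ}
    (hL : ContinuousOn L {a, b}ᶜ)
    (h : ∀ z ∈ ({a, b}ᶜ : Set ℂ), Complex.exp (L z) = (z - b) / (z - a)) : False := by
  have hab' : a - b ≠ 0 := sub_ne_zero.mpr hab
  let u : ℝ → ℂ := fun t ↦ Complex.exp (t * Complex.I) / 2
  have hu : Continuous u := by fun_prop
  have hun (t : ℝ) : ‖u t‖ < 1 := by
    simp only [u, norm_div, Complex.norm_exp_ofReal_mul_I]; norm_num
  have hu0 (t : ℝ) : u t ≠ 0 := by simp [u]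
  have hslit (t : ℝ) : 1 + u t ∈ Complex.slitPlane := Complex.mem_slitPlane_of_norm_lt_one (hun t)
  have hmem (t : ℝ) : a + (a - b) * u t ∈ ({a, b}ᶜ : Set ℂ) := by
    simp only [mem_compl_iff, mem_insert_iff, mem_singleton_iff, not_or]
    refine ⟨by simp [hab', hu0], fun e ↦ ?_⟩
    refine Complex.slitPlane_ne_zero (hslit t) (mul_left_cancel₀ hab' ?_)
    linear_combination e
  let G : ℝ → ℂ := fun t ↦ L (a + (a - b) * u t) + t * Complex.I - Complex.log (1 + u t)
  have hG : Continuous G := by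
    refine ((hL.comp_continuous (by fun_prop) hmem).add (by fun_prop)).sub ?_
    exact Continuous.clog (by fun_prop) hslit
  have hexp (t : ℝ) : Complex.exp (G t) = 2 := by
    simp only [G]
    rw [Complex.exp_sub, Complex.exp_add, h _ (hmem t),
      Complex.exp_log (Complex.slitPlane_ne_zero (hslit t))]
    have e : Complex.exp (t * Complex.I) = 2 * u t := by simp only [u]; ring
    have := Complex.slitPlane_ne_zero (hslit t)
    have := hu0 t
    rw [e, add_sub_cancel_left]
    field_simp
    ring
  have key := isPreconnected_univ.eqOn_const_of_exp_eq (f := G) hG.continuousOn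
    (fun t _ ↦ hexp t) (mem_univ 0) (mem_univ (2 * Real.pi))
  have hper : u (2 * Real.pi) = u 0 := by
    simp [u, Complex.exp_two_pi_mul_I]
  simp [G, hper, Real.pi_ne_zero] at key

theorem not_isPreconnected_compl_range_union {a b : ℂ} (hab : a ≠ b) (γ₁ γ₂ : Path a b)
    (h : range γ₁ ∩ range γ₂ ⊆ {a, b}) : ¬ IsPreconnected (range γ₁ ∪ range γ₂)ᶜ := by
  intro hpre
  obtain ⟨L₁, hc₁, hL₁⟩ := γ₁.exists_log_compl_range
  obtain ⟨L₂, hc₂, hL₂⟩ := γ₂.exists_log_compl_range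
  have ho₁ : IsOpen (range γ₁)ᶜ := (isCompact_range γ₁.continuous).isClosed.isOpen_compl
  have ho₂ : IsOpen (range γ₂)ᶜ := (isCompact_range γ₂.continuous).isClosed.isOpen_compl
  rw [compl_union] at hpre
  obtain ⟨c, hc, hexp⟩ : ∃ c : ℂ, (∀ z ∈ (range γ₁)ᶜ ∩ (range γ₂)ᶜ, L₁ z - L₂ z = c) ∧
      Complex.exp c = 1 := by
    have hone : ∀ z ∈ (range γ₁)ᶜ ∩ (range γ₂)ᶜ, Complex.exp (L₁ z - L₂ z) = 1 := fun z hz ↦ by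
      rw [Complex.exp_sub, hL₁ z hz.1, hL₂ z hz.2, div_self]
      rw [← hL₁ z hz.1]
      exact Complex.exp_ne_zero _
    rcases ((range γ₁)ᶜ ∩ (range γ₂)ᶜ).eq_empty_or_nonempty with he | ⟨w, hw⟩
    · exact ⟨0, by simp [he], Complex.exp_zero⟩
    · exact ⟨_, fun z hz ↦ hpre.eqOn_const_of_exp_eq ((hc₁.mono inter_subset_left).sub
        (hc₂.mono inter_subset_right)) hone hz hw, hone w hw⟩
  classical
  let L : ℂ → ℂ := (range γ₁)ᶜ.piecewise L₁ fun z ↦ L₂ z + c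
  have e₁ : EqOn L L₁ (range γ₁)ᶜ := piecewise_eqOn ..
  have e₂ : EqOn L (fun z ↦ L₂ z + c) (range γ₂)ᶜ := fun z hz ↦ by
    by_cases hz₁ : z ∈ (range γ₁)ᶜ
    · rw [e₁ hz₁, ← hc z ⟨hz₁, hz⟩]; ring
    · exact piecewise_eq_of_notMem _ _ _ hz₁
  have hcover : ({a, b}ᶜ : Set ℂ) ⊆ (range γ₁)ᶜ ∪ (range γ₂)ᶜ := by
    rw [← compl_inter]; exact compl_subset_compl.mpr h
  refine not_exists_log_div_sub hab (L := L) (ContinuousOn.mono ?_ hcover) fun z hz ↦ ?_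
  · exact (hc₁.congr e₁).union_of_isOpen ((hc₂.add continuousOn_const).congr e₂) ho₁ ho₂
  · rcases hcover hz with hz | hz
    · rw [e₁ hz, hL₁ z hz]
    · rw [e₂ hz, Complex.exp_add, hexp, mul_one, hL₂ z hz]

/-- The Jordan separation theorem. -/
theorem not_isPreconnected_compl_range_circle_s6 {φ : Circle → ℂ} (hφ : Continuous φ)
    (hinj : Function.Injective φ) : ¬ IsPreconnected (range φ)ᶜ := by
  have hpi : Circle.exp (-Real.pi) = Circle.exp Real.pi := by
    ext; simp [Circle.coe_exp]
  let γ₁ : Path (φ 1) (φ (Circle.exp Real.pi)) :=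
    ⟨⟨fun t ↦ φ (Circle.exp (Real.pi * t)), by fun_prop⟩, by simp, by simp⟩
  let γ₂ : Path (φ 1) (φ (Circle.exp Real.pi)) :=
    ⟨⟨fun t ↦ φ (Circle.exp (-(Real.pi * t))), by fun_prop⟩, by simp, by simp [hpi]⟩
  have hexp : ((Circle.exp Real.pi : Circle) : ℂ) = -1 := by simp [Circle.coe_exp]
  have him (t : unitInterval) : 0 ≤ ((Circle.exp (Real.pi * t) : Circle) : ℂ).im := by
    rw [Circle.coe_exp, Complex.exp_ofReal_mul_I_im]
    exact Real.sin_nonneg_of_nonneg_of_le_pi (by have := t.2.1; positivity)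
      (mul_le_of_le_one_right Real.pi_pos.le t.2.2)
  have hunion : range γ₁ ∪ range γ₂ = range φ := by
    refine subset_antisymm (union_subset ?_ ?_) ?_
    · rintro _ ⟨t, rfl⟩; exact mem_range_self _
    · rintro _ ⟨t, rfl⟩; exact mem_range_self _
    · rintro _ ⟨z, rfl⟩
      have hz := Circle.exp_arg z
      have h₁ := Complex.neg_pi_lt_arg z
      have h₂ := Complex.arg_le_pi z
      rcases le_total 0 (Complex.arg z) with h | h
      · refine .inl ⟨⟨Complex.arg z / Real.pi, by positivity, ?_⟩, ?_⟩
        · exact div_le_one_of_le₀ h₂ Real.pi_pos.le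
        · change φ (Circle.exp (Real.pi * (Complex.arg z / Real.pi))) = φ z
          rw [mul_div_cancel₀ _ Real.pi_ne_zero, hz]
      · refine .inr ⟨⟨-Complex.arg z / Real.pi, ?_, ?_⟩, ?_⟩
        · exact div_nonneg (by linarith) Real.pi_pos.le
        · exact div_le_one_of_le₀ (by linarith) Real.pi_pos.le
        · change φ (Circle.exp (-(Real.pi * (-Complex.arg z / Real.pi)))) = φ z
          rw [mul_div_cancel₀ _ Real.pi_ne_zero, neg_neg, hz]
  rw [← hunion]
  refine not_isPreconnected_compl_range_union (fun h ↦ ?_) γ₁ γ₂ ?_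
  · have := congrArg (Subtype.val) (hinj h)
    rw [hexp] at this
    norm_num at this
  · rintro _ ⟨⟨t, rfl⟩, s, hs⟩
    have hst : Circle.exp (-(Real.pi * s)) = Circle.exp (Real.pi * t) := hinj hs
    have h0 : ((Circle.exp (Real.pi * t) : Circle) : ℂ).im = 0 := by
      refine le_antisymm ?_ (him t)
      rw [← hst, Circle.exp_neg, Circle.coe_inv_eq_conj, Complex.conj_im]
      exact neg_nonpos.mpr (him s)
    have h1 := Circle.normSq_coe (Circle.exp (Real.pi * t))
    rw [Complex.normSq_apply, h0] at h1
    change φ (Circle.exp (Real.pi * t)) ∈ _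
    rcases mul_self_eq_one_iff.mp (by linarith : _ * _ = (1 : ℝ)) with h | h
    · left; congr 1; ext; exact Complex.ext (by simpa using h) (by simpa using h0)
    · right; congr 1; ext; rw [hexp]; exact Complex.ext (by simpa using h) (by simpa using h0)

theorem IsClosed.connectedComponentIn_compl_of_mem_closure {K : Set ℂ} (hK : IsClosed K) {x z : ℂ}
    (hz : z ∈ closure (connectedComponentIn Kᶜ x)) (hzK : z ∉ K) :
    z ∈ connectedComponentIn Kᶜ x := by
  obtain ⟨w, hwz, hwx⟩ := mem_closure_iff.mp hz _ hK.isOpen_compl.connectedComponentIn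
    (mem_connectedComponentIn hzK)
  rw [connectedComponentIn_eq hwx, ← connectedComponentIn_eq hwz]
  exact mem_connectedComponentIn hzK

/-- A nonempty component of the complement of a nonempty closed set accumulates on that set. -/
theorem IsClosed.exists_mem_closure_connectedComponentIn_compl {K : Set ℂ} (hK : IsClosed K)
    (hne : K.Nonempty) {x : ℂ} (hx : x ∉ K) :
    ∃ s ∈ K, s ∈ closure (connectedComponentIn Kᶜ x) := by
  have hopen : IsOpen (connectedComponentIn Kᶜ x) := hK.isOpen_compl.connectedComponentIn
  obtain ⟨s, hs⟩ : (frontier (connectedComponentIn Kᶜ x)).Nonempty := by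
    refine nonempty_frontier_iff.mpr ⟨⟨x, mem_connectedComponentIn hx⟩, fun h ↦ ?_⟩
    obtain ⟨k, hk⟩ := hne
    exact connectedComponentIn_subset Kᶜ x (h ▸ mem_univ k) hk
  rw [hopen.frontier_eq] at hs
  refine ⟨s, by_contra fun h ↦ hs.2 ?_, hs.1⟩
  exact hK.connectedComponentIn_compl_of_mem_closure hs.1 h

/-- The component of the complement of `K` containing `3`, which is the unbounded one if
`K` is contained in the disc of radius `2`. -/
def outerRegion (K : Set ℂ) : Set ℂ := connectedComponentIn Kᶜ 3

theorem isPreconnected_norm_gt (r : ℝ) (hr : 0 ≤ r) : IsPreconnected {z : ℂ | r < ‖z‖} := by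
  have h : {z : ℂ | r < ‖z‖} =
      (fun p : ℝ × ℂ ↦ p.1 • p.2) '' (Ioi r ×ˢ Metric.sphere (0 : ℂ) 1) := by
    ext z
    constructor
    · intro hz
      have hz0 : ‖z‖ ≠ 0 := (hr.trans_lt hz).ne'
      refine ⟨(‖z‖, ‖z‖⁻¹ • z), ⟨hz, ?_⟩, ?_⟩
      · simp [hz0]
      · simp [hz0]
    · rintro ⟨⟨s, w⟩, ⟨hs, hw⟩, rfl⟩
      have hs : r < s := hs
      have hw : ‖w‖ = 1 := by simpa using hw
      simpa [norm_smul, hw, abs_of_pos (hr.trans_lt hs)] using hs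
  rw [h]
  refine (isPreconnected_Ioi.prod (isPreconnected_sphere ?_ _ _)).image _ (by fun_prop)
  rw [Complex.rank_real_complex]
  exact Nat.one_lt_ofNat

section OuterRegion

variable {K T : Set ℂ}

theorem norm_gt_subset_outerRegion (hK : K ⊆ Metric.closedBall 0 2) :
    {z : ℂ | 2 < ‖z‖} ⊆ outerRegion K := by
  refine (isPreconnected_norm_gt 2 zero_le_two).subset_connectedComponentIn (by norm_num) ?_
  intro z hz hzK
  have := hK hzK
  simp only [mem_closedBall_zero_iff] at this
  exact absurd hz (not_lt.mpr this)

theorem three_mem_outerRegion (hK : K ⊆ Metric.closedBall 0 2) : (3 : ℂ) ∈ outerRegion K :=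
  norm_gt_subset_outerRegion hK (by norm_num)

theorem isOpen_outerRegion (hK : IsClosed K) : IsOpen (outerRegion K) :=
  hK.isOpen_compl.connectedComponentIn

theorem disjoint_outerRegion : Disjoint K (outerRegion K) :=
  disjoint_left.mpr fun _ hz h ↦ connectedComponentIn_subset _ _ h hz

theorem IsPreconnected.subset_outerRegion (hT : IsPreconnected T) (hKT : Disjoint T K) {z : ℂ}
    (hzT : z ∈ T) (hz : z ∈ outerRegion K) : T ⊆ outerRegion K := by
  rw [outerRegion, connectedComponentIn_eq hz]
  exact hT.subset_connectedComponentIn hzT hKT.subset_compl_right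

theorem IsPreconnected.disjoint_outerRegion (hT : IsPreconnected T) (hKT : Disjoint T K) {z : ℂ}
    (hzT : z ∈ T) (hz : z ∉ outerRegion K) : Disjoint T (outerRegion K) :=
  disjoint_left.mpr fun _ hw h ↦ hz (hT.subset_outerRegion hKT hw h hzT)

theorem outerRegion_subset_outerRegion (hK : K ⊆ Metric.closedBall 0 2)
    (h : Disjoint T (outerRegion K)) : outerRegion K ⊆ outerRegion T :=
  isPreconnected_connectedComponentIn.subset_connectedComponentIn (three_mem_outerRegion hK)
    h.subset_compl_left

theorem exists_mem_outerRegion_of_disjoint (hK : IsClosed K) (hK2 : K ⊆ Metric.closedBall 0 2)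
    (hne : K.Nonempty) (hT : IsClosed T) (hKT : Disjoint T K)
    (h : Disjoint T (outerRegion K)) : ∃ z ∈ K, z ∈ outerRegion T := by
  have h3 : (3 : ℂ) ∉ K := disjoint_right.mp disjoint_outerRegion (three_mem_outerRegion hK2)
  obtain ⟨s, hs, hcl⟩ := hK.exists_mem_closure_connectedComponentIn_compl hne h3
  exact ⟨s, hs, hT.connectedComponentIn_compl_of_mem_closure
    (closure_mono (outerRegion_subset_outerRegion hK2 h) hcl) (disjoint_right.mp hKT hs)⟩

/-- A point separated from infinity by two closed sets cannot have each of them in the outer region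
of the other. -/
theorem mem_outerRegion_of_subset_of_subset (hK : IsClosed K) (hne : K.Nonempty)
    (hT : IsClosed T) (hTK : T ⊆ outerRegion K) (hKT : K ⊆ outerRegion T) {z : ℂ}
    (hzK : z ∉ K) (hz : z ∉ outerRegion K) : z ∈ outerRegion T := by
  obtain ⟨s, hs, hcl⟩ := hK.exists_mem_closure_connectedComponentIn_compl hne hzK
  obtain ⟨w, hwT, hw⟩ := mem_closure_iff.mp hcl _ (isOpen_outerRegion hT) (hKT hs)
  refine isPreconnected_connectedComponentIn.subset_outerRegion ?_ hw hwT
    (mem_connectedComponentIn hzK)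
  refine disjoint_left.mpr fun v hv hvT ↦ hz ?_
  have h := hTK hvT
  rw [outerRegion, connectedComponentIn_eq h, ← connectedComponentIn_eq hv]
  exact mem_connectedComponentIn hzK

theorem mem_outerRegion_of_norm_eq_two (hK : IsClosed K) (hK2 : K ⊆ Metric.closedBall 0 2) {z : ℂ}
    (hz : ‖z‖ = 2) (hzK : z ∉ K) : z ∈ outerRegion K := by
  refine hK.connectedComponentIn_compl_of_mem_closure
    (closure_mono (norm_gt_subset_outerRegion hK2) ?_) hzK
  have hlim : Filter.Tendsto (fun t : ℝ ↦ (t : ℂ) * z) (𝓝[>] 1) (𝓝 z) := by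
    have : Continuous fun t : ℝ ↦ (t : ℂ) * z := by fun_prop
    simpa using (this.tendsto 1).mono_left nhdsWithin_le_nhds
  refine mem_closure_of_tendsto hlim (eventually_nhdsWithin_of_forall fun t ht ↦ ?_)
  have ht : (1 : ℝ) < t := ht
  simp only [mem_ofPred_eq, norm_mul, Complex.norm_real, Real.norm_eq_abs, hz,
    abs_of_pos (one_pos.trans ht)]
  linarith

end OuterRegion

instance : ConnectedSpace Circle :=
  have := Circle.exp.continuous
  Function.Surjective.connectedSpace (f := Circle.exp) (fun z ↦ ⟨_, Circle.exp_arg z⟩) this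

theorem Circle.not_injective_of_continuous_real {f : Circle → ℝ} (hf : Continuous f) :
    ¬ Function.Injective f := by
  intro hinj
  have hodd (z : Circle) : f (z * Circle.exp Real.pi * Circle.exp Real.pi) = f z := by
    rw [mul_assoc, ← Circle.exp_add, ← two_mul, Circle.exp_two_pi, mul_one]
  obtain ⟨z, hz⟩ : ∃ z, f z - f (z * Circle.exp Real.pi) = 0 := by
    have hc : Continuous fun z ↦ f z - f (z * Circle.exp Real.pi) := by fun_prop
    rcases le_total (f 1) (f (1 * Circle.exp Real.pi)) with h | h
    · refine mem_range_of_exists_le_of_exists_ge hc ⟨1, by linarith⟩ ⟨1 * Circle.exp Real.pi, ?_⟩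
      rw [hodd]; linarith
    · refine mem_range_of_exists_le_of_exists_ge hc ⟨1 * Circle.exp Real.pi, ?_⟩ ⟨1, by linarith⟩
      rw [hodd]; linarith
  have hpi : Circle.exp Real.pi = 1 := left_eq_mul.mp (hinj (sub_eq_zero.mp hz))
  have h := congrArg ((↑) : Circle → ℂ) hpi
  simp only [Circle.coe_exp, Complex.exp_pi_mul_I, Circle.coe_one] at h
  norm_num at h

theorem Circle.surjective_of_continuous_of_injective {f : Circle → Circle} (hf : Continuous f)
    (hinj : Function.Injective f) : Function.Surjective f := by
  intro w
  by_contra! hw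
  have hslit (z : Circle) : (((Circle.exp Real.pi) * w⁻¹ * f z : Circle) : ℂ) ∈
      Complex.slitPlane := by
    rw [Complex.mem_slitPlane_iff_arg]
    refine ⟨fun h ↦ hw z ?_, Circle.coe_ne_zero _⟩
    have := Circle.exp_arg (Circle.exp Real.pi * w⁻¹ * f z)
    rw [h, mul_assoc, left_eq_mul, inv_mul_eq_one] at this
    exact this.symm
  refine Circle.not_injective_of_continuous_real
    (f := fun z ↦ Complex.arg (Circle.exp Real.pi * w⁻¹ * f z : Circle)) ?_ ?_
  · refine continuous_iff_continuousAt.mpr fun z ↦ ?_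
    have hc : Continuous fun z ↦ ((Circle.exp Real.pi * w⁻¹ * f z : Circle) : ℂ) := by fun_prop
    exact ContinuousAt.comp' (Complex.continuousAt_arg (hslit z)) hc.continuousAt
  · exact Circle.injective_arg.comp ((mul_right_injective _).comp hinj)

namespace IsCircle

variable {X : Type*} [TopologicalSpace X] {C D : Set X}

theorem exists_range_eq_s6 (h : IsCircle C) :
    ∃ φ : Circle → X, Continuous φ ∧ Function.Injective φ ∧ range φ = C := by
  obtain ⟨e⟩ := h
  refine ⟨fun z ↦ e.symm z, by fun_prop, Subtype.val_injective.comp e.symm.injective, ?_⟩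
  rw [← Function.comp_def, e.symm.surjective.range_comp, Subtype.range_coe]

theorem isCompact (h : IsCircle C) : IsCompact C := by
  obtain ⟨φ, hφ, -, rfl⟩ := h.exists_range_eq_s6
  exact isCompact_range hφ

theorem isConnected (h : IsCircle C) : IsConnected C := by
  obtain ⟨φ, hφ, -, rfl⟩ := h.exists_range_eq_s6
  exact isConnected_range hφ

theorem eq_of_subset (hC : IsCircle C) (hD : IsCircle D) (h : C ⊆ D) : C = D := by
  obtain ⟨e⟩ := hC
  obtain ⟨e'⟩ := hD
  refine h.antisymm fun x hx ↦ ?_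
  obtain ⟨z, hz⟩ := Circle.surjective_of_continuous_of_injective
    (f := fun z ↦ e' (inclusion h (e.symm z)))
    (e'.continuous.comp ((continuous_inclusion h).comp e.symm.continuous))
    (e'.injective.comp ((inclusion_injective h).comp e.symm.injective)) (e' ⟨x, hx⟩)
  have := congrArg Subtype.val (e'.injective hz)
  exact mem_of_eq_of_mem this.symm (e.symm z).2

theorem image {Y : Type*} [TopologicalSpace Y] (h : IsCircle C) {f : X → Y}
    (hf : IsEmbedding f) : IsCircle (f '' C) :=
  h.map (hf.homeomorphImage C).symm.trans

theorem exists_notMem_outerRegion {K : Set ℂ} (h : IsCircle K) :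
    ∃ z, z ∉ K ∧ z ∉ outerRegion K := by
  by_contra! hK
  obtain ⟨φ, hφ, hinj, rfl⟩ := h.exists_range_eq_s6
  refine not_isPreconnected_compl_range_circle_s6 hφ hinj ?_
  have : outerRegion (range φ) = (range φ)ᶜ :=
    (connectedComponentIn_subset _ _).antisymm fun z hz ↦ hK z hz
  exact this ▸ isPreconnected_connectedComponentIn

end IsCircle

theorem isCircle_sphere : IsCircle (Metric.sphere (0 : ℂ) 2) := by
  have hcont : Continuous fun z : Circle ↦ 2 * (z : ℂ) := by fun_prop
  have hemb : IsEmbedding fun z : Circle ↦ 2 * (z : ℂ) :=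
    (hcont.isClosedEmbedding
      ((mul_right_injective₀ two_ne_zero).comp Circle.coe_injective)).isEmbedding
  have hrange : range (fun z : Circle ↦ 2 * (z : ℂ)) = Metric.sphere 0 2 := by
    ext z
    constructor
    · rintro ⟨w, rfl⟩
      simp [Circle.norm_coe]
    · intro hz
      refine ⟨Circle.exp z.arg, ?_⟩
      have := Complex.norm_mul_exp_arg_mul_I z
      rw [mem_sphere_zero_iff_norm.mp hz] at this
      simpa [Circle.coe_exp] using this
  exact hrange ▸ ⟨hemb.toHomeomorph.symm⟩

section PlanarAnnulus

variable {𝒞 : Set (Set ℂ)}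

/-- A circle of a decomposition of the planar annulus separates `0` from infinity. -/
theorem zero_notMem_outerRegion_of_mem (hcirc : ∀ C ∈ 𝒞, IsCircle C)
    (hdisj : ∀ C ∈ 𝒞, ∀ D ∈ 𝒞, C ≠ D → Disjoint C D)
    (hunion : ⋃₀ 𝒞 = {z : ℂ | 1 ≤ ‖z‖ ∧ ‖z‖ ≤ 2}) {S : Set ℂ} (hS : S ∈ 𝒞) :
    (0 : ℂ) ∉ outerRegion S := by
  intro h0
  have hsub {C : Set ℂ} (hC : C ∈ 𝒞) : C ⊆ {z : ℂ | 1 ≤ ‖z‖ ∧ ‖z‖ ≤ 2} :=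
    hunion ▸ subset_sUnion_of_mem hC
  have hball {C : Set ℂ} (hC : C ∈ 𝒞) : C ⊆ Metric.closedBall 0 2 := fun z hz ↦
    mem_closedBall_zero_iff.mpr (hsub hC hz).2
  have hclosed {C : Set ℂ} (hC : C ∈ 𝒞) : IsClosed C := (hcirc C hC).isCompact.isClosed
  have hfill {C : Set ℂ} (hC : C ∈ 𝒞) (h0 : (0 : ℂ) ∈ outerRegion C) :
      (outerRegion C)ᶜ ⊆ {z : ℂ | 1 ≤ ‖z‖ ∧ ‖z‖ ≤ 2} := by
    have hb : Metric.ball (0 : ℂ) 1 ⊆ outerRegion C := by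
      refine (Metric.isPreconnected_ball (x := (0 : ℂ)) (r := 1)).subset_outerRegion ?_
        (Metric.mem_ball_self one_pos) h0
      refine disjoint_left.mpr fun z hz hzC ↦ ?_
      exact (mem_ball_zero_iff.mp hz).not_ge (hsub hC hzC).1
    intro z hz
    refine ⟨not_lt.mp fun h ↦ hz (hb (mem_ball_zero_iff.mpr h)), not_lt.mp fun h ↦ hz ?_⟩
    exact norm_gt_subset_outerRegion (hball hC) h
  have hinside {C D : Set ℂ} (hC : C ∈ 𝒞) (hD : D ∈ 𝒞) {z : ℂ} (hzD : z ∈ D)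
      (hz : z ∉ outerRegion C) : Disjoint D (outerRegion C) := by
    rcases eq_or_ne D C with rfl | hne
    · exact disjoint_outerRegion
    · exact (hcirc D hD).isConnected.isPreconnected.disjoint_outerRegion
        (hdisj D hD C hC hne) hzD hz
  let F : Set (Set ℂ) := (fun C ↦ (outerRegion C)ᶜ) '' {C | C ∈ 𝒞 ∧ (0 : ℂ) ∈ outerRegion C}
  obtain ⟨_, ⟨C, ⟨hC, hC0⟩, rfl⟩, hmin⟩ : ∃ m, Minimal (· ∈ F) m := by
    refine zorn_superset F fun c hcF hchain ↦ ?_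
    rcases c.eq_empty_or_nonempty with rfl | hne
    · exact ⟨_, mem_image_of_mem _ ⟨hS, h0⟩, by simp⟩
    have hcl : ∀ s ∈ c, IsClosed s := fun s hs ↦ by
      obtain ⟨C, ⟨hC, -⟩, rfl⟩ := hcF hs
      exact (isOpen_outerRegion (hclosed hC)).isClosed_compl
    have : Nonempty c := hne.to_subtype
    obtain ⟨x, hx⟩ : (⋂₀ c).Nonempty := by
      refine IsCompact.nonempty_sInter_of_directed_nonempty_isCompact_isClosed ?_ ?_ ?_ hcl
      · exact IsChain.directedOn hchain.symm
      · intro s hs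
        obtain ⟨C, ⟨hC, -⟩, rfl⟩ := hcF hs
        obtain ⟨z, -, hz⟩ := (hcirc C hC).exists_notMem_outerRegion
        exact ⟨z, hz⟩
      · intro s hs
        refine (isCompact_closedBall (0 : ℂ) 2).of_isClosed_subset (hcl s hs) ?_
        obtain ⟨C, ⟨hC, hC0⟩, rfl⟩ := hcF hs
        exact fun z hz ↦ mem_closedBall_zero_iff.mpr (hfill hC hC0 hz).2
    obtain ⟨s₀, hs₀⟩ := hne
    obtain ⟨C₀, ⟨hC₀, hC₀0⟩, rfl⟩ := hcF hs₀
    obtain ⟨D, hD, hxD⟩ : x ∈ ⋃₀ 𝒞 := hunion ▸ hfill hC₀ hC₀0 (hx _ hs₀)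
    have hle {C : Set ℂ} (hC : C ∈ 𝒞) (hCc : (outerRegion C)ᶜ ∈ c) :
        outerRegion C ⊆ outerRegion D :=
      outerRegion_subset_outerRegion (hball hC) (hinside hC hD hxD (hx _ hCc))
    refine ⟨_, mem_image_of_mem _ ⟨hD, hle hC₀ hs₀ hC₀0⟩, fun s hs ↦ ?_⟩
    obtain ⟨C, ⟨hC, -⟩, rfl⟩ := hcF hs
    exact compl_subset_compl.mpr (hle hC hs)
  obtain ⟨y, hyC, hy⟩ := (hcirc C hC).exists_notMem_outerRegion
  obtain ⟨D, hD, hyD⟩ : y ∈ ⋃₀ 𝒞 := hunion ▸ hfill hC hC0 hy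
  have hDC : Disjoint D C := hdisj D hD C hC fun h ↦ hyC (h ▸ hyD)
  have hD' := hinside hC hD hyD hy
  have hle := outerRegion_subset_outerRegion (hball hC) hD'
  obtain ⟨s, hsC, hsD⟩ := exists_mem_outerRegion_of_disjoint (hclosed hC) (hball hC)
    (hcirc C hC).isConnected.nonempty (hclosed hD) hDC hD'
  have hsub' := hmin (mem_image_of_mem _ ⟨hD, hle hC0⟩) (compl_subset_compl.mpr hle)
  exact hsub' (disjoint_left.mp disjoint_outerRegion hsC) hsD

theorem sphere_mem_of_planar_annulus (hcirc : ∀ C ∈ 𝒞, IsCircle C)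
    (hdisj : ∀ C ∈ 𝒞, ∀ D ∈ 𝒞, C ≠ D → Disjoint C D)
    (hunion : ⋃₀ 𝒞 = {z : ℂ | 1 ≤ ‖z‖ ∧ ‖z‖ ≤ 2}) : Metric.sphere (0 : ℂ) 2 ∈ 𝒞 := by
  have hcover {z : ℂ} (hz : ‖z‖ = 2) : z ∈ ⋃₀ 𝒞 := by
    rw [hunion]; exact ⟨by rw [hz]; norm_num, hz.le⟩
  have hball {C : Set ℂ} (hC : C ∈ 𝒞) : C ⊆ Metric.closedBall 0 2 := fun z hz ↦ by
    have : z ∈ ⋃₀ 𝒞 := ⟨C, hC, hz⟩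
    rw [hunion] at this
    exact mem_closedBall_zero_iff.mpr this.2
  have hzero := fun C (hC : C ∈ 𝒞) ↦ zero_notMem_outerRegion_of_mem hcirc hdisj hunion hC
  have hzero' : ∀ C ∈ 𝒞, (0 : ℂ) ∉ C := fun C hC h ↦ by
    have : (0 : ℂ) ∈ ⋃₀ 𝒞 := ⟨C, hC, h⟩
    rw [hunion] at this
    have := this.1
    norm_num at this
  have houter {C D : Set ℂ} (hC : C ∈ 𝒞) (hD : D ∈ 𝒞) (hne : C ≠ D) {z : ℂ} (hz : ‖z‖ = 2)
      (hzC : z ∈ C) : C ⊆ outerRegion D := by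
    have hCD := hdisj C hC D hD hne
    exact (hcirc C hC).isConnected.isPreconnected.subset_outerRegion hCD hzC
      (mem_outerRegion_of_norm_eq_two (hcirc D hD).isCompact.isClosed (hball hD) hz
        (disjoint_left.mp hCD hzC))
  have h2 : ‖(2 : ℂ)‖ = 2 := by norm_num
  obtain ⟨S, hS, h2S⟩ := hcover h2
  suffices Metric.sphere (0 : ℂ) 2 ⊆ S by
    rwa [isCircle_sphere.eq_of_subset (hcirc S hS) this]
  intro q hq
  have hq : ‖q‖ = 2 := by simpa using hq
  obtain ⟨T, hT, hqT⟩ := hcover hq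
  rcases eq_or_ne S T with rfl | hne
  · exact hqT
  · exact absurd (mem_outerRegion_of_subset_of_subset (hcirc S hS).isCompact.isClosed ⟨2, h2S⟩
      (hcirc T hT).isCompact.isClosed (houter hT hS hne.symm hq hqT) (houter hS hT hne h2 h2S)
      (hzero' S hS) (hzero S hS)) (hzero T hT)

end PlanarAnnulus

theorem preimage_sphere_mem_circleDecomposition {X : Type*} [TopologicalSpace X] {𝒞 : Set (Set X)}
    (h𝒞 : IsCircleDecomposition 𝒞) {e : X → ℂ} (he : IsEmbedding e)
    (hrange : range e = {z : ℂ | 1 ≤ ‖z‖ ∧ ‖z‖ ≤ 2}) : e ⁻¹' Metric.sphere 0 2 ∈ 𝒞 := by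
  obtain ⟨hcirc, hdisj, hunion⟩ := h𝒞
  obtain ⟨C, hC, hCs⟩ : Metric.sphere (0 : ℂ) 2 ∈ image e '' 𝒞 := by
    refine sphere_mem_of_planar_annulus ?_ ?_ ?_
    · rintro _ ⟨C, hC, rfl⟩
      exact (hcirc C hC).image he
    · rintro _ ⟨C, hC, rfl⟩ _ ⟨D, hD, rfl⟩ hne
      exact (disjoint_image_iff he.injective).mpr (hdisj C hC D hD fun h ↦ hne (h ▸ rfl))
    · rw [← image_sUnion, hunion, image_univ, hrange]
  rwa [← hCs, preimage_image_eq _ he.injective]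

/-- Polar coordinates with radius given by an affine function onto `[1, 2]`. -/
theorem isEmbedding_annulus {r : Icc (0 : ℝ) 1 → ℝ} (hr : Continuous r)
    (hinj : Function.Injective r) (hrange : range r = Icc 1 2) :
    IsEmbedding (fun p : Circle × Icc (0 : ℝ) 1 ↦ (r p.2 : ℂ) * p.1) ∧
      range (fun p : Circle × Icc (0 : ℝ) 1 ↦ (r p.2 : ℂ) * p.1) =
        {z : ℂ | 1 ≤ ‖z‖ ∧ ‖z‖ ≤ 2} := by
  have hmem (t) : r t ∈ Icc 1 2 := hrange ▸ mem_range_self t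
  have hpos (t) : 0 < r t := one_pos.trans_le (hmem t).1
  have hnorm (p : Circle × Icc (0 : ℝ) 1) : ‖(r p.2 : ℂ) * p.1‖ = r p.2 := by
    simp [abs_of_pos (hpos _), Circle.norm_coe]
  constructor
  · refine (Continuous.isClosedEmbedding (by fun_prop) fun p q hpq ↦ ?_).isEmbedding
    have h₂ : r p.2 = r q.2 := by rw [← hnorm p, ← hnorm q]; exact congrArg norm hpq
    simp only [h₂] at hpq
    have h₁ := mul_left_cancel₀ (Complex.ofReal_ne_zero.mpr (hpos _).ne') hpq
    exact Prod.ext (Circle.ext h₁) (hinj h₂)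
  · ext z
    constructor
    · rintro ⟨p, rfl⟩
      simp only [mem_ofPred_eq, hnorm]
      exact hmem p.2
    · intro hz
      obtain ⟨t, ht⟩ : ‖z‖ ∈ range r := hrange ▸ hz
      refine ⟨(Circle.exp z.arg, t), ?_⟩
      simp only [ht, Circle.coe_exp]
      exact Complex.norm_mul_exp_arg_mul_I z

/-- If `𝒞` is a circle decomposition of the annulus `A = Circle × [0,1]`, then both
boundary circles `C₀` and `C₁` belong to `𝒞`. -/
theorem boundary_circles_mem_circle_decomposition
    (𝒞 : Set (Set (Circle × Set.Icc (0:ℝ) 1))) (h𝒞 : IsCircleDecomposition 𝒞) :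
    {p : Circle × Set.Icc (0:ℝ) 1 | (p.2 : ℝ) = 0} ∈ 𝒞 ∧
    {p : Circle × Set.Icc (0:ℝ) 1 | (p.2 : ℝ) = 1} ∈ 𝒞 := by
  constructor
  · obtain ⟨he, hrange⟩ := isEmbedding_annulus (r := fun t ↦ 2 - t) (by fun_prop)
      (fun s t h ↦ Subtype.ext (sub_right_injective h)) (by
        ext x
        refine ⟨?_, fun hx ↦ ⟨⟨2 - x, by linarith [hx.2], by linarith [hx.1]⟩, by simp⟩⟩
        rintro ⟨t, rfl⟩
        exact ⟨by linarith [t.2.2], by linarith [t.2.1]⟩)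
    convert preimage_sphere_mem_circleDecomposition h𝒞 he hrange using 1
    ext p
    have hp : 0 ≤ 2 - (p.2 : ℝ) := by linarith [p.2.2.2]
    simp only [mem_ofPred_eq, mem_preimage, mem_sphere_zero_iff_norm, norm_mul, Circle.norm_coe,
      mul_one, Complex.norm_real, Real.norm_eq_abs, abs_of_nonneg hp]
    constructor <;> intro h <;> linarith
  · obtain ⟨he, hrange⟩ := isEmbedding_annulus (r := fun t ↦ 1 + t) (by fun_prop)
      (fun s t h ↦ Subtype.ext (add_right_injective 1 h)) (by
        ext x
        refine ⟨?_, fun hx ↦ ⟨⟨x - 1, by linarith [hx.1], by linarith [hx.2]⟩, by simp⟩⟩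
        rintro ⟨t, rfl⟩
        exact ⟨by linarith [t.2.1], by linarith [t.2.2]⟩)
    convert preimage_sphere_mem_circleDecomposition h𝒞 he hrange using 1
    ext p
    have hp : 0 ≤ 1 + (p.2 : ℝ) := by linarith [p.2.2.1]
    simp only [mem_ofPred_eq, mem_preimage, mem_sphere_zero_iff_norm, norm_mul, Circle.norm_coe,
      mul_one, Complex.norm_real, Real.norm_eq_abs, abs_of_nonneg hp]
    constructor <;> intro h <;> linarith
end
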